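/- (Effective prime ideal theorem) Let K be a number field. There exist constants C₁, C₂ > 0 such that for all sufficiently large X, |π(K;X) − Li(X)| ≤ C₁·X·exp(−C₂·√(log X)), where π(K;X) is the number of prime ideals of O_K of norm at most X. -/

import Mathlib

open NumberField Ideal Filter

noncomputable section

namespace AlladiGen

variable (K : Type*) [Field K] [NumberField K]

open Classical in
/-- The generalized Möbius function on integral ideals. -/
def muK (a : Ideal (𝓞 K)) : ℤ :=
  if Squarefree a then (-1) ^ (Nat.card {p : Ideal (𝓞 K) // p.IsPrime ∧ a ≤ p}) else 0

/-- `p` is a prime ideal of minimal norm among those containing `a`. -/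
def MinimalPrime (a p : Ideal (𝓞 K)) : Prop :=
  p.IsPrime ∧ a ≤ p ∧ ∀ q : Ideal (𝓞 K), q.IsPrime → a ≤ q → absNorm p ≤ absNorm q

/-- `a ∈ D(K,S)`: `a` is distinguishable with minimal prime in `S`. -/
def InD (S : Set (Ideal (𝓞 K))) (a : Ideal (𝓞 K)) : Prop :=
  ∃ p : Ideal (𝓞 K), MinimalPrime K a p ∧ p ∈ S ∧ ∀ q : Ideal (𝓞 K), MinimalPrime K a q → q = p

/-- `π_S(K; X)`: number of prime ideals in `S` of norm at most `X`. -/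
def primeCount (S : Set (Ideal (𝓞 K))) (X : ℝ) : ℕ :=
  Nat.card {p : Ideal (𝓞 K) // p.IsPrime ∧ p ∈ S ∧ (absNorm p : ℝ) ≤ X}

/-- `S` has natural density `δ` within the prime ideals of `K`. -/
def HasPrimeDensity (S : Set (Ideal (𝓞 K))) (δ : ℝ) : Prop :=
  Tendsto (fun X : ℝ => (primeCount K S X : ℝ) / (primeCount K Set.univ X : ℝ))
    atTop (nhds δ)

/-- `M(a)`: the maximal norm of a prime ideal containing `a`. -/
def maxNorm (a : Ideal (𝓞 K)) : ℕ :=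
  sSup (absNorm '' {p : Ideal (𝓞 K) | p.IsPrime ∧ a ≤ p})

/-- `Q_S(a)`: number of primes in `S` containing `a` of maximal norm. -/
def QS (S : Set (Ideal (𝓞 K))) (a : Ideal (𝓞 K)) : ℕ :=
  Nat.card {p : Ideal (𝓞 K) // p.IsPrime ∧ a ≤ p ∧ p ∈ S ∧ absNorm p = maxNorm K a}

/-- `c_K`: residue of the Dedekind zeta function at 1, via the analytic class number formula. -/
def cK : ℝ :=
  (2 ^ (InfinitePlace.nrRealPlaces K) * (2 * Real.pi) ^ (InfinitePlace.nrComplexPlaces K) *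
    NumberField.Units.regulator K * (NumberField.classNumber K)) /
  ((NumberField.Units.torsionOrder K : ℝ) * Real.sqrt |(NumberField.discr K : ℝ)|)

/-- `Ψ(X,Y)`: number of `Y`-smooth nonzero integral ideals of norm at most `X`. -/
def Psi (X Y : ℝ) : ℕ :=
  Nat.card {a : Ideal (𝓞 K) // a ≠ ⊥ ∧ (absNorm a : ℝ) ≤ X ∧
    ∀ p : Ideal (𝓞 K), p.IsPrime → a ≤ p → (absNorm p : ℝ) ≤ Y}

/-- `[X]_K`: number of nonzero integral ideals of norm at most `X`. -/
def idealCount (X : ℝ) : ℕ := Nat.card {a : Ideal (𝓞 K) // a ≠ ⊥ ∧ (absNorm a : ℝ) ≤ X}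

/-- The logarithmic integral `Li(X) = ∫_2^X dt / log t`. -/
def Li (X : ℝ) : ℝ := ∫ t in (2:ℝ)..X, 1 / Real.log t

end AlladiGen

namespace EPI

open Metric Topology in
/-- finite factorization of an analytic function on a closed disc -/
theorem exists_factorization {f : ℂ → ℂ} {R : ℝ} (hR : 0 < R)
    (hf : AnalyticOnNhd ℂ f (closedBall 0 R)) (hf0 : f 0 ≠ 0) :
    ∃ (S : Finset ℂ) (m : ℂ → ℕ) (g : ℂ → ℂ), (∀ u ∈ S, u ∈ closedBall (0:ℂ) R ∧ m u ≠ 0) ∧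
      AnalyticOnNhd ℂ g (closedBall 0 R) ∧ (∀ u ∈ closedBall (0:ℂ) R, g u ≠ 0) ∧
      ∀ z ∈ closedBall (0:ℂ) R, f z = (∏ u ∈ S, (z - u) ^ m u) * g z := by
  have h0 : (0:ℂ) ∈ closedBall (0:ℂ) R := mem_closedBall_self hR.le
  have hmer : MeromorphicOn f (closedBall 0 R) := hf.meromorphicOn
  have hord : ∀ u : closedBall (0:ℂ) R, meromorphicOrderAt f u ≠ ⊤ := by
    have hconn : IsConnected (closedBall (0:ℂ) R) :=
      ⟨⟨0, h0⟩, (convex_closedBall (0:ℂ) R).isPreconnected⟩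
    have := hmer.exists_meromorphicOrderAt_ne_top_iff_forall hconn
    refine this.1 ⟨⟨0, h0⟩, ?_⟩
    have : meromorphicOrderAt f 0 = 0 :=
      ((hf 0 h0).meromorphicNFAt.meromorphicOrderAt_eq_zero_iff).2 hf0
    simp [this]
  have hfin : (MeromorphicOn.divisor f (closedBall (0:ℂ) R)).support.Finite :=
    (MeromorphicOn.divisor f (closedBall (0:ℂ) R)).finiteSupport (isCompact_closedBall 0 R)
  obtain ⟨g, hg, hg0, hfg⟩ := hmer.extract_zeros_poles hord hfin
  set D := MeromorphicOn.divisor f (closedBall (0:ℂ) R) with hD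
  have hDnn : 0 ≤ D := MeromorphicOn.AnalyticOnNhd.divisor_nonneg hf
  have hprod : ∀ z, (∏ᶠ u, (fun z : ℂ => z - u) ^ D u) z
      = ∏ u ∈ hfin.toFinset, (z - u) ^ (D u).toNat := by
    intro z
    rw [finprod_eq_prod_of_mulSupport_subset (s := hfin.toFinset)]
    · rw [Finset.prod_apply]
      refine Finset.prod_congr rfl fun u hu => ?_
      obtain ⟨k, hk⟩ := Int.eq_ofNat_of_zero_le (hDnn u)
      rw [Pi.pow_apply, hk, zpow_natCast, Int.toNat_natCast]
    · intro u hu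
      simp only [Function.mem_mulSupport] at hu
      simp only [Set.Finite.coe_toFinset, Function.mem_support]
      intro h; apply hu; rw [h]; simp
  refine ⟨hfin.toFinset, fun u => (D u).toNat, g, ?_, hg, fun u hu => hg0 ⟨u, hu⟩, ?_⟩
  · intro u hu
    simp only [Set.Finite.mem_toFinset, Function.mem_support] at hu
    refine ⟨?_, ?_⟩
    · by_contra h
      exact hu (Function.locallyFinsuppWithin.apply_eq_zero_of_notMem _ h)
    · obtain ⟨k, hk⟩ := Int.eq_ofNat_of_zero_le (hDnn u)
      change (D u).toNat ≠ 0
      rw [hk] at hu ⊢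
      rw [Int.toNat_natCast]
      exact_mod_cast hu
  · set F : ℂ → ℂ := fun z => (∏ u ∈ hfin.toFinset, (z - u) ^ (D u).toNat) * g z with hF
    have hFc : ContinuousOn F (closedBall 0 R) := by
      refine ContinuousOn.mul ?_ hg.continuousOn
      fun_prop
    have hev : f =ᶠ[codiscreteWithin (closedBall (0:ℂ) R)] F := by
      filter_upwards [hfg] with z hz
      rw [hz, Pi.smul_apply', hprod, smul_eq_mul]
    -- equality on the open ball
    have hball : ∀ z ∈ ball (0:ℂ) R, f z = F z := by
      intro z hz
      have hz' : closedBall (0:ℂ) R ∈ 𝓝 z := mem_of_superset (isOpen_ball.mem_nhds hz) ball_subset_closedBall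
      have h1 : ∀ᶠ w in 𝓝[≠] z, f w = F w := by
        have := (mem_codiscreteWithin.1 hev) z (mem_of_mem_nhds hz')
        rw [disjoint_principal_right] at this
        filter_upwards [this, nhdsWithin_le_nhds hz'] with w hw hw2
        by_contra hne
        exact hw ⟨hw2, hne⟩
      have c1 : Tendsto f (𝓝[≠] z) (𝓝 (f z)) :=
        ((hf z (ball_subset_closedBall hz)).continuousAt).tendsto.mono_left nhdsWithin_le_nhds
      have c2 : Tendsto F (𝓝[≠] z) (𝓝 (F z)) :=
        (hFc.continuousAt hz').tendsto.mono_left nhdsWithin_le_nhds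
      exact tendsto_nhds_unique (c1.congr' h1) c2
    intro z hz
    have := Set.EqOn.closure (s := ball (0:ℂ) R) (f := f) (g := F)
    have h2 : Set.EqOn f F (closedBall 0 R) := by
      refine Set.EqOn.of_subset_closure (s := ball (0:ℂ) R) hball hf.continuousOn hFc
        ball_subset_closedBall ?_
      rw [closure_ball _ hR.ne']
    exact h2 hz

end EPI

namespace EPI

open Metric Topology in
/-- existence of a logarithm and Borel-Caratheodory bound of the log-derivative -/
theorem logDeriv_bound {h : ℂ → ℂ} {c : ℂ} {R M : ℝ} (hR : 0 < R) (hM : 0 < M)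
    (hd : DifferentiableOn ℂ h (ball c R)) (hne : ∀ z ∈ ball c R, h z ≠ 0)
    (hb : ∀ z ∈ ball c R, ‖h z‖ ≤ Real.exp M * ‖h c‖) {z : ℂ} (hz : ‖z - c‖ ≤ R / 2) :
    ‖logDeriv h z‖ ≤ 24 * M / R := by
  have hc : c ∈ ball c R := mem_ball_self hR
  have hdd : DifferentiableOn ℂ (logDeriv h) (ball c R) := by
    have : DifferentiableOn ℂ (deriv h) (ball c R) := hd.deriv isOpen_ball
    exact this.div hd hne
  obtain ⟨L0, hL0⟩ := hdd.isExactOn_ball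
  set L : ℂ → ℂ := fun w => L0 w - L0 c with hL
  have hLd : ∀ w ∈ ball c R, HasDerivAt L (logDeriv h w) w := fun w hw => (hL0 w hw).sub_const _
  have hexp : ∀ w ∈ ball c R, h w = h c * Complex.exp (L w) := by
    have hq : ∀ w ∈ ball c R, HasDerivAt (fun w => h w * Complex.exp (-L w)) 0 w := by
      intro w hw
      have h1 := (hd.differentiableAt (isOpen_ball.mem_nhds hw)).hasDerivAt.mul ((hLd w hw).neg.cexp)
      have key : deriv h w * Complex.exp ((-L) w) + h w * (Complex.exp ((-L) w) * -logDeriv h w) = 0 := by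
        have := hne w hw
        rw [logDeriv_apply]
        field_simp
        ring
      rw [key] at h1
      exact h1
    intro w hw
    have := (convex_ball c R).is_const_of_fderivWithin_eq_zero (𝕜 := ℂ)
      (f := fun w => h w * Complex.exp (-L w))
      (fun w hw => (hq w hw).differentiableAt.differentiableWithinAt)
      (fun w hw => by
        rw [fderivWithin_of_isOpen isOpen_ball hw]
        ext
        simp [(hq w hw).deriv]) hw hc
    simp only [hL, sub_self, neg_zero, Complex.exp_zero, mul_one] at this
    rw [← this, mul_assoc, ← Complex.exp_add]
    simp [hL]
  have hre : ∀ w ∈ ball c R, (L w).re ≤ M := by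
    intro w hw
    have h1 := hb w hw
    rw [hexp w hw, norm_mul, Complex.norm_exp, mul_comm] at h1
    have h2 : 0 < ‖h c‖ := norm_pos_iff.2 (hne c hc)
    exact Real.exp_le_exp.1 (le_of_mul_le_mul_right h1 h2)
  have hbc : ∀ w ∈ closedBall z (R / 4), ‖L w‖ ≤ 6 * M := by
    intro w hw
    have hwc : ‖w - c‖ ≤ 3 * R / 4 := by
      have h1 : ‖w - z‖ ≤ R / 4 := by simpa [dist_eq_norm] using hw
      calc ‖w - c‖ = ‖(w - z) + (z - c)‖ := by ring_nf
        _ ≤ _ := norm_add_le _ _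
        _ ≤ _ := by linarith
    have hmaps : ∀ v ∈ ball (0:ℂ) R, c + v ∈ ball c R := by
      intro v hv; simpa [dist_eq_norm] using hv
    have := Complex.borelCaratheodory_zero (f := fun v => L (c + v)) (z := w - c) (R := R) hM
      (by
        intro v hv
        have := (hLd (c + v) (hmaps v hv)).differentiableAt
        exact (this.comp v (by fun_prop)).differentiableWithinAt)
      (fun v hv => hre _ (hmaps v hv)) hR (by simp; linarith) (by simp [hL])
    simp only [add_sub_cancel] at this
    refine this.trans ?_
    rw [div_le_iff₀ (by linarith)]
    nlinarith
  have hsub : closedBall z (R / 4) ⊆ ball c R := by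
    intro w hw
    have h1 : ‖w - z‖ ≤ R / 4 := by simpa [dist_eq_norm] using hw
    rw [mem_ball, dist_eq_norm]
    calc ‖w - c‖ = ‖(w - z) + (z - c)‖ := by ring_nf
        _ ≤ _ := norm_add_le _ _
        _ < _ := by linarith
  have hzb : z ∈ ball c R := hsub (mem_closedBall_self (by linarith))
  have hdl : DifferentiableOn ℂ L (ball c R) := fun w hw => (hLd w hw).differentiableAt.differentiableWithinAt
  have := Complex.norm_deriv_le_of_forall_mem_sphere_norm_le (f := L) (c := z) (R := R / 4) (C := 6 * M)
    (by linarith) (DifferentiableOn.diffContOnCl (by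
      rw [closure_ball _ (by linarith)]; exact hdl.mono hsub)) (fun w hw => hbc w (sphere_subset_closedBall hw))
  rw [(hLd z hzb).deriv] at this
  refine this.trans (le_of_eq ?_)
  field_simp
  ring

open Metric Topology in
theorem landau_zero {f : ℂ → ℂ} {R M : ℝ} (hR : 0 < R) (hM : 0 < M)
    (hf : AnalyticOnNhd ℂ f (closedBall 0 R)) (hf0 : f 0 ≠ 0)
    (hb : ∀ z ∈ sphere (0:ℂ) R, ‖f z‖ ≤ Real.exp M * ‖f 0‖)
    (hz : ∀ z ∈ closedBall (0:ℂ) R, f z = 0 → z.re < 0) :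
    -(24 * M / R) ≤ (logDeriv f 0).re ∧ ∀ β : ℝ, 0 < β → β ≤ R → f (-β) = 0 →
      -(24 * M / R) + 1 / β - 1 / R ≤ (logDeriv f 0).re := by
  obtain ⟨S, m, g, hS, hg, hg0, hfg⟩ := exists_factorization hR hf hf0
  have h0 : (0:ℂ) ∈ closedBall (0:ℂ) R := mem_closedBall_self hR.le
  have hfS : ∀ u ∈ S, f u = 0 := by
    intro u hu
    rw [hfg u (hS u hu).1, Finset.prod_eq_zero hu, zero_mul]
    simp [(hS u hu).2]
  have hSre : ∀ u ∈ S, u.re < 0 := fun u hu => hz u (hS u hu).1 (hfS u hu)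
  have hSne : ∀ u ∈ S, u ≠ 0 := by
    intro u hu h; have := hSre u hu; simp [h] at this
  have hSn : ∀ u ∈ S, ‖u‖ ≤ R := fun u hu => by simpa using (hS u hu).1
  have hRc : (R:ℂ) ≠ 0 := by exact_mod_cast hR.ne'
  set b : ℂ → ℂ → ℂ := fun u z => ((R:ℂ) ^ 2 - (starRingEnd ℂ) u * z) / R with hbdef
  set h : ℂ → ℂ := fun z => (∏ u ∈ S, (b u z) ^ m u) * g z with hh
  have hbd : ∀ u, Differentiable ℂ (b u) := by intro u; simp only [hbdef]; fun_prop
  have hPd : Differentiable ℂ (fun z => ∏ u ∈ S, (b u z) ^ m u) := by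
    refine Differentiable.fun_finsetProd (fun u _ => (hbd u).pow _)
  have hbne : ∀ u ∈ S, ∀ z ∈ ball (0:ℂ) R, b u z ≠ 0 := by
    intro u hu z hz hzero
    simp only [hbdef, div_eq_zero_iff, hRc, or_false] at hzero
    have h1 : ‖(R:ℂ) ^ 2‖ = ‖(starRingEnd ℂ) u * z‖ := by rw [sub_eq_zero.1 hzero]
    rw [norm_mul, RCLike.norm_conj, norm_pow, Complex.norm_real, Real.norm_of_nonneg hR.le] at h1
    have h2 : ‖z‖ < R := by simpa using hz
    nlinarith [hSn u hu, norm_nonneg u, norm_nonneg z]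
  have hhd : DifferentiableOn ℂ h (closedBall 0 R) := hPd.differentiableOn.mul hg.differentiableOn
  have hhne : ∀ z ∈ ball (0:ℂ) R, h z ≠ 0 := by
    intro z hz
    refine mul_ne_zero (Finset.prod_ne_zero_iff.2 fun u hu => pow_ne_zero _ (hbne u hu z hz))
      (hg0 z (ball_subset_closedBall hz))
  have hsph : ∀ z ∈ sphere (0:ℂ) R, ‖h z‖ = ‖f z‖ := by
    intro z hz
    have hzn : ‖z‖ = R := by simpa using hz
    rw [hfg z (sphere_subset_closedBall hz), hh, norm_mul, norm_mul, norm_prod, norm_prod]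
    congr 1
    refine Finset.prod_congr rfl fun u hu => ?_
    rw [norm_pow, norm_pow]
    congr 1
    have : b u z = (starRingEnd ℂ) (z - u) * z / R := by
      simp only [hbdef]
      congr 1
      rw [map_sub, sub_mul, ← Complex.normSq_eq_conj_mul_self, Complex.normSq_eq_norm_sq, hzn]
      push_cast; ring
    rw [this, norm_div, norm_mul, RCLike.norm_conj, hzn, Complex.norm_real, Real.norm_of_nonneg hR.le]
    field_simp
  have hh0 : ‖f 0‖ ≤ ‖h 0‖ := by
    rw [hfg 0 h0, hh, norm_mul, norm_mul, norm_prod, norm_prod]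
    refine mul_le_mul_of_nonneg_right ?_ (norm_nonneg _)
    refine Finset.prod_le_prod (fun _ _ => norm_nonneg _) fun u hu => ?_
    rw [norm_pow, norm_pow]
    refine pow_le_pow_left₀ (norm_nonneg _) ?_ _
    have : b u 0 = R := by simp only [hbdef]; field_simp; simp
    rw [this, Complex.norm_real, Real.norm_of_nonneg hR.le]
    simpa using hSn u hu
  have hhb : ∀ z ∈ ball (0:ℂ) R, ‖h z‖ ≤ Real.exp M * ‖h 0‖ := by
    intro z hz
    refine Complex.norm_le_of_forall_mem_frontier_norm_le (U := ball (0:ℂ) R) isBounded_ball ?_ ?_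
      (subset_closure hz)
    · refine DifferentiableOn.diffContOnCl ?_
      rwa [closure_ball _ hR.ne']
    · intro w hw
      rw [frontier_ball _ hR.ne'] at hw
      rw [hsph w hw]
      exact (hb w hw).trans (by gcongr)
  have hld := logDeriv_bound hR hM (hhd.mono ball_subset_closedBall) hhne hhb (z := 0) (by simp; linarith)
  have hgd : DifferentiableAt ℂ g 0 := (hg 0 h0).differentiableAt
  have e1 : logDeriv h 0 = (∑ u ∈ S, (m u : ℂ) * (-(starRingEnd ℂ) u / R ^ 2)) + logDeriv g 0 := by
    have hb0 : ∀ u ∈ S, b u 0 ^ m u ≠ 0 := fun u hu => pow_ne_zero _ (hbne u hu 0 (mem_ball_self hR))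
    rw [hh, logDeriv_mul 0 (Finset.prod_ne_zero_iff.2 hb0) (hg0 0 h0) hPd.differentiableAt hgd,
      logDeriv_prod (f := fun u z => b u z ^ m u) hb0 (fun u _ => ((hbd u).pow _).differentiableAt)]
    congr 1
    refine Finset.sum_congr rfl fun u hu => ?_
    rw [logDeriv_fun_pow (hbd u).differentiableAt]
    congr 1
    have hdv : HasDerivAt (b u) (-(starRingEnd ℂ) u / R) 0 := by
      have := (((hasDerivAt_id (0:ℂ)).const_mul ((starRingEnd ℂ) u)).const_sub ((R:ℂ)^2)).div_const (R:ℂ)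
      simpa using this
    rw [logDeriv_apply, hdv.deriv]
    simp only [hbdef]; simp; field_simp
  have e2 : logDeriv f 0 = (∑ u ∈ S, (m u : ℂ) * (-1 / u)) + logDeriv g 0 := by
    have hfe : f =ᶠ[𝓝 0] fun z => (∏ u ∈ S, (z - u) ^ m u) * g z := by
      filter_upwards [closedBall_mem_nhds (0:ℂ) hR] with z hz using hfg z hz
    have hb0 : ∀ u ∈ S, (0 - u) ^ m u ≠ 0 := fun u hu => pow_ne_zero _ (by simpa using hSne u hu)
    have : logDeriv f 0 = logDeriv (fun z => (∏ u ∈ S, (z - u) ^ m u) * g z) 0 := by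
      rw [logDeriv_apply, logDeriv_apply, hfe.deriv_eq, hfe.eq_of_nhds]
    rw [this, logDeriv_mul 0 (Finset.prod_ne_zero_iff.2 hb0) (hg0 0 h0) (by fun_prop) hgd,
      logDeriv_prod hb0 (fun u _ => by fun_prop)]
    congr 1
    refine Finset.sum_congr rfl fun u hu => ?_
    rw [logDeriv_fun_pow (by fun_prop)]
    congr 1
    rw [logDeriv_apply]
    simp only [deriv_sub_const_fun, deriv_id'', zero_sub]
    rw [div_neg, neg_div]
  set T : ℂ → ℝ := fun u => u.re * (1 / R ^ 2 - 1 / ‖u‖ ^ 2) with hT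
  have e3 : (logDeriv f 0).re = (logDeriv h 0).re + ∑ u ∈ S, (m u : ℝ) * T u := by
    have : logDeriv f 0 = logDeriv h 0 + ∑ u ∈ S, (m u : ℂ) * (-1 / u + (starRingEnd ℂ) u / R ^ 2) := by
      rw [e1, e2]
      have : ∑ u ∈ S, (m u : ℂ) * (-1 / u + (starRingEnd ℂ) u / R ^ 2) = ∑ u ∈ S, (m u : ℂ) * (-1 / u)
        - ∑ u ∈ S, (m u : ℂ) * (-(starRingEnd ℂ) u / R ^ 2) := by
        rw [← Finset.sum_sub_distrib]
        refine Finset.sum_congr rfl fun u _ => by ring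
      rw [this]; ring
    rw [this, Complex.add_re, Complex.re_sum]
    congr 1
    refine Finset.sum_congr rfl fun u hu => ?_
    have hk : ((R:ℂ) ^ 2) = ((R ^ 2 : ℝ) : ℂ) := by push_cast; ring
    rw [← Complex.ofReal_natCast, Complex.re_ofReal_mul, Complex.add_re, hk, Complex.div_ofReal_re,
      Complex.conj_re, neg_div, one_div, Complex.neg_re, Complex.inv_re, Complex.normSq_eq_norm_sq]
    simp only [hT]; ring
  have hTnn : ∀ u ∈ S, 0 ≤ T u := by
    intro u hu
    have hun : 0 < ‖u‖ := norm_pos_iff.2 (hSne u hu)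
    refine mul_nonneg_of_nonpos_of_nonpos (hSre u hu).le (sub_nonpos.2 ?_)
    gcongr
    exact hSn u hu
  have hlre : -(24 * M / R) ≤ (logDeriv h 0).re := by
    have := (abs_le.1 ((Complex.abs_re_le_norm _).trans hld)).1
    linarith
  have hmT : ∀ u ∈ S, 0 ≤ (m u : ℝ) * T u := fun u hu => mul_nonneg (Nat.cast_nonneg _) (hTnn u hu)
  refine ⟨?_, ?_⟩
  · rw [e3]
    have := Finset.sum_nonneg hmT
    linarith
  · intro β hβ hβR hfβ
    have hmem : (-β : ℂ) ∈ S := by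
      by_contra hnot
      have hβb : (-β : ℂ) ∈ closedBall (0:ℂ) R := by
        simp [abs_of_pos hβ, hβR]
      rw [hfg _ hβb, mul_eq_zero, or_iff_left (hg0 _ hβb), Finset.prod_eq_zero_iff] at hfβ
      obtain ⟨u, hu, hu0⟩ := hfβ
      have := (pow_eq_zero_iff (hS u hu).2).1 hu0
      rw [sub_eq_zero] at this
      exact hnot (this ▸ hu)
    rw [e3]
    have h1 := Finset.single_le_sum hmT hmem
    have hT1 : T (-β) = 1 / β - β / R ^ 2 := by
      simp only [hT, norm_neg, Complex.norm_real, Real.norm_of_nonneg hβ.le, Complex.neg_re, Complex.ofReal_re]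
      field_simp
      ring
    have hm1 : (1:ℝ) ≤ m (-β) := by exact_mod_cast Nat.one_le_iff_ne_zero.2 (hS _ hmem).2
    have h2 : T (-β) ≤ (m (-β) : ℝ) * T (-β) := le_mul_of_one_le_left (hTnn _ hmem) hm1
    have h3 : β / R ^ 2 ≤ 1 / R := by
      rw [div_le_div_iff₀ (by positivity) hR]; nlinarith
    linarith

open Metric Topology in
theorem landau {f : ℂ → ℂ} {c : ℂ} {R M : ℝ} (hR : 0 < R) (hM : 0 < M)
    (hf : AnalyticOnNhd ℂ f (closedBall c R)) (hf0 : f c ≠ 0)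
    (hb : ∀ z ∈ sphere c R, ‖f z‖ ≤ Real.exp M * ‖f c‖)
    (hz : ∀ z ∈ closedBall c R, f z = 0 → z.re < c.re) :
    -(24 * M / R) ≤ (logDeriv f c).re ∧ ∀ β : ℝ, 0 < β → β ≤ R → f (c - β) = 0 →
      -(24 * M / R) + 1 / β - 1 / R ≤ (logDeriv f c).re := by
  have hmaps : ∀ z ∈ closedBall (0:ℂ) R, c + z ∈ closedBall c R := by
    intro v hv; simpa [dist_eq_norm] using hv
  have hlog : logDeriv (fun z => f (c + z)) 0 = logDeriv f c := by
    rw [logDeriv_apply, logDeriv_apply, deriv_comp_const_add]; simp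
  have := landau_zero (f := fun z => f (c + z)) hR hM
    (fun z hz => (hf (c + z) (hmaps z hz)).comp_of_eq (by fun_prop) rfl) (by simpa using hf0)
    (fun z hz => by
      simpa using hb (c + z) (by simpa [dist_eq_norm] using hz))
    (fun z hz' h => by
      have := hz (c + z) (hmaps z hz') h
      simpa using this)
  rw [hlog] at this
  simpa [sub_eq_add_neg] using this

end EPI

namespace EPI

/-- `τ(t) = log(|t|+3)` -/
def tau (t : ℝ) : ℝ := Real.log (|t| + 3)

lemma one_le_tau (t : ℝ) : 1 ≤ tau t := by
  unfold tau
  rw [Real.le_log_iff_exp_le (by positivity)]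
  have := Real.exp_one_lt_d9
  have := abs_nonneg t
  linarith

lemma tau_pos (t : ℝ) : 0 < tau t := by linarith [one_le_tau t]

lemma tau_mono {s t : ℝ} (h : |s| ≤ |t|) : tau s ≤ tau t := by
  unfold tau
  exact Real.log_le_log (by positivity) (by linarith)

lemma tau_le_two {s t : ℝ} (h : |s| ≤ 2 * |t| + 1) : tau s ≤ 2 * tau t := by
  unfold tau
  have h2 : 2 * Real.log (|t| + 3) = Real.log ((|t| + 3) ^ 2) := by rw [Real.log_pow]; norm_num
  rw [h2]
  exact Real.log_le_log (by positivity) (by nlinarith [abs_nonneg t])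

lemma re_term (Λ : ℕ → ℝ) (s : ℂ) (n : ℕ) : (LSeries.term (fun n => (Λ n : ℂ)) s n).re =
    if n = 0 then 0 else Λ n * ((n : ℝ) ^ (-s.re) * Real.cos (s.im * Real.log n)) := by
  split_ifs with hn
  · simp [hn]
  · rw [LSeries.term_of_ne_zero hn, div_eq_mul_inv, ← Complex.cpow_neg, Complex.re_ofReal_mul]
    congr 1
    have hn' : (0:ℝ) < n := by exact_mod_cast Nat.pos_of_ne_zero hn
    rw [Complex.cpow_def_of_ne_zero (by exact_mod_cast hn), ← Complex.natCast_log, Complex.exp_re,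
      Real.rpow_def_of_pos hn']
    simp only [Complex.mul_re, Complex.ofReal_re, Complex.neg_re, Complex.ofReal_im, zero_mul, sub_zero,
      Complex.mul_im, Complex.neg_im, add_zero]
    congr 1
    rw [← Real.cos_neg]
    congr 1
    ring

/-- The analytic input. -/
structure Hyp (H : ℂ → ℂ) (Λ : ℕ → ℝ) (δ A c : ℝ) : Prop where
  δ_pos : 0 < δ
  δ_le : δ ≤ 1
  A_pos : 0 < A
  c_pos : 0 < c
  c_le : c ≤ 1
  hol : DifferentiableOn ℂ H {s | 1 - δ < s.re}
  growth : ∀ s : ℂ, 1 - δ < s.re → s.re ≤ 3 → ‖H s‖ ≤ Real.exp (A * tau s.im)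
  lower : ∀ s : ℂ, 1 < s.re → s.re ≤ 2 → c * (s.re - 1) ^ 2 ≤ ‖H s‖
  one : H 1 ≠ 0
  nonneg : ∀ n, 0 ≤ Λ n
  summ : ∀ s : ℂ, 1 < s.re → LSeriesSummable (fun n => (Λ n : ℂ)) s
  eq : ∀ s : ℂ, 1 < s.re → LSeries (fun n => (Λ n : ℂ)) s = 1 / (s - 1) - logDeriv H s

namespace Hyp
variable {H : ℂ → ℂ} {Λ : ℕ → ℝ} {δ A c : ℝ}

lemma ne_zero (h : Hyp H Λ δ A c) {s : ℂ} (h1 : 1 < s.re) (h2 : s.re ≤ 2) : H s ≠ 0 := by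
  rw [← norm_pos_iff]
  refine lt_of_lt_of_le ?_ (h.lower s h1 h2)
  have := h.c_pos
  have : 0 < s.re - 1 := by linarith
  positivity

lemma norm_term (h : Hyp H Λ δ A c) (s : ℂ) (n : ℕ) :
    ‖LSeries.term (fun n => (Λ n : ℂ)) s n‖ = (LSeries.term (fun n => (Λ n : ℂ)) (s.re : ℂ) n).re := by
  rw [re_term, LSeries.norm_term_eq]
  split_ifs with hn
  · rfl
  · simp [abs_of_nonneg (h.nonneg n), Real.rpow_neg, div_eq_mul_inv]

lemma norm_le (h : Hyp H Λ δ A c) {s : ℂ} (h1 : 1 < s.re) :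
    ‖LSeries (fun n => (Λ n : ℂ)) s‖ ≤ (LSeries (fun n => (Λ n : ℂ)) (s.re : ℂ)).re := by
  have hs : LSeriesSummable (fun n => (Λ n : ℂ)) (s.re : ℂ) := h.summ _ (by simpa using h1)
  have h2 := (h.summ s h1).norm
  calc _ ≤ ∑' n, ‖LSeries.term (fun n => (Λ n : ℂ)) s n‖ := norm_tsum_le_tsum_norm h2
    _ = ∑' n, (LSeries.term (fun n => (Λ n : ℂ)) (s.re : ℂ) n).re := by
        simp_rw [h.norm_term s]
    _ = _ := (Complex.re_tsum hs).symm

lemma three_four_one (h : Hyp H Λ δ A c) {σ : ℝ} (hσ : 1 < σ) (t : ℝ) :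
    0 ≤ 3 * (LSeries (fun n => (Λ n : ℂ)) (σ : ℂ)).re
      + 4 * (LSeries (fun n => (Λ n : ℂ)) (σ + t * Complex.I)).re
      + (LSeries (fun n => (Λ n : ℂ)) (σ + (2 * t : ℝ) * Complex.I)).re := by
  have e : ∀ u : ℝ, ((σ : ℂ) + u * Complex.I).re = σ := by intro u; simp
  have e' : ∀ u : ℝ, ((σ : ℂ) + u * Complex.I).im = u := by intro u; simp
  have s0 := h.summ (σ : ℂ) (by simpa using hσ)
  have s1 := h.summ ((σ : ℂ) + t * Complex.I) (by rw [e]; exact hσ)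
  have s2 := h.summ ((σ : ℂ) + (2 * t : ℝ) * Complex.I) (by rw [e]; exact hσ)
  have r0 := (Complex.hasSum_re s0.hasSum).mul_left 3
  have r1 := (Complex.hasSum_re s1.hasSum).mul_left 4
  have r2 := (Complex.hasSum_re s2.hasSum)
  refine ((r0.add r1).add r2).nonneg fun n => ?_
  rw [re_term, re_term, re_term, e, e, e', e']
  split_ifs with hn
  · simp
  · have := h.nonneg n
    have hp : 0 ≤ (n : ℝ) ^ (-σ) := by positivity
    set θ := t * Real.log n
    have h2 : Real.cos (2 * t * Real.log n) = 2 * Real.cos θ ^ 2 - 1 := by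
      rw [← Real.cos_two_mul]; congr 1; simp only [θ]; ring
    rw [h2]
    simp only [Complex.ofReal_re, Complex.ofReal_im, zero_mul, Real.cos_zero, mul_one]
    have : 3 * (Λ n * (n : ℝ) ^ (-σ)) + 4 * (Λ n * ((n : ℝ) ^ (-σ) * Real.cos θ))
      + Λ n * ((n : ℝ) ^ (-σ) * (2 * Real.cos θ ^ 2 - 1))
      = Λ n * (n : ℝ) ^ (-σ) * (2 * (1 + Real.cos θ) ^ 2) := by ring
    rw [this]; positivity

lemma isOpen_dom : IsOpen {s : ℂ | 1 - δ < s.re} := isOpen_lt continuous_const Complex.continuous_re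

lemma D_le (h : Hyp H Λ δ A c) : ∃ C : ℝ, 0 ≤ C ∧ ∀ σ : ℝ, 1 < σ → σ ≤ 2 →
    (LSeries (fun n => (Λ n : ℂ)) (σ : ℂ)).re ≤ 1 / (σ - 1) + C := by
  have hδ := h.δ_pos
  have hc : ContinuousOn (fun σ : ℝ => logDeriv H (σ : ℂ)) (Set.Icc 1 2) := by
    have hd : ContinuousOn (deriv H) {s : ℂ | 1 - δ < s.re} := (h.hol.deriv isOpen_dom).continuousOn
    have : ∀ σ ∈ Set.Icc (1:ℝ) 2, (σ : ℂ) ∈ {s : ℂ | 1 - δ < s.re} := by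
      intro σ hσ; simp only [Set.mem_ofPred_eq, Complex.ofReal_re]; linarith [hσ.1]
    refine ContinuousOn.div (hd.comp (by fun_prop) this) (h.hol.continuousOn.comp (by fun_prop) this) ?_
    intro σ hσ
    rcases eq_or_lt_of_le hσ.1 with h1 | h1
    · simpa [← h1] using h.one
    · exact h.ne_zero (by simpa using h1) (by simpa using hσ.2)
  obtain ⟨C, hC⟩ := isCompact_Icc.exists_bound_of_continuousOn hc
  refine ⟨C, (norm_nonneg _).trans (hC 1 (by simp)), fun σ h1 h2 => ?_⟩
  rw [h.eq _ (by simpa using h1), Complex.sub_re]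
  have e1 : (1 / ((σ : ℂ) - 1)).re = 1 / (σ - 1) := by
    rw [← Complex.ofReal_one, ← Complex.ofReal_sub, ← Complex.ofReal_div, Complex.ofReal_re]
  rw [e1]
  have := hC σ ⟨h1.le, h2⟩
  have := (abs_le.1 ((Complex.abs_re_le_norm _).trans this)).1
  linarith

/-- bound of the `M` in Landau's lemma -/
lemma ratio (h : Hyp H Λ δ A c) {s z : ℂ} {t : ℝ} (h1 : 1 < s.re) (h2 : s.re ≤ 2) (hz : 1 - δ < z.re)
    (hz3 : z.re ≤ 3) (him : |z.im| ≤ 2 * |t| + 1) :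
    ‖H z‖ ≤ Real.exp (2 * A * tau t + Real.log (1 / c) + 2 * Real.log (1 / (s.re - 1))) * ‖H s‖ := by
  have ha : 0 < s.re - 1 := by linarith
  have hc := h.c_pos
  have e : Real.exp (2 * A * tau t + Real.log (1 / c) + 2 * Real.log (1 / (s.re - 1)))
      = Real.exp (2 * A * tau t) * (1 / c) * (1 / (s.re - 1)) ^ 2 := by
    rw [Real.exp_add, Real.exp_add, Real.exp_log (by positivity), two_mul (Real.log _), Real.exp_add,
      Real.exp_log (by positivity)]
    ring
  rw [e]
  calc ‖H z‖ ≤ Real.exp (A * tau z.im) := h.growth z hz hz3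
    _ ≤ Real.exp (2 * A * tau t) := by
        rw [mul_comm 2 A, mul_assoc]
        exact Real.exp_le_exp.2 (mul_le_mul_of_nonneg_left (tau_le_two him) h.A_pos.le)
    _ = Real.exp (2 * A * tau t) * (1 / c) * (1 / (s.re - 1)) ^ 2 * (c * (s.re - 1) ^ 2) := by
        field_simp
    _ ≤ _ := by gcongr; exact h.lower s h1 h2

open Metric in
lemma mem_ball_re_im {s z : ℂ} {R : ℝ} (hz : z ∈ closedBall s R) :
    s.re - R ≤ z.re ∧ z.re ≤ s.re + R ∧ |z.im| ≤ |s.im| + R := by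
  rw [mem_closedBall, dist_eq_norm] at hz
  have h1 := (Complex.abs_re_le_norm _).trans hz
  have h2 := (Complex.abs_im_le_norm _).trans hz
  rw [Complex.sub_re, abs_le] at h1
  rw [Complex.sub_im] at h2
  refine ⟨by linarith, by linarith, ?_⟩
  have := abs_sub_abs_le_abs_sub z.im s.im
  linarith

lemma landau_at (h : Hyp H Λ δ A c) {a t u : ℝ} (ha : 0 < a) (ha2 : a ≤ δ / 4) (hu : |u| ≤ 2 * |t|) :
    let M := 2 * A * tau t + Real.log (1 / c) + 2 * Real.log (1 / a)
    let s : ℂ := ((1 + a : ℝ) : ℂ) + u * Complex.I;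
    -(48 * M / δ) ≤ (logDeriv H s).re ∧
    ∀ β : ℝ, 1 - δ / 4 ≤ β → β ≤ 1 → H (β + u * Complex.I) = 0 →
      -(48 * M / δ) + 1 / (1 + a - β) - 2 / δ ≤ (logDeriv H s).re := by
  intro M s
  have hδ := h.δ_pos
  have hδ1 := h.δ_le
  have hsre : s.re = 1 + a := by simp [s]
  have hsim : s.im = u := by simp [s]
  have hMpos : 0 < M := by
    have h1 : 0 ≤ Real.log (1 / c) := Real.log_nonneg (by
      rw [le_div_iff₀ h.c_pos]; linarith [h.c_le])
    have h2 : 0 ≤ Real.log (1 / a) := Real.log_nonneg (by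
      rw [le_div_iff₀ ha]; linarith)
    have h3 := mul_pos h.A_pos (tau_pos t)
    simp only [M]; nlinarith
  have hsub : ∀ z ∈ Metric.closedBall s (δ / 2), 1 - δ < z.re ∧ z.re ≤ 2 ∧ |z.im| ≤ 2 * |t| + 1 := by
    intro z hz
    obtain ⟨h1, h2, h3⟩ := mem_ball_re_im hz
    rw [hsre] at h1 h2
    rw [hsim] at h3
    refine ⟨by linarith, by linarith, by linarith⟩
  have hL := landau (f := H) (c := s) (R := δ / 2) (M := M) (by linarith) hMpos
    (fun z hz => h.hol.analyticAt (isOpen_dom.mem_nhds (hsub z hz).1))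
    (h.ne_zero (by rw [hsre]; linarith) (by rw [hsre]; linarith))
    (fun z hz => by
      obtain ⟨h1, h2, h3⟩ := hsub z (Metric.sphere_subset_closedBall hz)
      have := h.ratio (s := s) (z := z) (t := t) (by rw [hsre]; linarith) (by rw [hsre]; linarith) h1
        (by linarith) h3
      simpa [hsre, M] using this)
    (fun z hz hz0 => by
      obtain ⟨h1, h2, h3⟩ := hsub z hz
      by_contra hcon
      rw [hsre, not_lt] at hcon
      exact h.ne_zero (by linarith) h2 hz0)
  have e : 24 * M / (δ / 2) = 48 * M / δ := by field_simp; norm_num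
  have e2 : 1 / (δ / 2) = 2 / δ := by field_simp
  rw [e, e2] at hL
  refine ⟨hL.1, fun β h1 h2 h3 => hL.2 (1 + a - β) (by linarith) (by linarith) ?_⟩
  rw [← h3]
  congr 1
  simp only [s]; push_cast; ring

set_option maxHeartbeats 1000000 in
/-- the zero-free region -/
theorem zero_free (h : Hyp H Λ δ A c) : ∃ κ : ℝ, 0 < κ ∧ κ ≤ δ / 4 ∧
    ∀ s : ℂ, 1 - κ / tau s.im < s.re → s.re ≤ 2 → H s ≠ 0 := by
  have hδ := h.δ_pos
  have hδ1 := h.δ_le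
  -- near 1
  have hev : ∀ᶠ s in nhds (1:ℂ), H s ≠ 0 := by
    have : ContinuousAt H 1 := (h.hol.continuousOn).continuousAt (isOpen_dom.mem_nhds (by simp; linarith))
    exact this.eventually_ne h.one
  obtain ⟨r, hr, hrb⟩ := Metric.eventually_nhds_iff.1 hev
  obtain ⟨C, hC0, hC⟩ := h.D_le
  -- constants
  set C2 : ℝ := 480 / δ with hC2
  have hC2pos : 0 < C2 := by positivity
  set B : ℝ := C2 * Real.log (4 * C2) with hB
  have hlog : ∀ x : ℝ, 0 < x → C2 * Real.log x ≤ x / 4 + |B| := by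
    intro x hx
    have h1 := Real.add_one_le_exp (Real.log (x / (4 * C2)))
    rw [Real.exp_log (by positivity), Real.log_div hx.ne' (by positivity)] at h1
    have h2 : C2 * (Real.log x - Real.log (4 * C2)) ≤ C2 * (x / (4 * C2)) :=
      mul_le_mul_of_nonneg_left (by linarith) hC2pos.le
    have h3 : C2 * (x / (4 * C2)) = x / 4 := by field_simp
    have h4 : B ≤ |B| := le_abs_self _
    rw [h3, mul_sub] at h2
    linarith
  set C4 : ℝ := 480 * A / δ + 3 * C + 240 * Real.log (1 / c) / δ + 8 / δ + 10 / r + |B| + 1 / δ with hC4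
  have hlc : 0 ≤ Real.log (1 / c) := Real.log_nonneg (by
      rw [le_div_iff₀ h.c_pos]; linarith [h.c_le])
  have hA := h.A_pos
  have hC4pos : 0 < C4 := by positivity
  have hC4δ : 1 / δ ≤ C4 := by
    have : 0 ≤ 480 * A / δ + 3 * C + 240 * Real.log (1 / c) / δ + 8 / δ + 10 / r + |B| := by positivity
    linarith
  refine ⟨min (min (1 / (28 * C4)) (δ / 4)) (r / 2), by positivity, (min_le_left _ _).trans (min_le_right _ _), ?_⟩
  set κ := min (min (1 / (28 * C4)) (δ / 4)) (r / 2) with hκ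
  have hκpos : 0 < κ := by positivity
  have hκ1 : κ ≤ 1 / (28 * C4) := (min_le_left _ _).trans (min_le_left _ _)
  have hκ2 : κ ≤ δ / 4 := (min_le_left _ _).trans (min_le_right _ _)
  have hκ3 : κ ≤ r / 2 := min_le_right _ _
  intro s hs1 hs2 hs0
  have hτ := one_le_tau s.im
  have hκτ : κ / tau s.im ≤ κ := div_le_self hκpos.le hτ
  have hsle : s.re ≤ 1 := by
    by_contra hcon
    exact h.ne_zero (not_le.1 hcon) hs2 hs0
  by_cases hsm : |s.im| < r / 2
  · refine hrb ?_ hs0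
    rw [dist_eq_norm]
    have h1 : |(s - 1).re| ≤ r / 2 := by
      rw [Complex.sub_re, Complex.one_re, abs_le]
      constructor <;> linarith
    have h2 : |(s - 1).im| < r / 2 := by simpa using hsm
    calc _ ≤ _ := Complex.norm_le_abs_re_add_abs_im _
      _ < r := by linarith
  rw [not_lt] at hsm
  set γ := s.im with hγ
  set τ := tau γ with hτdef
  have hτpos : 0 < τ := tau_pos _
  set a : ℝ := 1 / (4 * C4 * τ) with ha
  have hapos : 0 < a := by positivity
  have haδ : a ≤ δ / 4 := by
    rw [ha, div_le_div_iff₀ (by positivity) (by norm_num)]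
    have : 1 ≤ δ * C4 := by
      have := mul_le_mul_of_nonneg_left hC4δ hδ.le
      rwa [mul_one_div_cancel hδ.ne'] at this
    nlinarith
  have L1 := (h.landau_at hapos haδ (t := γ) (u := γ) (by linarith [abs_nonneg γ])).2 s.re
    (by linarith) hsle (by rw [hγ, Complex.re_add_im]; exact hs0)
  have L2 := (h.landau_at hapos haδ (t := γ) (u := 2 * γ) (by rw [abs_mul]; simp)).1
  have T := h.three_four_one (σ := 1 + a) (by linarith) γ
  have hre : ∀ u : ℝ, ((((1 + a : ℝ)) : ℂ) + u * Complex.I).re = 1 + a := by intro u; simp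
  have hpole : ∀ u : ℝ, r / 2 ≤ |u| → (1 / ((((1 + a : ℝ)) : ℂ) + u * Complex.I - 1)).re ≤ 2 / r := by
    intro u hu
    refine (Complex.re_le_norm _).trans ?_
    rw [norm_div, norm_one]
    have : r / 2 ≤ ‖(((1 + a : ℝ)) : ℂ) + u * Complex.I - 1‖ := by
      refine le_trans ?_ (Complex.abs_im_le_norm _)
      simpa using hu
    calc _ ≤ 1 / (r / 2) := by gcongr
      _ = _ := by field_simp
  rw [h.eq (((1 + a : ℝ) : ℂ) + (γ : ℂ) * Complex.I) (by rw [hre]; linarith),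
    h.eq (((1 + a : ℝ) : ℂ) + ((2 * γ : ℝ) : ℂ) * Complex.I) (by rw [hre]; linarith), Complex.sub_re, Complex.sub_re] at T
  have p1 := hpole γ hsm
  have p2 := hpole (2 * γ) (by rw [abs_mul]; simp; linarith)
  have p0 := hC (1 + a) (by linarith) (by linarith)
  rw [add_sub_cancel_left] at p0
  have q := hlog (1 / a) (by positivity)
  set M := 2 * A * τ + Real.log (1 / c) + 2 * Real.log (1 / a) with hM
  have L1' : -(48 * M / δ) + 1 / (1 + a - s.re) - 2 / δ
    ≤ (logDeriv H (((1 + a : ℝ) : ℂ) + (γ : ℂ) * Complex.I)).re := L1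
  have L2' : -(48 * M / δ) ≤ (logDeriv H (((1 + a : ℝ) : ℂ) + ((2 * γ : ℝ) : ℂ) * Complex.I)).re := L2
  have main : 4 / (1 + a - s.re) ≤ 3 / a + 3 * C + 10 / r + 240 * M / δ + 8 / δ := by
    have e1 : 4 / (1 + a - s.re) = 4 * (1 / (1 + a - s.re)) := by ring
    have e2 : 10 / r = 5 * (2 / r) := by ring
    have e3 : 240 * M / δ = 5 * (48 * M / δ) := by ring
    have e4 : 8 / δ = 4 * (2 / δ) := by ring
    have e5 : 3 / a = 3 * (1 / a) := by ring
    rw [e1, e2, e3, e4, e5]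
    linarith
  have hMe : 240 * M / δ = 480 * A / δ * τ + 240 * Real.log (1 / c) / δ + C2 * Real.log (1 / a) := by
    rw [hM, hC2]; ring
  have h14 : C4 * τ = 1 / a / 4 := by rw [ha]; field_simp
  have hC4τ : 480 * A / δ * τ + (3 * C + 240 * Real.log (1 / c) / δ + 8 / δ + 10 / r + |B|) ≤ C4 * τ := by
    have : C4 * τ = 480 * A / δ * τ + (3 * C + 240 * Real.log (1 / c) / δ + 8 / δ + 10 / r + |B| + 1 / δ) * τ := by
      rw [hC4]; ring
    rw [this]
    have h0 : 0 ≤ 3 * C + 240 * Real.log (1 / c) / δ + 8 / δ + 10 / r + |B| + 1 / δ := by positivity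
    have h1 : 0 < 1 / δ := by positivity
    have h2 := le_mul_of_one_le_right h0 hτ
    linarith
  have fin : 4 / (1 + a - s.re) ≤ 7 / 2 * (1 / a) := by
    have e5 : 3 / a = 3 * (1 / a) := by ring
    rw [hMe, e5] at main
    linarith
  have hpos : 0 < 1 + a - s.re := by linarith
  rw [mul_one_div, div_le_div_iff₀ hpos hapos] at fin
  have h7 : a / 7 ≤ 1 - s.re := by linarith
  have : κ / τ ≤ a / 7 := by
    calc κ / τ ≤ 1 / (28 * C4) / τ := by gcongr
      _ = a / 7 := by rw [ha]; field_simp; norm_num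
  linarith

/-- the bound for the logarithmic derivative -/
theorem logDeriv_le (h : Hyp H Λ δ A c) : ∃ κ C : ℝ, 0 < κ ∧ κ ≤ δ / 4 ∧ 0 < C ∧
    ∀ s : ℂ, 1 - κ / tau s.im ≤ s.re → s.re ≤ 2 → H s ≠ 0 ∧ ‖logDeriv H s‖ ≤ C * tau s.im ^ 2 := by
  have hδ := h.δ_pos
  have hδ1 := h.δ_le
  obtain ⟨κ, hκ, hκδ, hzf⟩ := h.zero_free
  obtain ⟨C, hC0, hC⟩ := h.D_le
  have hA := h.A_pos
  have hlc : 0 ≤ Real.log (1 / c) := Real.log_nonneg (by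
      rw [le_div_iff₀ h.c_pos]; linarith [h.c_le])
  set C1 := 2 * A + Real.log (1 / c) + 2 * |Real.log (16 / κ)| + 2 with hC1
  have hC1pos : 0 < C1 := by positivity
  refine ⟨κ / 16, 96 * C1 / κ + 32 / κ + C, by positivity, by linarith, by positivity, ?_⟩
  intro s hs1 hs2
  set t := s.im with ht
  set τ := tau t with hτdef
  have hτ : 1 ≤ τ := one_le_tau t
  have hτpos : 0 < τ := tau_pos t
  set a := κ / 16 / τ with ha
  have hapos : 0 < a := by positivity
  have haκ : a ≤ κ / 16 := div_le_self (by positivity) hτ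
  refine ⟨hzf s (by
    have : κ / 16 / τ < κ / τ := by gcongr; linarith
    linarith) hs2, ?_⟩
  have hτ2 : τ ≤ τ ^ 2 := by nlinarith
  rcases le_total s.re (1 + a) with hle | hge
  · set s0 : ℂ := ((1 + a : ℝ) : ℂ) + t * Complex.I with hs0
    have hre : s0.re = 1 + a := by simp [s0]
    have him : s0.im = t := by simp [s0]
    have hsub : ∀ z ∈ Metric.ball s0 (4 * a), 1 - 3 * a ≤ z.re ∧ z.re ≤ 2 ∧ |z.im| ≤ 2 * |t| + 1 := by
      intro z hz
      obtain ⟨h1, h2, h3⟩ := mem_ball_re_im (Metric.ball_subset_closedBall hz)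
      rw [hre] at h1 h2
      rw [him] at h3
      refine ⟨by linarith, by linarith, by linarith [abs_nonneg t]⟩
    set M := 2 * A * τ + Real.log (1 / c) + 2 * Real.log (1 / a) with hM
    have hla : Real.log (1 / a) ≤ |Real.log (16 / κ)| + τ := by
      have : 1 / a = 16 / κ * τ := by rw [ha]; field_simp
      rw [this, Real.log_mul (by positivity) hτpos.ne']
      have h1 := le_abs_self (Real.log (16 / κ))
      have h2 := Real.log_le_sub_one_of_pos hτpos
      linarith
    have hla0 : 0 ≤ Real.log (1 / a) := Real.log_nonneg (by
      rw [le_div_iff₀ hapos]; linarith)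
    have hMpos : 0 < M := by positivity
    have hMle : M ≤ C1 * τ := by
      have : C1 * τ = 2 * A * τ + (Real.log (1 / c) + 2 * |Real.log (16 / κ)|) * τ + 2 * τ := by rw [hC1]; ring
      have h0 : 0 ≤ Real.log (1 / c) + 2 * |Real.log (16 / κ)| := by positivity
      nlinarith
    have := logDeriv_bound (h := H) (c := s0) (R := 4 * a) (M := M) (z := s) (by linarith) hMpos
      (h.hol.mono fun z hz => by
        have := (hsub z hz).1
        simp only [Set.mem_ofPred_eq]; linarith)
      (fun z hz => by
        obtain ⟨h1, h2, h3⟩ := hsub z hz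
        refine hzf z (lt_of_lt_of_le ?_ h1) h2
        have ht2 := tau_le_two h3
        have : κ / (2 * τ) ≤ κ / tau z.im := by gcongr; exact tau_pos _
        have e : κ / (2 * τ) = 8 * a := by rw [ha]; field_simp; norm_num
        linarith)
      (fun z hz => by
        obtain ⟨h1, h2, h3⟩ := hsub z hz
        have := h.ratio (s := s0) (z := z) (t := t) (by rw [hre]; linarith) (by rw [hre]; linarith)
          (by linarith) (by linarith) h3
        simpa [hre, M] using this)
      (by
        have e : s - s0 = ((s.re - (1 + a) : ℝ) : ℂ) := by
          apply Complex.ext <;> simp [hs0, ht]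
        rw [e, Complex.norm_real, Real.norm_eq_abs, abs_le]
        constructor <;> linarith)
    refine this.trans ?_
    calc 24 * M / (4 * a) ≤ 24 * (C1 * τ) / (4 * a) := by gcongr
      _ = 96 * C1 / κ * τ ^ 2 := by rw [ha]; field_simp; norm_num
      _ ≤ _ := by
        gcongr
        have : 0 ≤ 32 / κ := by positivity
        linarith
  · have h1 : 1 < s.re := by linarith
    have e := h.eq s h1
    have e' : logDeriv H s = 1 / (s - 1) - LSeries (fun n => (Λ n : ℂ)) s := by rw [e]; ring
    rw [e']
    have hq : 1 / (s.re - 1) ≤ 1 / a := by gcongr; linarith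
    have b1 : ‖1 / (s - 1)‖ ≤ 1 / a := by
      rw [norm_div, norm_one]
      gcongr
      refine le_trans ?_ (Complex.re_le_norm _)
      simp; linarith
    have b2 := (h.norm_le h1).trans (hC s.re h1 hs2)
    calc _ ≤ _ := norm_sub_le _ _
      _ ≤ 1 / a + (1 / a + C) := by linarith
      _ = 32 / κ * τ + C := by rw [ha]; field_simp; ring
      _ ≤ 32 / κ * τ ^ 2 + C * τ ^ 2 := by
        have : 1 ≤ τ ^ 2 := by nlinarith
        gcongr
        nlinarith
      _ = (0 + 32 / κ + C) * τ ^ 2 := by ring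
      _ ≤ _ := by gcongr; positivity

end Hyp
end EPI

namespace EPI

open MeasureTheory Complex in
lemma inv_prod_le {m p q : ℝ} (hm : 0 < m) (hm1 : m ≤ 1) (hp : m ≤ p) (hq : m ≤ q) (y : ℝ) :
    ‖1 / (((p : ℂ) + y * I) * ((q : ℂ) + y * I))‖ ≤ 1 / m ^ 2 * (1 + y ^ 2)⁻¹ := by
  have key : ∀ r : ℝ, m ≤ r → m * Real.sqrt (1 + y ^ 2) ≤ ‖(r : ℂ) + y * I‖ := by
    intro r hr
    rw [Complex.norm_add_mul_I]
    apply Real.le_sqrt_of_sq_le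
    rw [mul_pow, Real.sq_sqrt (by positivity)]
    have : m ^ 2 ≤ r ^ 2 := by gcongr
    have : m ^ 2 ≤ 1 := by nlinarith
    nlinarith [sq_nonneg y]
  rw [norm_div, norm_one, norm_mul]
  have h0 : 0 < m * Real.sqrt (1 + y ^ 2) := by positivity
  calc 1 / (‖(p : ℂ) + y * I‖ * ‖(q : ℂ) + y * I‖)
      ≤ 1 / ((m * Real.sqrt (1 + y ^ 2)) * (m * Real.sqrt (1 + y ^ 2))) := by
        gcongr
        · exact key p hp
        · exact key q hq
    _ = _ := by
        have : Real.sqrt (1 + y ^ 2) * Real.sqrt (1 + y ^ 2) = 1 + y ^ 2 := Real.mul_self_sqrt (by positivity)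
        rw [mul_mul_mul_comm, this]; field_simp

open MeasureTheory Complex in
/-- Mellin inversion for the kernels `u^a - u^b` on `(0,1]`. -/
theorem kernel_inversion (a b σ : ℝ) (ha : 0 < σ + a) (hb : 0 < σ + b) {u : ℝ} (hu : 0 < u) :
    ∫ y : ℝ, (u : ℂ) ^ (-((σ : ℂ) + y * I)) *
      (1 / ((σ : ℂ) + y * I + a) - 1 / ((σ : ℂ) + y * I + b))
      = 2 * Real.pi * (((min u 1) ^ a - (min u 1) ^ b : ℝ) : ℂ) := by
  set f : ℝ → ℂ := fun u => (((min u 1) ^ a - (min u 1) ^ b : ℝ) : ℂ) with hf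
  set g : ℝ → ℂ := fun t => Set.indicator (Set.Ioc 0 1) (fun t => (t : ℂ) ^ (a : ℂ) : ℝ → ℂ) t
    - Set.indicator (Set.Ioc 0 1) (fun t => (t : ℂ) ^ (b : ℂ) : ℝ → ℂ) t with hg
  have hfg : ∀ t ∈ Set.Ioi (0:ℝ), g t = f t := by
    intro t ht
    rw [Set.mem_Ioi] at ht
    by_cases h1 : t ≤ 1
    · simp only [hg, hf]
      have hmem : t ∈ Set.Ioc (0:ℝ) 1 := ⟨ht, h1⟩
      rw [Set.indicator_of_mem hmem, Set.indicator_of_mem hmem, min_eq_left h1, ofReal_sub,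
        ofReal_cpow ht.le, ofReal_cpow ht.le]
    · simp only [hg, hf]
      rw [Set.indicator_of_notMem (by simp [h1]), Set.indicator_of_notMem (by simp [h1]),
        min_eq_right (not_le.1 h1).le]
      simp
  have hM : ∀ s : ℂ, s.re = σ → HasMellin f s (1 / (s + a) - 1 / (s + b)) := by
    intro s hs
    have h1 := hasMellin_cpow_Ioc (a : ℂ) (s := s) (by simpa [hs] using ha)
    have h2 := hasMellin_cpow_Ioc (b : ℂ) (s := s) (by simpa [hs] using hb)
    have h3 := hasMellin_sub h1.1 h2.1
    rw [h1.2, h2.2] at h3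
    refine ⟨?_, ?_⟩
    · refine (integrableOn_congr_fun (fun t ht => ?_) measurableSet_Ioi).1 h3.1
      simp only [← hfg t ht, hg]
    · rw [← h3.2]
      refine setIntegral_congr_fun measurableSet_Ioi fun t ht => ?_
      simp only [← hfg t ht, hg]
  have hre : ∀ y : ℝ, ((σ : ℂ) + y * I).re = σ := by intro y; simp
  have hne : ∀ (r : ℝ), 0 < σ + r → ∀ y : ℝ, (σ : ℂ) + y * I + r ≠ 0 := by
    intro r hr y h
    have := congrArg Complex.re h
    simp at this
    linarith
  have hv : VerticalIntegrable (mellin f) σ := by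
    have e : ∀ y : ℝ, mellin f (σ + y * I) = ((b - a : ℝ) : ℂ) *
        (1 / ((((σ + a : ℝ) : ℂ) + y * I) * (((σ + b : ℝ) : ℂ) + y * I))) := by
      intro y
      rw [(hM _ (hre y)).2]
      have h1 := hne a ha y
      have h2 := hne b hb y
      have h3 : ((σ + a : ℝ) : ℂ) + y * I = (σ : ℂ) + y * I + a := by push_cast; ring
      have h4 : ((σ + b : ℝ) : ℂ) + y * I = (σ : ℂ) + y * I + b := by push_cast; ring
      rw [h3, h4]
      field_simp
      push_cast; ring
    unfold VerticalIntegrable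
    simp_rw [e]
    refine Integrable.const_mul ?_ _
    set m := min (min (σ + a) (σ + b)) 1
    refine Integrable.mono' (integrable_inv_one_add_sq.const_mul (1 / m ^ 2)) ?_ ?_
    · refine Continuous.aestronglyMeasurable ?_
      refine Continuous.div continuous_const (by fun_prop) fun y => ?_
      refine mul_ne_zero ?_ ?_
      · have := hne a ha y
        push_cast
        convert this using 1; ring
      · have := hne b hb y
        push_cast
        convert this using 1; ring
    · exact Filter.Eventually.of_forall fun y => inv_prod_le (by positivity) (min_le_right _ _)
        ((min_le_left _ _).trans (min_le_left _ _)) ((min_le_left _ _).trans (min_le_right _ _)) y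
  have hcont : ContinuousAt f u := by
    refine Complex.continuous_ofReal.continuousAt.comp ?_
    have h1 : ContinuousAt (fun u : ℝ => min u 1) u := by fun_prop
    have h2 : min u 1 ≠ 0 := by positivity
    exact (h1.rpow_const (Or.inl h2)).sub (h1.rpow_const (Or.inl h2))
  have := mellinInv_mellin_eq σ f hu (hM _ (by simp)).1 hv hcont
  have h5 : ∀ y : ℝ, mellin f (σ + y * I) = (1 / ((σ : ℂ) + y * I + a) - 1 / ((σ : ℂ) + y * I + b)) :=
    fun y => (hM _ (hre y)).2
  rw [mellinInv] at this
  simp_rw [h5, smul_eq_mul] at this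
  change _ = 2 * (Real.pi : ℂ) * f u
  rw [← this, Complex.real_smul]
  generalize (∫ y : ℝ, (u : ℂ) ^ (-((σ : ℂ) + y * I)) *
      (1 / ((σ : ℂ) + y * I + a) - 1 / ((σ : ℂ) + y * I + b))) = J
  have hpi : (Real.pi : ℂ) ≠ 0 := by exact_mod_cast Real.pi_ne_zero
  push_cast
  field_simp

end EPI

namespace EPI
namespace Hyp
variable {H : ℂ → ℂ} {Λ : ℕ → ℝ} {δ A c : ℝ}

open MeasureTheory Complex

/-- the kernel `x^s/(s(s+1))` on a vertical line -/
def G (x σ y : ℝ) : ℂ := (x : ℂ) ^ ((σ : ℂ) + y * I) / (((σ : ℂ) + y * I) * ((σ : ℂ) + y * I + 1))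

lemma norm_G_le {x σ : ℝ} (hx : 0 < x) (hσ : 1 / 2 ≤ σ) (y : ℝ) :
    ‖G x σ y‖ ≤ 4 * x ^ σ * (1 + y ^ 2)⁻¹ := by
  have h := inv_prod_le (m := 1 / 2) (p := σ) (q := σ + 1) (by norm_num) (by norm_num) hσ (by linarith) y
  have e : G x σ y = (x : ℂ) ^ ((σ : ℂ) + y * I) * (1 / (((σ : ℂ) + y * I) * (((σ + 1 : ℝ) : ℂ) + y * I))) := by
    unfold G
    rw [div_eq_mul_one_div]
    congr 3
    push_cast; ring
  rw [e, norm_mul, norm_cpow_eq_rpow_re_of_pos hx]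
  have e2 : ((σ : ℂ) + y * I).re = σ := by simp
  rw [e2]
  calc _ ≤ x ^ σ * (1 / (1 / 2) ^ 2 * (1 + y ^ 2)⁻¹) := by gcongr
    _ = _ := by ring

lemma continuous_G {x σ : ℝ} (hx : 0 < x) (hσ : 0 < σ) : Continuous (G x σ) := by
  unfold G
  have hx' : (x : ℂ) ≠ 0 := by exact_mod_cast hx.ne'
  refine Continuous.div (Continuous.const_cpow (by fun_prop) (Or.inl hx')) (by fun_prop) fun y h => ?_
  rcases mul_eq_zero.1 h with h | h
  · have := congrArg Complex.re h
    simp at this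
    linarith
  · have := congrArg Complex.re h
    simp at this
    linarith

lemma integrable_G {x σ : ℝ} (hx : 0 < x) (hσ : 1 / 2 ≤ σ) : Integrable (G x σ) :=
  Integrable.mono' (integrable_inv_one_add_sq.const_mul (4 * x ^ σ))
    (continuous_G hx (by linarith)).aestronglyMeasurable (Eventually.of_forall fun y => norm_G_le hx hσ y)

lemma perron_L (h : Hyp H Λ δ A c) {σ x : ℝ} (hσ : 1 < σ) (hx : 1 ≤ x) :
    ∫ y : ℝ, LSeries (fun n => (Λ n : ℂ)) (σ + y * I) * G x σ y
      = 2 * Real.pi * ((∑ n ∈ Finset.Icc 1 ⌊x⌋₊, Λ n * (1 - n / x) : ℝ) : ℂ) := by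
  have hx0 : 0 < x := by linarith
  set F : ℕ → ℝ → ℂ := fun n y => LSeries.term (fun n => (Λ n : ℂ)) (σ + y * I) n * G x σ y with hF
  have hre : ∀ y : ℝ, ((σ : ℂ) + y * I).re = σ := by intro y; simp
  have hterm : ∀ n, Continuous fun y : ℝ => LSeries.term (fun n => (Λ n : ℂ)) (σ + y * I) n := by
    intro n
    rcases eq_or_ne n 0 with rfl | hn
    · simp [continuous_const]
    · simp_rw [LSeries.term_of_ne_zero hn]
      have hn' : (n : ℂ) ≠ 0 := by exact_mod_cast hn
      refine Continuous.div continuous_const (Continuous.const_cpow (by fun_prop) (Or.inl hn')) fun y => ?_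
      simp [Complex.cpow_eq_zero_iff, hn']
  have hnorm : ∀ n y, ‖F n y‖ = (LSeries.term (fun n => (Λ n : ℂ)) (σ : ℂ) n).re * ‖G x σ y‖ := by
    intro n y
    simp only [hF]
    rw [norm_mul, h.norm_term, hre]
  have hIntg : ∀ n, Integrable (F n) := by
    intro n
    refine Integrable.mono' ((integrable_G hx0 (by linarith)).norm.const_mul
      (LSeries.term (fun n => (Λ n : ℂ)) (σ : ℂ) n).re)
      ((hterm n).mul (continuous_G hx0 (by linarith))).aestronglyMeasurable
      (Eventually.of_forall fun y => (hnorm n y).le)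
  have hsum : Summable fun n => ∫ y, ‖F n y‖ := by
    simp_rw [hnorm, integral_const_mul]
    refine Summable.mul_right _ ?_
    exact (Complex.hasSum_re (h.summ (σ : ℂ) (by simpa using hσ)).hasSum).summable
  have hS := hasSum_integral_of_summable_integral_norm hIntg hsum
  have e1 : ∀ y : ℝ, ∑' n, F n y = LSeries (fun n => (Λ n : ℂ)) (σ + y * I) * G x σ y := by
    intro y
    simp only [hF]
    rw [tsum_mul_right]; rfl
  simp_rw [e1] at hS
  have e2 : ∀ n : ℕ, ∫ y, F n y = 2 * Real.pi * ((if n = 0 then 0 else Λ n * (1 - min (n / x) 1) : ℝ) : ℂ) := by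
    intro n
    split_ifs with hn
    · simp [hF, hn]
    · have hn' : (0:ℝ) < n := by exact_mod_cast Nat.pos_of_ne_zero hn
      have hk := kernel_inversion 0 1 σ (by linarith) (by linarith) (u := n / x) (by positivity)
      have : ∀ y, F n y = (Λ n : ℂ) * (((n / x : ℝ) : ℂ) ^ (-((σ : ℂ) + y * I)) *
          (1 / ((σ : ℂ) + y * I + (0:ℝ)) - 1 / ((σ : ℂ) + y * I + (1:ℝ)))) := by
        intro y
        simp only [hF]
        rw [LSeries.term_of_ne_zero hn, G]
        have hpos : 0 ≤ (n : ℝ) / x := by positivity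
        have q : (((n / x : ℝ) : ℂ)) ^ (-((σ : ℂ) + y * I)) =
            (x : ℂ) ^ ((σ : ℂ) + y * I) / (n : ℂ) ^ ((σ : ℂ) + y * I) := by
          rw [div_eq_mul_inv, ofReal_mul, Complex.mul_cpow_ofReal_nonneg hn'.le (by positivity),
            ofReal_inv, Complex.inv_cpow _ _ (by
              rw [Complex.arg_ofReal_of_nonneg hx0.le]; exact Real.pi_pos.ne), Complex.cpow_neg, Complex.cpow_neg, inv_inv, ofReal_natCast]
          ring
        rw [q]
        have h1 : (σ : ℂ) + y * I ≠ 0 := by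
          intro h0; have := congrArg Complex.re h0; simp at this; linarith
        have h2 : (σ : ℂ) + y * I + 1 ≠ 0 := by
          intro h0; have := congrArg Complex.re h0; simp at this; linarith
        have h3 : (n : ℂ) ^ ((σ : ℂ) + y * I) ≠ 0 := by
          have hn'' : (n : ℂ) ≠ 0 := by exact_mod_cast hn
          simp [Complex.cpow_eq_zero_iff, hn'']
        push_cast
        rw [add_zero]
        field_simp
        ring
      simp_rw [this]
      rw [integral_const_mul, hk, Real.rpow_zero, Real.rpow_one]
      push_cast; ring
  simp_rw [e2] at hS
  have hfin := hasSum_sum_of_ne_finset_zero (L := SummationFilter.unconditional ℕ) (f := fun n : ℕ => 2 * (Real.pi : ℂ) *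
    ((if n = 0 then 0 else Λ n * (1 - min (n / x) 1) : ℝ) : ℂ)) (s := Finset.Icc 1 ⌊x⌋₊) (by
      intro n hn
      rw [Finset.mem_Icc, not_and_or] at hn
      rcases hn with hn | hn
      · have : n = 0 := by omega
        simp [this]
      · have hn0 : n ≠ 0 := by rintro rfl; simp at hn
        have h2 : x < n := by
          rw [not_le] at hn
          exact (Nat.floor_lt hx0.le).1 hn
        have : min ((n : ℝ) / x) 1 = 1 := min_eq_right (by rw [le_div_iff₀ hx0]; linarith)
        simp [hn0, this])
  rw [hS.unique hfin, ← Finset.mul_sum]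
  push_cast
  congr 1
  refine Finset.sum_congr rfl fun n hn => ?_
  rw [Finset.mem_Icc] at hn
  have hn0 : n ≠ 0 := by omega
  have h2 : (n : ℝ) ≤ x := (Nat.le_floor_iff hx0.le).1 hn.2
  have : min ((n : ℝ) / x) 1 = n / x := min_eq_left (by rw [div_le_one hx0]; exact h2)
  simp [hn0, this]

lemma perron_main {σ x : ℝ} (hσ : 1 < σ) (hx : 1 ≤ x) :
    ∫ y : ℝ, (1 + 1 / ((σ : ℂ) + y * I - 1)) * G x σ y
      = 2 * Real.pi * (((x - 1 / x) / 2 : ℝ) : ℂ) := by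
  have hx0 : 0 < x := by linarith
  have hk := kernel_inversion (-1) 1 σ (by linarith) (by linarith) (u := 1 / x) (by positivity)
  have : ∀ y : ℝ, (1 + 1 / ((σ : ℂ) + y * I - 1)) * G x σ y = (1 / 2) * (((1 / x : ℝ) : ℂ) ^ (-((σ : ℂ) + y * I)) *
          (1 / ((σ : ℂ) + y * I + (-1:ℝ)) - 1 / ((σ : ℂ) + y * I + (1:ℝ)))) := by
    intro y
    have q : (((1 / x : ℝ) : ℂ)) ^ (-((σ : ℂ) + y * I)) = (x : ℂ) ^ ((σ : ℂ) + y * I) := by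
      rw [one_div, ofReal_inv, Complex.inv_cpow _ _ (by
              rw [Complex.arg_ofReal_of_nonneg hx0.le]; exact Real.pi_pos.ne), Complex.cpow_neg, inv_inv]
    rw [q, G]
    have h1 : (σ : ℂ) + y * I ≠ 0 := by
      intro h0; have := congrArg Complex.re h0; simp at this; linarith
    have h2 : (σ : ℂ) + y * I + 1 ≠ 0 := by
      intro h0; have := congrArg Complex.re h0; simp at this; linarith
    have h3 : (σ : ℂ) + y * I - 1 ≠ 0 := by
      intro h0; have := congrArg Complex.re h0; simp at this; linarith
    push_cast
    rw [← sub_eq_add_neg]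
    field_simp
    ring
  simp_rw [this]
  have hmin : min (1 / x) 1 = 1 / x := min_eq_left (by rw [div_le_one hx0]; exact hx)
  rw [integral_const_mul, hk, hmin, Real.rpow_one, Real.rpow_neg_one]
  push_cast
  simp only [one_div, inv_inv]
  ring

/-- the function to be integrated -/
def F1 (H : ℂ → ℂ) (s : ℂ) : ℂ := -1 - logDeriv H s

lemma integrable_F1 (h : Hyp H Λ δ A c) {σ x : ℝ} (hσ : 1 < σ) (hσ2 : σ ≤ 2) (hx : 1 ≤ x) :
    Integrable fun y : ℝ => F1 H (σ + y * I) * G x σ y := by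
  have hre : ∀ y : ℝ, ((σ : ℂ) + y * I).re = σ := by intro y; simp
  have hδ := h.δ_pos
  set B : ℝ := 1 + 1 / (σ - 1) + (LSeries (fun n => (Λ n : ℂ)) (σ : ℂ)).re with hB
  have hb : ∀ y : ℝ, ‖F1 H (σ + y * I)‖ ≤ B := by
    intro y
    have h1 : 1 < ((σ : ℂ) + y * I).re := by rw [hre]; exact hσ
    have e : F1 H (σ + y * I) = LSeries (fun n => (Λ n : ℂ)) (σ + y * I) - (1 + 1 / ((σ : ℂ) + y * I - 1)) := by
      rw [F1, h.eq _ h1]; ring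
    rw [e]
    have n1 := h.norm_le h1
    rw [hre] at n1
    have n2 : ‖1 / ((σ : ℂ) + y * I - 1)‖ ≤ 1 / (σ - 1) := by
      rw [norm_div, norm_one]
      have : 0 < σ - 1 := by linarith
      gcongr
      refine le_trans ?_ (Complex.re_le_norm _)
      simp
    calc _ ≤ ‖LSeries (fun n => (Λ n : ℂ)) (σ + y * I)‖ + ‖(1:ℂ) + 1 / ((σ : ℂ) + y * I - 1)‖ := norm_sub_le _ _
      _ ≤ ‖LSeries (fun n => (Λ n : ℂ)) (σ + y * I)‖ + (‖(1:ℂ)‖ + ‖1 / ((σ : ℂ) + y * I - 1)‖) := by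
        gcongr; exact norm_add_le _ _
      _ ≤ B := by rw [norm_one, hB]; linarith
  have hcont : Continuous fun y : ℝ => F1 H (σ + y * I) := by
    refine continuous_const.sub ?_
    have hd : ContinuousOn (deriv H) {s : ℂ | 1 - δ < s.re} := (h.hol.deriv isOpen_dom).continuousOn
    have hmem : ∀ y : ℝ, ((σ : ℂ) + y * I) ∈ {s : ℂ | 1 - δ < s.re} := by
      intro y; rw [Set.mem_ofPred_eq, hre]; linarith
    have hl : Continuous fun y : ℝ => (σ : ℂ) + y * I := by fun_prop
    exact Continuous.div (hd.comp_continuous hl hmem) (h.hol.continuousOn.comp_continuous hl hmem)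
      fun y => h.ne_zero (by rw [hre]; exact hσ) (by rw [hre]; exact hσ2)
  exact (integrable_G (by linarith) (by linarith)).bdd_mul hcont.aestronglyMeasurable
    (Eventually.of_forall hb)

theorem perron (h : Hyp H Λ δ A c) {σ x : ℝ} (hσ : 1 < σ) (hσ2 : σ ≤ 2) (hx : 1 ≤ x) :
    ∫ y : ℝ, F1 H (σ + y * I) * G x σ y = 2 * Real.pi *
      (((∑ n ∈ Finset.Icc 1 ⌊x⌋₊, Λ n * (1 - n / x)) - (x - 1 / x) / 2 : ℝ) : ℂ) := by
  have hre : ∀ y : ℝ, ((σ : ℂ) + y * I).re = σ := by intro y; simp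
  have e : ∀ y : ℝ, F1 H (σ + y * I) * G x σ y = LSeries (fun n => (Λ n : ℂ)) (σ + y * I) * G x σ y
      - (1 + 1 / ((σ : ℂ) + y * I - 1)) * G x σ y := by
    intro y
    rw [F1, h.eq _ (by rw [hre]; exact hσ)]; ring
  have i2 : Integrable fun y : ℝ => (1 + 1 / ((σ : ℂ) + y * I - 1)) * G x σ y := by
    have hne : ∀ y : ℝ, (σ : ℂ) + y * I - 1 ≠ 0 := by
      intro y h0; have := congrArg Complex.re h0; simp at this; linarith
    refine (integrable_G (by linarith) (by linarith)).bdd_mul (c := 1 + 1 / (σ - 1)) (Continuous.aestronglyMeasurable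
      (continuous_const.add (Continuous.div continuous_const (by fun_prop) hne)))
      (Eventually.of_forall fun y => ?_)
    refine (norm_add_le _ _).trans ?_
    rw [norm_one, norm_div, norm_one]
    have : 0 < σ - 1 := by linarith
    gcongr
    refine le_trans ?_ (Complex.re_le_norm _)
    simp
  have i1 : Integrable fun y : ℝ => LSeries (fun n => (Λ n : ℂ)) (σ + y * I) * G x σ y := by
    have := (h.integrable_F1 hσ hσ2 hx).add i2
    refine this.congr (Eventually.of_forall fun y => ?_)
    simp only [Pi.add_apply, e y]; ring
  simp_rw [e]
  rw [integral_sub i1 i2, h.perron_L hσ hx, perron_main hσ hx]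
  push_cast; ring

end Hyp
end EPI

namespace EPI
namespace Hyp
variable {H : ℂ → ℂ} {Λ : ℕ → ℝ} {δ A c : ℝ}

open MeasureTheory Complex

lemma tail_le {T : ℝ} (hT : 0 < T) : Real.pi / 2 - Real.arctan T ≤ 1 / T := by
  rw [← Real.arctan_inv_of_pos hT, one_div]
  have h : 0 < T⁻¹ := by positivity
  have h1 := Real.lt_tan (x := Real.arctan T⁻¹) (by simpa using h) (Real.arctan_lt_pi_div_two _)
  rw [Real.tan_arctan] at h1
  exact h1.le

lemma shift_bound {F : ℂ → ℂ} {x σ0 σ1 T B : ℝ} (hx : 1 ≤ x) (h0 : 1 / 2 ≤ σ0) (h01 : σ0 ≤ σ1) (h1 : σ1 ≤ 2)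
    (hT : 1 ≤ T) (hB : 0 ≤ B)
    (hd : ∀ s : ℂ, σ0 ≤ s.re → s.re ≤ σ1 → |s.im| ≤ T → DifferentiableAt ℂ F s ∧ ‖F s‖ ≤ B)
    (hl : ∀ y : ℝ, ‖F (σ1 + y * I)‖ ≤ B)
    (hi : Integrable fun y : ℝ => F (σ1 + y * I) * G x σ1 y) :
    ‖∫ y : ℝ, F (σ1 + y * I) * G x σ1 y‖ ≤ B * (4 * Real.pi * x ^ σ0 + 24 * (x ^ σ1 / T)) := by
  have hx0 : 0 < x := by linarith
  set g : ℝ → ℂ := fun y => F (σ1 + y * I) * G x σ1 y with hg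
  have hgle : ∀ y, ‖g y‖ ≤ B * (4 * x ^ σ1) * (1 + y ^ 2)⁻¹ := by
    intro y
    simp only [hg]
    rw [norm_mul, mul_assoc]
    exact mul_le_mul (hl y) (norm_G_le hx0 (by linarith) y) (norm_nonneg _) hB
  have hsplit : ∫ y, g y = (∫ y in Set.Iic (-T), g y) + ((∫ y in (-T)..T, g y) + ∫ y in Set.Ioi T, g y) := by
    rw [intervalIntegral.integral_interval_add_Ioi hi.integrableOn hi.integrableOn,
      intervalIntegral.integral_Iic_add_Ioi hi.integrableOn hi.integrableOn]
  have t1 : ‖∫ y in Set.Iic (-T), g y‖ ≤ 4 * B * (x ^ σ1 / T) := by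
    calc _ ≤ ∫ y in Set.Iic (-T), B * (4 * x ^ σ1) * (1 + y ^ 2)⁻¹ :=
          norm_integral_le_of_norm_le (integrable_inv_one_add_sq.const_mul _).integrableOn
            (Eventually.of_forall hgle)
      _ = B * (4 * x ^ σ1) * (Real.pi / 2 - Real.arctan T) := by
        rw [integral_const_mul, integral_Iic_inv_one_add_sq, Real.arctan_neg]; ring
      _ ≤ B * (4 * x ^ σ1) * (1 / T) := by gcongr; exact tail_le (by linarith)
      _ = _ := by ring
  have t2 : ‖∫ y in Set.Ioi T, g y‖ ≤ 4 * B * (x ^ σ1 / T) := by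
    calc _ ≤ ∫ y in Set.Ioi T, B * (4 * x ^ σ1) * (1 + y ^ 2)⁻¹ :=
          norm_integral_le_of_norm_le (integrable_inv_one_add_sq.const_mul _).integrableOn
            (Eventually.of_forall hgle)
      _ = B * (4 * x ^ σ1) * (Real.pi / 2 - Real.arctan T) := by
        rw [integral_const_mul, integral_Ioi_inv_one_add_sq]
      _ ≤ B * (4 * x ^ σ1) * (1 / T) := by gcongr; exact tail_le (by linarith)
      _ = _ := by ring
  -- the rectangle
  set f : ℂ → ℂ := fun s => F s * ((x : ℂ) ^ s / (s * (s + 1))) with hf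
  have hfG : ∀ σ y : ℝ, f (σ + y * I) = F (σ + y * I) * G x σ y := fun σ y => rfl
  have hfle : ∀ σ y : ℝ, σ0 ≤ σ → σ ≤ σ1 → |y| ≤ T → ‖f (σ + y * I)‖ ≤ B * (4 * x ^ σ) * (1 + y ^ 2)⁻¹ := by
    intro σ y a1 a2 a3
    rw [hfG, norm_mul, mul_assoc]
    exact mul_le_mul (hd _ (by simpa using a1) (by simpa using a2) (by simpa using a3)).2
      (norm_G_le hx0 (by linarith) y) (norm_nonneg _) hB
  have hrect := Complex.integral_boundary_rect_eq_zero_of_differentiableOn f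
    (⟨σ0, -T⟩ : ℂ) (⟨σ1, T⟩ : ℂ) (by
      intro s hs
      rw [Complex.mem_reProdIm, Set.uIcc_of_le h01, Set.uIcc_of_le (by simp; linarith)] at hs
      obtain ⟨⟨a1, a2⟩, a3⟩ := hs
      have hF := (hd s a1 a2 (abs_le.2 a3)).1
      have hxne : (x : ℂ) ≠ 0 := by exact_mod_cast hx0.ne'
      have hs0 : s ≠ 0 := by rintro rfl; simp at a1; linarith
      have hs1 : s + 1 ≠ 0 := by
        intro h; have := congrArg Complex.re h; simp at this a1; linarith
      have hnum : DifferentiableAt ℂ (fun s : ℂ => (x : ℂ) ^ s) s := differentiableAt_id.const_cpow (Or.inl hxne)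
      have hden : DifferentiableAt ℂ (fun s : ℂ => s * (s + 1)) s := by fun_prop
      have hq : DifferentiableAt ℂ (fun s : ℂ => (x : ℂ) ^ s / (s * (s + 1))) s :=
        DifferentiableAt.fun_div hnum hden (mul_ne_zero hs0 hs1)
      exact (hF.fun_mul hq).differentiableWithinAt)
  simp only [] at hrect
  have hh : ∀ y : ℝ, |y| = T → ‖∫ u in σ0..σ1, f (u + y * I)‖ ≤ 8 * B * (x ^ σ1 / T) := by
    intro y hy
    have := intervalIntegral.norm_integral_le_of_norm_le_const (a := σ0) (b := σ1)
      (f := fun u : ℝ => f (u + y * I)) (C := B * (4 * x ^ σ1) * (1 / T)) (by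
        intro u hu
        rw [Set.uIoc_of_le h01] at hu
        refine (hfle u y hu.1.le hu.2 hy.le).trans ?_
        have : (1 + y ^ 2)⁻¹ ≤ 1 / T := by
          rw [← one_div, ← sq_abs, hy]
          gcongr
          nlinarith
        gcongr
        exact hu.2)
    refine this.trans ?_
    have h2 : |σ1 - σ0| ≤ 2 := by rw [abs_le]; constructor <;> linarith
    calc _ ≤ B * (4 * x ^ σ1) * (1 / T) * 2 := by gcongr
      _ = _ := by ring
  have hv : ‖∫ y in (-T)..T, f (σ0 + y * I)‖ ≤ 4 * B * Real.pi * x ^ σ0 := by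
    have hle : -T ≤ T := by linarith
    calc _ ≤ ∫ y in (-T)..T, B * (4 * x ^ σ0) * (1 + y ^ 2)⁻¹ := by
          refine intervalIntegral.norm_integral_le_of_norm_le hle (Eventually.of_forall fun y hy => ?_)
            (integrable_inv_one_add_sq.const_mul _).intervalIntegrable
          exact hfle σ0 y le_rfl h01 (abs_le.2 ⟨hy.1.le, hy.2⟩)
      _ = B * (4 * x ^ σ0) * ∫ y in (-T)..T, (1 + y ^ 2)⁻¹ := by rw [intervalIntegral.integral_const_mul]
      _ ≤ B * (4 * x ^ σ0) * Real.pi := by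
          gcongr
          rw [integral_inv_one_add_sq]
          have := Real.arctan_lt_pi_div_two T
          have := Real.neg_pi_div_two_lt_arctan (-T)
          linarith
      _ = _ := by ring
  have hmid : ‖∫ y in (-T)..T, g y‖ ≤ 4 * B * Real.pi * x ^ σ0 + 16 * B * (x ^ σ1 / T) := by
    have e : I • (∫ y in (-T)..T, g y) = I • (∫ y in (-T)..T, f (σ0 + y * I))
        - (∫ u in σ0..σ1, f (u + (-T : ℝ) * I)) + ∫ u in σ0..σ1, f (u + (T : ℝ) * I) := by
      have : ∫ y in (-T)..T, g y = ∫ y in (-T)..T, f (σ1 + y * I) := rfl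
      rw [this]
      linear_combination hrect
    have n : ‖∫ y in (-T)..T, g y‖ = ‖I • (∫ y in (-T)..T, g y)‖ := by simp
    rw [n, e]
    have a1 := hh (-T) (by rw [abs_neg, abs_of_pos (by linarith)])
    have a2 := hh T (by rw [abs_of_pos (by linarith)])
    calc _ ≤ ‖I • (∫ y in (-T)..T, f (σ0 + y * I))‖ + ‖∫ u in σ0..σ1, f (u + (-T : ℝ) * I)‖
          + ‖∫ u in σ0..σ1, f (u + (T : ℝ) * I)‖ := by
            refine (norm_add_le _ _).trans ?_
            gcongr
            exact norm_sub_le _ _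
      _ ≤ _ := by
        rw [norm_smul, norm_I, one_mul]
        linarith
  rw [hsplit]
  calc _ ≤ ‖∫ y in Set.Iic (-T), g y‖ + (‖∫ y in (-T)..T, g y‖ + ‖∫ y in Set.Ioi T, g y‖) := by
        refine (norm_add_le _ _).trans ?_
        gcongr
        exact norm_add_le _ _
    _ ≤ 4 * B * (x ^ σ1 / T) + ((4 * B * Real.pi * x ^ σ0 + 16 * B * (x ^ σ1 / T)) + 4 * B * (x ^ σ1 / T)) := by gcongr
    _ = _ := by ring

set_option maxHeartbeats 1000000 in
theorem smooth_bound (h : Hyp H Λ δ A c) : ∃ C c0 x0 : ℝ, 0 < C ∧ 0 < c0 ∧ 1 ≤ x0 ∧ ∀ x, x0 ≤ x →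
    |(∑ n ∈ Finset.Icc 1 ⌊x⌋₊, Λ n * (1 - n / x)) - (x - 1 / x) / 2| ≤ C * x * Real.exp (-c0 * √(Real.log x)) := by
  have hδ := h.δ_pos
  have hδ1 := h.δ_le
  obtain ⟨κ, C, hκ, hκδ, hC, hld⟩ := h.logDeriv_le
  obtain ⟨C', hC', hD⟩ := h.D_le
  set K : ℝ := (3 + 4 * C + C') * (32 / κ ^ 2) * (4 * Real.pi + 24 * Real.exp 1) with hK
  have hpi := Real.pi_pos
  refine ⟨K, κ / 4, Real.exp 4, by positivity, by positivity, Real.one_le_exp (by norm_num), ?_⟩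
  intro x hx
  have hx0 : 0 < x := (Real.exp_pos _).trans_le hx
  have hlog : 4 ≤ Real.log x := (Real.le_log_iff_exp_le hx0).2 hx
  have hx1 : 1 ≤ x := (Real.one_le_exp (by norm_num)).trans hx
  set l := √(Real.log x) with hl
  have hl2 : l ^ 2 = Real.log x := Real.sq_sqrt (by linarith)
  have hlge : 2 ≤ l := Real.le_sqrt_of_sq_le (by linarith)
  set T := Real.exp l with hT
  have hT3 : 3 ≤ T := by have := Real.add_one_le_exp l; linarith
  have hτ1 : tau T ≤ 2 * l := by
    unfold tau
    rw [abs_of_pos (by linarith)]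
    have : 2 * l = Real.log (T ^ 2) := by rw [Real.log_pow, hT, Real.log_exp]; norm_num
    rw [this]
    exact Real.log_le_log (by linarith) (by nlinarith)
  have hτ0 := one_le_tau T
  set σ0 := 1 - κ / tau T with hσ0
  set σ1 := 1 + 1 / l ^ 2 with hσ1
  have hκτ : κ / tau T ≤ κ := div_le_self hκ.le hτ0
  have hκτ0 : 0 < κ / tau T := div_pos hκ (tau_pos T)
  have hl4 : 1 / l ^ 2 ≤ 1 := by rw [div_le_one (by positivity)]; nlinarith
  have hl0 : 0 < 1 / l ^ 2 := by positivity
  set B := 1 + 4 * C * l ^ 2 + (2 * l ^ 2 + C') with hB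
  have hBpos : 0 ≤ B := by positivity
  have hrg : ∀ s : ℂ, σ0 ≤ s.re → s.re ≤ σ1 → |s.im| ≤ T →
      DifferentiableAt ℂ (F1 H) s ∧ ‖F1 H s‖ ≤ B := by
    intro s a1 a2 a3
    have hτs : tau s.im ≤ tau T := tau_mono (by rwa [abs_of_pos (by linarith : (0:ℝ) < T)])
    have hre : 1 - κ / tau s.im ≤ s.re := by
      have : κ / tau T ≤ κ / tau s.im := by gcongr; exact tau_pos _
      linarith
    obtain ⟨b1, b2⟩ := hld s hre (by linarith)
    constructor
    · have hm : {s : ℂ | 1 - δ < s.re} ∈ nhds s := isOpen_dom.mem_nhds (by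
        rw [Set.mem_ofPred_eq]; linarith)
      exact (differentiableAt_const _).sub (DifferentiableAt.div
        ((h.hol.deriv isOpen_dom).differentiableAt hm) (h.hol.differentiableAt hm) b1)
    · have hts : tau s.im ^ 2 ≤ (2 * l) ^ 2 := by
        have := tau_pos s.im
        gcongr
        linarith
      calc _ ≤ ‖(-1:ℂ)‖ + ‖logDeriv H s‖ := norm_sub_le _ _
        _ ≤ 1 + C * (2 * l) ^ 2 := by
          rw [norm_neg, norm_one]
          have := b2.trans (mul_le_mul_of_nonneg_left hts hC.le)
          linarith
        _ ≤ B := by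
          rw [hB]
          have : 0 ≤ 2 * l ^ 2 + C' := by positivity
          nlinarith
  have hline : ∀ y : ℝ, ‖F1 H (σ1 + y * I)‖ ≤ B := by
    intro y
    have hre : ((σ1 : ℂ) + y * I).re = σ1 := by simp
    have h1 : 1 < ((σ1 : ℂ) + y * I).re := by rw [hre]; linarith
    have e : F1 H (σ1 + y * I) = LSeries (fun n => (Λ n : ℂ)) (σ1 + y * I) - (1 + 1 / ((σ1 : ℂ) + y * I - 1)) := by
      rw [F1, h.eq _ h1]; ring
    rw [e]
    have n1 := h.norm_le h1
    rw [hre] at n1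
    have n3 := hD σ1 (by linarith) (by linarith)
    have hinv : 1 / (σ1 - 1) = l ^ 2 := by rw [hσ1]; field_simp; ring
    have n2 : ‖1 / ((σ1 : ℂ) + y * I - 1)‖ ≤ 1 / (σ1 - 1) := by
      rw [norm_div, norm_one]
      have : 0 < σ1 - 1 := by linarith
      gcongr
      refine le_trans ?_ (Complex.re_le_norm _)
      simp
    rw [hinv] at n2 n3
    calc _ ≤ ‖LSeries (fun n => (Λ n : ℂ)) (σ1 + y * I)‖ + ‖(1:ℂ) + 1 / ((σ1 : ℂ) + y * I - 1)‖ := norm_sub_le _ _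
      _ ≤ ‖LSeries (fun n => (Λ n : ℂ)) (σ1 + y * I)‖ + (‖(1:ℂ)‖ + ‖1 / ((σ1 : ℂ) + y * I - 1)‖) := by
        gcongr; exact norm_add_le _ _
      _ ≤ B := by
        rw [norm_one, hB]
        have : 0 ≤ 4 * C * l ^ 2 := by positivity
        linarith
  have hsb := shift_bound (F := F1 H) (x := x) (σ0 := σ0) (σ1 := σ1) (T := T) (B := B) hx1 (by linarith)
    (by linarith) (by linarith) (by linarith) hBpos hrg hline
    (h.integrable_F1 (by linarith) (by linarith) hx1)
  rw [h.perron (by linarith) (by linarith) hx1] at hsb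
  set P := (∑ n ∈ Finset.Icc 1 ⌊x⌋₊, Λ n * (1 - n / x)) - (x - 1 / x) / 2 with hP
  have hnorm : ‖2 * (Real.pi : ℂ) * (P : ℂ)‖ = 2 * Real.pi * |P| := by
    rw [norm_mul, norm_mul, Complex.norm_real, Complex.norm_real, Real.norm_eq_abs, Real.norm_eq_abs, abs_of_pos hpi]
    norm_num
  rw [hnorm] at hsb
  have hP1 : |P| ≤ 2 * Real.pi * |P| := by
    refine le_mul_of_one_le_left (abs_nonneg _) ?_
    have := Real.pi_gt_three; linarith
  have hxσ1 : x ^ σ1 = Real.exp 1 * x := by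
    rw [hσ1, Real.rpow_add hx0, Real.rpow_one, mul_comm, Real.rpow_def_of_pos hx0, ← hl2]
    congr 2
    field_simp
  have hxσ0 : x ^ σ0 ≤ x * Real.exp (-(κ / 2 * l)) := by
    rw [hσ0, sub_eq_add_neg, Real.rpow_add hx0, Real.rpow_one, Real.rpow_def_of_pos hx0, ← hl2]
    gcongr
    have : κ / (2 * l) ≤ κ / tau T := by gcongr
    have h2 : l ^ 2 * (κ / (2 * l)) = κ / 2 * l := by field_simp
    have h3 := mul_le_mul_of_nonneg_left this (sq_nonneg l)
    linarith
  have hTinv : x ^ σ1 / T ≤ Real.exp 1 * x * Real.exp (-(κ / 2 * l)) := by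
    rw [hxσ1, div_eq_mul_inv, hT, ← Real.exp_neg]
    gcongr
    nlinarith
  have hBle : B ≤ (3 + 4 * C + C') * l ^ 2 := by
    rw [hB]
    have h1 : 1 ≤ l ^ 2 := by nlinarith
    have h2 := le_mul_of_one_le_right hC' h1
    have h3 : (3 + 4 * C + C') * l ^ 2 = 3 * l ^ 2 + 4 * C * l ^ 2 + C' * l ^ 2 := by ring
    linarith
  have hlsq : l ^ 2 ≤ 32 / κ ^ 2 * Real.exp (κ / 4 * l) := by
    have := Real.quadratic_le_exp_of_nonneg (x := κ / 4 * l) (by positivity)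
    have h0 : 0 ≤ κ / 4 * l := by positivity
    have h3 : (κ / 4 * l) ^ 2 / 2 ≤ Real.exp (κ / 4 * l) := by linarith
    calc l ^ 2 = 32 / κ ^ 2 * ((κ / 4 * l) ^ 2 / 2) := by field_simp; norm_num
      _ ≤ _ := by gcongr
  calc |P| ≤ _ := hP1
    _ ≤ _ := hsb
    _ ≤ ((3 + 4 * C + C') * (32 / κ ^ 2 * Real.exp (κ / 4 * l))) * (4 * Real.pi * (x * Real.exp (-(κ / 2 * l)))
        + 24 * (Real.exp 1 * x * Real.exp (-(κ / 2 * l)))) := by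
      gcongr
      exact hBle.trans (by gcongr)
    _ = K * x * (Real.exp (κ / 4 * l) * Real.exp (-(κ / 2 * l))) := by rw [hK]; ring
    _ = _ := by
      rw [← Real.exp_add]
      congr 2
      ring

end Hyp
end EPI

namespace EPI
namespace Hyp
variable {H : ℂ → ℂ} {Λ : ℕ → ℝ} {δ A c : ℝ}

lemma sum_ge (h0 : ∀ n, 0 ≤ Λ n) {y : ℝ} (hy : 0 ≤ y) (N : ℕ) :
    ∑ n ∈ Finset.Icc 1 N, Λ n * (y - n) ≤ ∑ n ∈ Finset.Icc 1 ⌊y⌋₊, Λ n * (y - n) := by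
  rcases le_total N ⌊y⌋₊ with h | h
  · refine Finset.sum_le_sum_of_subset_of_nonneg (Finset.Icc_subset_Icc le_rfl h) fun n hn _ => ?_
    refine mul_nonneg (h0 n) ?_
    have := (Nat.le_floor_iff hy).1 (Finset.mem_Icc.1 hn).2
    linarith
  · rw [← Finset.sum_sdiff (Finset.Icc_subset_Icc (le_refl 1) h)]
    have : ∑ n ∈ Finset.Icc 1 N \ Finset.Icc 1 ⌊y⌋₊, Λ n * (y - n) ≤ 0 := by
      refine Finset.sum_nonpos fun n hn => ?_
      rw [Finset.mem_sdiff, Finset.mem_Icc, Finset.mem_Icc] at hn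
      have h2 : ⌊y⌋₊ < n := by
        by_contra hc
        exact hn.2 ⟨hn.1.1, not_lt.1 hc⟩
      have := (Nat.floor_lt hy).1 h2
      exact mul_nonpos_of_nonneg_of_nonpos (h0 n) (by linarith)
    linarith

theorem psi_bound (h : Hyp H Λ δ A c) : ∃ C c0 x0 : ℝ, 0 < C ∧ 0 < c0 ∧ 2 ≤ x0 ∧ ∀ x, x0 ≤ x →
    |(∑ n ∈ Finset.Icc 1 ⌊x⌋₊, Λ n) - x| ≤ C * x * Real.exp (-c0 * √(Real.log x)) := by
  obtain ⟨C, k, x0, hC, hk, hx0, hb⟩ := h.smooth_bound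
  refine ⟨1 / 2 + 8 * C * Real.exp k, k / 2, max (2 * x0) (Real.exp (4 / k ^ 2)), by positivity, by positivity,
    le_max_of_le_left (by linarith), ?_⟩
  intro x hx
  have hx1 : 2 * x0 ≤ x := (le_max_left _ _).trans hx
  have hx2 : Real.exp (4 / k ^ 2) ≤ x := (le_max_right _ _).trans hx
  have hxp : 0 < x := by linarith
  have hlog : 4 / k ^ 2 ≤ Real.log x := (Real.le_log_iff_exp_le hxp).2 hx2
  set l := √(Real.log x) with hl
  have hl2 : 2 / k ≤ l := Real.le_sqrt_of_sq_le (by rw [div_pow]; norm_num; exact hlog)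
  have hkl : 1 ≤ k / 2 * l := by
    have := mul_le_mul_of_nonneg_left hl2 (by positivity : 0 ≤ k / 2)
    have e : k / 2 * (2 / k) = 1 := by field_simp
    linarith
  set η := Real.exp (-(k / 2) * l) with hη
  have hη0 : 0 < η := Real.exp_pos _
  have hη1 : η ≤ 1 / 2 := by
    rw [hη, neg_mul, Real.exp_neg, one_div]
    gcongr
    have := Real.add_one_le_exp (k / 2 * l)
    linarith
  set E := 4 * C * Real.exp k * x ^ 2 * η ^ 2 with hE
  set S : ℝ → ℝ := fun y => ∑ n ∈ Finset.Icc 1 ⌊y⌋₊, Λ n * (y - n) with hS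
  have key : ∀ y, x / 2 ≤ y → y ≤ 2 * x → |S y - (y ^ 2 - 1) / 2| ≤ E := by
    intro y h1 h2
    have hy0 : 0 < y := by linarith
    have hb' := hb y (by linarith)
    have e : S y - (y ^ 2 - 1) / 2 = y * ((∑ n ∈ Finset.Icc 1 ⌊y⌋₊, Λ n * (1 - n / y)) - (y - 1 / y) / 2) := by
      rw [mul_sub, Finset.mul_sum]
      congr 1
      · refine Finset.sum_congr rfl fun n _ => ?_
        field_simp
      · field_simp
    rw [e, abs_mul, abs_of_pos hy0]
    have hly : l - 1 ≤ √(Real.log y) := by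
      have h3 : Real.log x ≤ Real.log y + 1 := by
        have : Real.log x ≤ Real.log (2 * y) := Real.log_le_log hxp (by linarith)
        rw [Real.log_mul (by norm_num) hy0.ne'] at this
        have := Real.log_two_lt_d9
        linarith
      have h4 : l ≤ √(Real.log y) + 1 := by
        rw [hl]
        refine Real.sqrt_le_iff.2 ⟨by positivity, ?_⟩
        have h5 : Real.log y ≤ √(Real.log y) ^ 2 := by
          rw [Real.sq_sqrt (Real.log_nonneg (by linarith))]
        nlinarith [Real.sqrt_nonneg (Real.log y)]
      linarith
    calc y * _ ≤ y * (C * y * Real.exp (-k * √(Real.log y))) := by gcongr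
      _ ≤ (2 * x) * (C * (2 * x) * (Real.exp k * η ^ 2)) := by
        gcongr
        rw [hη, ← Real.exp_nat_mul, ← Real.exp_add]
        gcongr
        push_cast
        nlinarith
      _ = E := by rw [hE]; ring
  set ψ := ∑ n ∈ Finset.Icc 1 ⌊x⌋₊, Λ n with hψ
  have hmove : ∀ u : ℝ, 0 ≤ x + u → S x + u * ψ ≤ S (x + u) := by
    intro u hu
    refine le_trans (le_of_eq ?_) (sum_ge h.nonneg hu ⌊x⌋₊)
    rw [hS, hψ, Finset.mul_sum, ← Finset.sum_add_distrib]
    refine Finset.sum_congr rfl fun n _ => by ring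
  have hxη : x * η ≤ x * (1 / 2) := by gcongr
  have hxη0 : 0 < x * η := by positivity
  have k0 := abs_le.1 (key x (by linarith) (by linarith))
  have k1 := abs_le.1 (key (x + x * η) (by linarith) (by linarith))
  have k2 := abs_le.1 (key (x + -(x * η)) (by linarith) (by linarith))
  have m1 := hmove (x * η) (by linarith)
  have m2 := hmove (-(x * η)) (by linarith)
  have hE2 : 2 * E = x * η * (8 * C * Real.exp k * x * η) := by rw [hE]; ring
  rw [abs_le]
  constructor
  · refine le_of_mul_le_mul_left ?_ hxη0
    have : x * η * -((1 / 2 + 8 * C * Real.exp k) * x * η) = - (x * η) ^ 2 / 2 - 2 * E := by rw [hE2]; ring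
    rw [this]
    nlinarith
  · refine le_of_mul_le_mul_left ?_ hxη0
    have : x * η * ((1 / 2 + 8 * C * Real.exp k) * x * η) = (x * η) ^ 2 / 2 + 2 * E := by rw [hE2]; ring
    rw [this]
    nlinarith

end Hyp
end EPI

namespace EPI
section D1
variable (K : Type*) [Field K] [NumberField K]

/-- ideals of norm `n`. -/
def idn (n : ℕ) : Finset (Ideal (𝓞 K)) := (Ideal.finite_setOfPred_absNorm_eq (S := 𝓞 K) n).toFinset

open Classical in
/-- nonzero primes of norm at most `n`. -/
def pr (n : ℕ) : Finset (Ideal (𝓞 K)) :=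
  (Ideal.finite_setOfPred_absNorm_le (S := 𝓞 K) n).toFinset.filter (fun p => p.IsPrime ∧ p ≠ ⊥)

variable {K}
lemma mem_idn {n : ℕ} {I : Ideal (𝓞 K)} : I ∈ idn K n ↔ absNorm I = n := by simp [idn]
lemma mem_pr {n : ℕ} {p : Ideal (𝓞 K)} : p ∈ pr K n ↔ absNorm p ≤ n ∧ p.IsPrime ∧ p ≠ ⊥ := by simp [pr]

lemma two_le_absNorm {p : Ideal (𝓞 K)} (h : p.IsPrime) (h0 : p ≠ ⊥) : 2 ≤ absNorm p := by
  have h1 : absNorm p ≠ 0 := by rwa [Ne, Ideal.absNorm_eq_zero_iff]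
  have h2 : absNorm p ≠ 1 := by rw [Ne, Ideal.absNorm_eq_one_iff]; exact h.ne_top
  omega

lemma card_idn (n : ℕ) : (idn K n).card = Nat.card {I : Ideal (𝓞 K) // absNorm I = n} := by
  have := Set.ncard_eq_toFinset_card {I : Ideal (𝓞 K) | absNorm I = n}
    (Ideal.finite_setOfPred_absNorm_eq (S := 𝓞 K) n)
  rw [idn, ← this, ← Nat.card_coe_set_eq]
  rfl

variable (K) in
open Classical in
/-- The von Mangoldt function of `K`. -/
def Lam (n : ℕ) : ℝ :=
  ∑ p ∈ pr K n, ∑ k ∈ Finset.Icc 1 n, if absNorm p ^ k = n then Real.log (absNorm p) else 0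

lemma log_absNorm_nonneg (p : Ideal (𝓞 K)) : 0 ≤ Real.log (absNorm p) := Real.log_natCast_nonneg _

lemma Lam_nonneg (n : ℕ) : 0 ≤ Lam K n :=
  Finset.sum_nonneg fun p _ => Finset.sum_nonneg fun k _ => by
    split_ifs
    · exact log_absNorm_nonneg p
    · exact le_rfl

lemma Lam_eq {n N : ℕ} (h : n ≤ N) : Lam K n =
    ∑ p ∈ pr K N, ∑ k ∈ Finset.Icc 1 N, if absNorm p ^ k = n then Real.log (absNorm p) else 0 := by
  rw [Lam]
  have hk : ∀ p ∈ pr K N, ∀ k, absNorm p ^ k = n → k ≤ n := by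
    intro p hp k hk
    rw [mem_pr] at hp
    rw [← hk]
    exact (Nat.lt_pow_self (two_le_absNorm hp.2.1 hp.2.2)).le
  have hsub : pr K n ⊆ pr K N := fun p hp => by
    rw [mem_pr] at hp ⊢; exact ⟨hp.1.trans h, hp.2⟩
  rw [← Finset.sum_subset hsub]
  · refine Finset.sum_congr rfl fun p hp => ?_
    refine Finset.sum_subset (Finset.Icc_subset_Icc le_rfl h) fun k h1 h2 => ?_
    rw [if_neg]
    intro h3
    have := hk p (hsub hp) k h3
    rw [Finset.mem_Icc] at h1 h2
    omega
  · intro p h1 h2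
    refine Finset.sum_eq_zero fun k h3 => ?_
    rw [if_neg]
    intro h4
    apply h2
    rw [mem_pr] at h1 ⊢
    refine ⟨?_, h1.2⟩
    rw [← h4]
    exact Nat.le_self_pow (by rw [Finset.mem_Icc] at h3; omega) _

open UniqueFactorizationMonoid in
open Classical in
lemma log_eq {n : ℕ} (hn : 1 ≤ n) {I : Ideal (𝓞 K)} (hI : absNorm I = n) :
    Real.log n = ∑ p ∈ pr K n, ∑ k ∈ Finset.Icc 1 n, if p ^ k ∣ I then Real.log (absNorm p) else 0 := by
  have hI0 : I ≠ 0 := by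
    rintro rfl
    rw [Ideal.zero_eq_bot, Ideal.absNorm_bot] at hI
    omega
  have hprod : (normalizedFactors I).prod = I := by
    exact associated_iff_eq.1 (prod_normalizedFactors hI0)
  have hsub : (normalizedFactors I).toFinset ⊆ pr K n := by
    intro p hp
    rw [Multiset.mem_toFinset] at hp
    have hpp := prime_of_normalized_factor p hp
    rw [mem_pr]
    refine ⟨?_, Ideal.isPrime_of_prime hpp, hpp.ne_zero⟩
    rw [← hI]
    refine Nat.le_of_dvd (by omega) (Ideal.absNorm_dvd_absNorm_of_le ?_)
    exact Ideal.dvd_iff_le.1 (dvd_of_mem_normalizedFactors hp)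
  have hcount : ∀ p ∈ pr K n, ∀ k, p ^ k ∣ I ↔ k ≤ (normalizedFactors I).count p := by
    intro p hp k
    rw [mem_pr] at hp
    have hpr := Ideal.prime_of_isPrime hp.2.2 hp.2.1
    rw [Multiset.le_count_iff_replicate_le, dvd_iff_normalizedFactors_le_normalizedFactors (pow_ne_zero _ hpr.ne_zero) hI0,
      normalizedFactors_pow, normalizedFactors_irreducible hpr.irreducible, normalize_eq, Multiset.nsmul_singleton]
  have e1 : Real.log n = ∑ p ∈ pr K n, ((normalizedFactors I).count p : ℝ) * Real.log (absNorm p) := by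
    conv_lhs => rw [← hI, ← hprod, map_multiset_prod, Finset.prod_multiset_map_count]
    rw [Nat.cast_prod, Real.log_prod]
    · rw [← Finset.sum_subset hsub]
      · refine Finset.sum_congr rfl fun p _ => ?_
        rw [Nat.cast_pow, Real.log_pow]
      · intro p _ h2
        rw [Multiset.mem_toFinset] at h2
        rw [Multiset.count_eq_zero_of_notMem h2]; simp
    · intro p hp
      have := (mem_pr.1 (hsub hp))
      have := two_le_absNorm this.2.1 this.2.2
      positivity
  rw [e1]
  refine Finset.sum_congr rfl fun p hp => ?_
  rw [← Finset.sum_filter, Finset.sum_const, nsmul_eq_mul]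
  congr 2
  have : Finset.filter (fun k => p ^ k ∣ I) (Finset.Icc 1 n) = Finset.Icc 1 ((normalizedFactors I).count p) := by
    ext k
    rw [Finset.mem_filter, Finset.mem_Icc, Finset.mem_Icc, hcount p hp]
    constructor
    · rintro ⟨⟨a, b⟩, c⟩; exact ⟨a, c⟩
    · rintro ⟨a, c⟩
      refine ⟨⟨a, ?_⟩, c⟩
      have h1 := (hcount p hp k).2 c
      rw [mem_pr] at hp
      have h2 : absNorm p ^ k ∣ n := by
        rw [← hI, ← map_pow]
        exact Ideal.absNorm_dvd_absNorm_of_le (Ideal.dvd_iff_le.1 h1)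
      exact (Nat.lt_pow_self (two_le_absNorm hp.2.1 hp.2.2)).le.trans (Nat.le_of_dvd (by omega) h2)
  rw [this, Nat.card_Icc]; simp

open Classical in
lemma card_dvd {n : ℕ} (hn : 1 ≤ n) {J : Ideal (𝓞 K)} (hJ : J ≠ ⊥) :
    ((((idn K n).filter (fun I => J ∣ I)).card : ℕ) : ℝ) =
      ∑ x ∈ n.divisorsAntidiagonal, (if absNorm J = x.1 then (1 : ℝ) else 0) * (idn K x.2).card := by
  have hJ0 : absNorm J ≠ 0 := by rwa [Ne, Ideal.absNorm_eq_zero_iff]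
  by_cases h : absNorm J ∣ n
  · obtain ⟨m, rfl⟩ := h
    have hm : m ≠ 0 := by rintro rfl; simp at hn
    rw [Finset.sum_eq_single (absNorm J, m)]
    · rw [if_pos rfl, one_mul]
      congr 1
      rw [← Finset.card_image_of_injective (idn K m) (mul_right_injective₀ (a := J) hJ)]
      congr 1
      ext I
      simp only [Finset.mem_filter, Finset.mem_image, mem_idn]
      constructor
      · rintro ⟨h1, I', rfl⟩
        refine ⟨I', ?_, rfl⟩
        rw [map_mul] at h1
        exact Nat.eq_of_mul_eq_mul_left (by omega) h1
      · rintro ⟨I', h1, rfl⟩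
        exact ⟨by rw [map_mul, h1], dvd_mul_right _ _⟩
    · intro x hx hne
      rw [if_neg, zero_mul]
      intro h2
      rw [Nat.mem_divisorsAntidiagonal] at hx
      apply hne
      ext
      · exact h2.symm
      · rw [← h2] at hx
        exact Nat.eq_of_mul_eq_mul_left (by omega) hx.1
    · intro h2
      exact absurd (Nat.mem_divisorsAntidiagonal.2 ⟨rfl, by positivity⟩) h2
  · rw [Finset.filter_eq_empty_iff.2, Finset.sum_eq_zero]
    · simp
    · intro x hx
      rw [if_neg, zero_mul]
      intro h2
      rw [Nat.mem_divisorsAntidiagonal] at hx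
      exact h ⟨x.2, by rw [h2, hx.1]⟩
    · intro I hI h2
      rw [mem_idn] at hI
      exact h (hI ▸ Ideal.absNorm_dvd_absNorm_of_le (Ideal.dvd_iff_le.1 h2))

lemma conv_eq {n : ℕ} (hn : 1 ≤ n) :
    ∑ x ∈ n.divisorsAntidiagonal, Lam K x.1 * (idn K x.2).card = (idn K n).card * Real.log n := by
  classical
  calc _ = ∑ x ∈ n.divisorsAntidiagonal, ∑ p ∈ pr K n, ∑ k ∈ Finset.Icc 1 n,
        Real.log (absNorm p) * ((if absNorm (p ^ k) = x.1 then (1:ℝ) else 0) * (idn K x.2).card) := by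
        refine Finset.sum_congr rfl fun x hx => ?_
        have hx' := Nat.mem_divisorsAntidiagonal.1 hx
        rw [Lam_eq (Nat.le_of_dvd (by omega) ⟨x.2, hx'.1.symm⟩), Finset.sum_mul]
        refine Finset.sum_congr rfl fun p _ => ?_
        rw [Finset.sum_mul]
        refine Finset.sum_congr rfl fun k _ => ?_
        rw [map_pow]
        split_ifs <;> ring
    _ = ∑ p ∈ pr K n, ∑ k ∈ Finset.Icc 1 n, Real.log (absNorm p) * ∑ x ∈ n.divisorsAntidiagonal,
        ((if absNorm (p ^ k) = x.1 then (1:ℝ) else 0) * (idn K x.2).card) := by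
        rw [Finset.sum_comm]
        refine Finset.sum_congr rfl fun p _ => ?_
        rw [Finset.sum_comm]
        refine Finset.sum_congr rfl fun k _ => ?_
        rw [Finset.mul_sum]
    _ = ∑ p ∈ pr K n, ∑ k ∈ Finset.Icc 1 n, ∑ I ∈ idn K n, if p ^ k ∣ I then Real.log (absNorm p) else 0 := by
        refine Finset.sum_congr rfl fun p hp => Finset.sum_congr rfl fun k _ => ?_
        rw [← card_dvd hn (pow_ne_zero k (mem_pr.1 hp).2.2), ← Finset.sum_filter, Finset.sum_const, nsmul_eq_mul, mul_comm]
    _ = ∑ I ∈ idn K n, ∑ p ∈ pr K n, ∑ k ∈ Finset.Icc 1 n, if p ^ k ∣ I then Real.log (absNorm p) else 0 := by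
        rw [Finset.sum_comm]
        conv_rhs => rw [Finset.sum_comm]
        rw [Finset.sum_comm]
        refine Finset.sum_congr rfl fun p _ => ?_
        rw [Finset.sum_comm]
    _ = ∑ I ∈ idn K n, Real.log n := Finset.sum_congr rfl fun I hI => (log_eq hn (mem_idn.1 hI)).symm
    _ = _ := by rw [Finset.sum_const, nsmul_eq_mul]

lemma card_idn_one : (idn K 1).card = 1 := by
  rw [Finset.card_eq_one]
  refine ⟨⊤, ?_⟩
  ext I
  rw [mem_idn, Ideal.absNorm_eq_one_iff, Finset.mem_singleton]

lemma Lam_zero : Lam K 0 = 0 := by simp [Lam]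
lemma Lam_one : Lam K 1 = 0 := by
  rw [Lam]
  refine Finset.sum_eq_zero fun p hp => ?_
  have := mem_pr.1 hp
  have := two_le_absNorm this.2.1 this.2.2
  omega

lemma Lam_le (n : ℕ) : Lam K n ≤ (idn K n).card * Real.log n := by
  rcases Nat.eq_zero_or_pos n with rfl | hn
  · rw [Lam_zero]; simp
  · rw [← conv_eq hn]
    have h := Finset.single_le_sum (f := fun x : ℕ × ℕ => Lam K x.1 * (idn K x.2).card) (s := n.divisorsAntidiagonal)
      (fun x _ => mul_nonneg (Lam_nonneg _) (by positivity)) (a := (n, 1))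
      (Nat.mem_divisorsAntidiagonal.2 ⟨mul_one n, by omega⟩)
    simpa [card_idn_one] using h
end D1
end EPI

namespace EPI
section E
open MeasureTheory Complex Asymptotics

variable {a : ℕ → ℝ} {κ δ C : ℝ}

/-- summatory function -/
def Nsum (a : ℕ → ℝ) (x : ℝ) : ℝ := ∑ n ∈ Finset.Icc 1 ⌊x⌋₊, a n

/-- error term -/
def Err (a : ℕ → ℝ) (κ : ℝ) : ℝ → ℂ := Set.indicator (Set.Ioi 1) (fun t => ((Nsum a t - κ * t : ℝ) : ℂ))

lemma Nsum_measurable (a : ℕ → ℝ) : Measurable (Nsum a) :=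
  (measurable_from_nat (f := fun N : ℕ => ∑ n ∈ Finset.Icc 1 N, a n)).comp Nat.measurable_floor

lemma Err_measurable : Measurable (Err a κ) := by
  unfold Err
  refine Measurable.indicator ?_ measurableSet_Ioi
  have := Nsum_measurable a
  fun_prop

lemma Err_le (hC : 0 < C) (hN : ∀ x, 1 ≤ x → |Nsum a x - κ * x| ≤ C * x ^ (1 - δ)) (t : ℝ) (ht : 0 < t) :
    ‖Err a κ t‖ ≤ C * t ^ (1 - δ) := by
  unfold Err
  by_cases h : t ∈ Set.Ioi 1
  · rw [Set.indicator_of_mem h, Complex.norm_real]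
    exact hN t (le_of_lt h)
  · rw [Set.indicator_of_notMem h, norm_zero]
    positivity

lemma mellin_diff (hC : 0 < C) (hN : ∀ x, 1 ≤ x → |Nsum a x - κ * x| ≤ C * x ^ (1 - δ)) {s : ℂ} (hs : 1 - δ < s.re) :
    DifferentiableAt ℂ (fun s => mellin (Err a κ) (-s)) s := by
  have hloc : LocallyIntegrableOn (Err a κ) (Set.Ioi 0) := by
    have hc : LocallyIntegrableOn (fun t : ℝ => C * t ^ (1 - δ)) (Set.Ioi 0) := by
      refine ContinuousOn.locallyIntegrableOn ?_ measurableSet_Ioi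
      exact continuousOn_const.mul (ContinuousOn.rpow_const continuousOn_id fun x hx => Or.inl (ne_of_gt hx))
    rw [locallyIntegrableOn_iff isOpen_Ioi.isLocallyClosed] at hc ⊢
    intro k hk1 hk2
    refine Integrable.mono' (hc k hk1 hk2) Err_measurable.aestronglyMeasurable ?_
    refine (ae_restrict_iff' hk2.measurableSet).2 (Eventually.of_forall fun t ht => Err_le hC hN t (hk1 ht))
  have hd := mellin_differentiableAt_of_isBigO_rpow (f := Err a κ) (a := -(1 - δ)) (b := -s.re - 1) (s := -s)
    hloc ?_ (by simp; linarith) ?_ (by simp)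
  · exact DifferentiableAt.fun_comp' s hd differentiableAt_id.neg
  · rw [neg_neg]
    refine IsBigO.of_bound C ?_
    filter_upwards [eventually_gt_atTop 0] with t ht
    rw [Real.norm_of_nonneg (by positivity)]
    exact Err_le hC hN t ht
  · refine IsBigO.of_bound 0 ?_
    filter_upwards [Ioo_mem_nhdsGT (zero_lt_one' ℝ)] with t ht
    rw [Err, Set.indicator_of_notMem (by simp; exact ht.2.le)]
    simp

lemma mellin_eq (s : ℂ) : mellin (Err a κ) (-s) =
    ∫ t in Set.Ioi (1:ℝ), (t : ℂ) ^ (-(s + 1)) * ((Nsum a t - κ * t : ℝ) : ℂ) := by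
  unfold mellin Err
  have : ∀ t : ℝ, (t : ℂ) ^ (-s - 1) • Set.indicator (Set.Ioi 1) (fun t : ℝ => ((Nsum a t - κ * t : ℝ) : ℂ)) t =
    Set.indicator (Set.Ioi 1) (fun t : ℝ => (t : ℂ) ^ (-(s + 1)) * ((Nsum a t - κ * t : ℝ) : ℂ)) t := by
    intro t
    by_cases h : t ∈ Set.Ioi (1:ℝ)
    · rw [Set.indicator_of_mem h, Set.indicator_of_mem h, smul_eq_mul]
      congr 2; ring
    · rw [Set.indicator_of_notMem h, Set.indicator_of_notMem h, smul_zero]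
  simp_rw [this]
  rw [setIntegral_indicator measurableSet_Ioi]
  congr 2
  rw [Set.inter_eq_right]
  exact Set.Ioi_subset_Ioi zero_le_one

lemma integrand_le (hN : ∀ x, 1 ≤ x → |Nsum a x - κ * x| ≤ C * x ^ (1 - δ)) (s : ℂ) {t : ℝ} (ht : 1 < t) :
    ‖(t : ℂ) ^ (-(s + 1)) * ((Nsum a t - κ * t : ℝ) : ℂ)‖ ≤ C * t ^ (-s.re - δ) := by
  have ht0 : 0 < t := by linarith
  rw [norm_mul, Complex.norm_real, Complex.norm_cpow_eq_rpow_re_of_pos ht0]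
  calc _ ≤ t ^ (-(s+1)).re * (C * t ^ (1 - δ)) := by
        gcongr; exact hN t ht.le
    _ = C * (t ^ (-(s+1)).re * t ^ (1 - δ)) := by ring
    _ = _ := by rw [← Real.rpow_add ht0]; congr 2; simp; ring

lemma integrand_integrable (hN : ∀ x, 1 ≤ x → |Nsum a x - κ * x| ≤ C * x ^ (1 - δ)) {s : ℂ} (hs : 1 - δ < s.re) :
    IntegrableOn (fun t : ℝ => (t : ℂ) ^ (-(s + 1)) * ((Nsum a t - κ * t : ℝ) : ℂ)) (Set.Ioi 1) := by
  refine Integrable.mono' ((integrableOn_Ioi_rpow_of_lt (a := -s.re - δ) (by linarith) one_pos).const_mul C) ?_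
    ((ae_restrict_iff' measurableSet_Ioi).2 (Eventually.of_forall fun t ht => integrand_le hN s ht))
  have := Nsum_measurable a
  refine Measurable.aestronglyMeasurable ?_
  fun_prop

lemma mellin_le (hN : ∀ x, 1 ≤ x → |Nsum a x - κ * x| ≤ C * x ^ (1 - δ)) {s : ℂ} (hs : 1 - δ < s.re) :
    ‖mellin (Err a κ) (-s)‖ ≤ C / (s.re - (1 - δ)) := by
  rw [mellin_eq]
  have hlt : -s.re - δ < -1 := by linarith
  calc _ ≤ ∫ t in Set.Ioi (1:ℝ), C * t ^ (-s.re - δ) :=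
        norm_integral_le_of_norm_le ((integrableOn_Ioi_rpow_of_lt hlt one_pos).const_mul C)
          ((ae_restrict_iff' measurableSet_Ioi).2 (Eventually.of_forall fun t ht => integrand_le hN s ht))
    _ = C * (-(1:ℝ) ^ (-s.re - δ + 1) / (-s.re - δ + 1)) := by
        rw [integral_const_mul, integral_Ioi_rpow_of_lt hlt one_pos]
    _ = _ := by
        rw [Real.one_rpow, neg_div, ← div_neg, mul_one_div]
        congr 1; ring

lemma Nsum_bigO (hC : 0 < C) (hδ : 0 < δ) (hN : ∀ x, 1 ≤ x → |Nsum a x - κ * x| ≤ C * x ^ (1 - δ)) :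
    (fun n : ℕ => ∑ k ∈ Finset.Icc 1 n, a k) =O[atTop] fun n => (n : ℝ) ^ (1:ℝ) := by
  refine IsBigO.of_bound (|κ| + C) ?_
  filter_upwards [eventually_ge_atTop 1] with n hn
  have hn1 : (1:ℝ) ≤ n := by exact_mod_cast hn
  have h := hN n hn1
  rw [Nsum, Nat.floor_natCast] at h
  rw [Real.rpow_one, Real.norm_eq_abs, Real.norm_eq_abs, abs_of_pos (by linarith : (0:ℝ) < n)]
  have h1 : (n:ℝ) ^ (1 - δ) ≤ n := by
    calc (n:ℝ) ^ (1 - δ) ≤ (n:ℝ) ^ (1:ℝ) := Real.rpow_le_rpow_of_exponent_le hn1 (by linarith)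
      _ = n := Real.rpow_one _
  have h2 := abs_add_le (∑ k ∈ Finset.Icc 1 n, a k - κ * n) (κ * n)
  rw [sub_add_cancel, abs_mul, abs_of_pos (by linarith : (0:ℝ) < n)] at h2
  nlinarith

theorem exists_H (h0 : ∀ n, 0 ≤ a n) (hC : 0 < C) (hδ : 0 < δ) (hδ1 : δ ≤ 1) (hκ : 0 < κ)
    (hN : ∀ x, 1 ≤ x → |Nsum a x - κ * x| ≤ C * x ^ (1 - δ)) :
    (∀ s : ℂ, 1 < s.re → LSeriesSummable (fun n => (a n : ℂ)) s) ∧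
    ∃ (H : ℂ → ℂ) (A : ℝ), 0 < A ∧ DifferentiableOn ℂ H {s | 1 - δ / 2 < s.re} ∧
      (∀ s : ℂ, 1 - δ / 2 < s.re → s.re ≤ 3 → ‖H s‖ ≤ Real.exp (A * tau s.im)) ∧
      H 1 = κ ∧ ∀ s : ℂ, 1 < s.re → H s = (s - 1) * LSeries (fun n => (a n : ℂ)) s := by
  have hO := Nsum_bigO hC hδ hN
  refine ⟨fun s hs => LSeriesSummable_of_sum_norm_bigO_and_nonneg hO h0 zero_le_one hs, ?_⟩
  set M := κ + 2 * C / δ with hM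
  have hM0 : 0 < M := by positivity
  refine ⟨fun s => κ * s + s * (s - 1) * mellin (Err a κ) (-s), |Real.log M| + 2, by positivity, ?_, ?_, ?_, ?_⟩
  · intro s hs
    have := mellin_diff (a := a) (κ := κ) hC hN (s := s) (by rw [Set.mem_ofPred_eq] at hs; linarith)
    exact (DifferentiableAt.fun_add (by fun_prop) (DifferentiableAt.fun_mul (by fun_prop) this)).differentiableWithinAt
  · intro s h1 h3
    have hm := mellin_le (a := a) (κ := κ) hN (s := s) (by linarith)
    have hm2 : ‖mellin (Err a κ) (-s)‖ ≤ 2 * C / δ := by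
      refine hm.trans ?_
      rw [div_le_div_iff₀ (by linarith) hδ]
      nlinarith
    have n1 : ‖s‖ ≤ |s.im| + 3 := by
      have := Complex.norm_le_abs_re_add_abs_im s
      rw [abs_of_pos (by linarith : 0 < s.re)] at this
      linarith
    have n2 : ‖s - 1‖ ≤ |s.im| + 3 := by
      have := Complex.norm_le_abs_re_add_abs_im (s - 1)
      have h4 : |(s - 1).re| ≤ 3 := by rw [abs_le]; simp; constructor <;> linarith
      simp at this h4
      linarith
    have hp : 1 ≤ |s.im| + 3 := by have := abs_nonneg s.im; linarith
    calc _ ≤ ‖(κ : ℂ) * s‖ + ‖s * (s - 1) * mellin (Err a κ) (-s)‖ := norm_add_le _ _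
      _ = κ * ‖s‖ + ‖s‖ * ‖s - 1‖ * ‖mellin (Err a κ) (-s)‖ := by
        rw [norm_mul, norm_mul, norm_mul, Complex.norm_real, Real.norm_of_nonneg hκ.le]
      _ ≤ κ * (|s.im| + 3) ^ 2 + (|s.im| + 3) * (|s.im| + 3) * (2 * C / δ) := by
        gcongr
        exact n1.trans (by nlinarith)
      _ = M * (|s.im| + 3) ^ 2 := by rw [hM]; ring
      _ = Real.exp (Real.log M + 2 * tau s.im) := by
        rw [Real.exp_add, Real.exp_log hM0, tau, mul_comm 2, Real.exp_mul, Real.exp_log (by linarith)]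
        norm_num
      _ ≤ _ := by
        gcongr
        have := one_le_tau s.im
        have h5 := le_abs_self (Real.log M)
        nlinarith [abs_nonneg (Real.log M)]
  · simp
  · intro s hs
    have hs0 : s - 1 ≠ 0 := by
      intro h; have := congrArg Complex.re h; simp at this; linarith
    simp only []
    rw [LSeries_eq_mul_integral_of_nonneg a zero_le_one hs hO h0, mellin_eq]
    have e : ∀ t : ℝ, t ∈ Set.Ioi (1:ℝ) → (∑ k ∈ Finset.Icc 1 ⌊t⌋₊, (a k : ℂ)) * (t : ℂ) ^ (-(s + 1)) =
        (t : ℂ) ^ (-(s + 1)) * ((Nsum a t - κ * t : ℝ) : ℂ) + κ * (t : ℂ) ^ (-s) := by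
      intro t ht
      have ht0 : (t : ℂ) ≠ 0 := by
        have : (0:ℝ) < t := lt_trans one_pos ht
        exact_mod_cast this.ne'
      have : (t : ℂ) ^ (-s) = (t : ℂ) ^ (-(s + 1)) * t := by
        rw [show -s = -(s + 1) + 1 by ring, Complex.cpow_add _ _ ht0, Complex.cpow_one]
      rw [this, Nsum]
      push_cast
      ring
    rw [setIntegral_congr_fun measurableSet_Ioi e, integral_add (integrand_integrable hN (by linarith))
      ((integrableOn_Ioi_cpow_of_lt (by simpa using hs) one_pos).const_mul _), integral_const_mul,
      integral_Ioi_cpow_of_lt (by simpa using hs) one_pos]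
    have hs1 : -s + 1 ≠ 0 := by
      intro h; apply hs0; linear_combination -h
    simp only [Complex.ofReal_one, Complex.one_cpow]
    field_simp
    ring
end E
end EPI

namespace EPI
section D2
open LSeries

lemma norm_LSeries_le {f : ℕ → ℝ} (h0 : ∀ n, 0 ≤ f n) {s : ℂ} (h1 : LSeriesSummable (fun n => (f n : ℂ)) s)
    (h2 : LSeriesSummable (fun n => (f n : ℂ)) (s.re : ℂ)) :
    ‖LSeries (fun n => (f n : ℂ)) s‖ ≤ (LSeries (fun n => (f n : ℂ)) (s.re : ℂ)).re := by
  calc _ ≤ ∑' n, ‖LSeries.term (fun n => (f n : ℂ)) s n‖ := norm_tsum_le_tsum_norm h1.norm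
    _ = ∑' n, (LSeries.term (fun n => (f n : ℂ)) (s.re : ℂ) n).re := by
        refine tsum_congr fun n => ?_
        rw [re_term, LSeries.norm_term_eq]
        split_ifs with hn
        · rfl
        · simp [abs_of_nonneg (h0 n), Real.rpow_neg, div_eq_mul_inv]
    _ = _ := (Complex.re_tsum h2).symm

theorem exists_hyp {a Λ : ℕ → ℝ} (a0 : ∀ n, 0 ≤ a n) (a1 : a 1 = 1) (L0 : ∀ n, 0 ≤ Λ n) (Lz : Λ 0 = 0) (L1 : Λ 1 = 0)
    (Lle : ∀ n, Λ n ≤ a n * Real.log n)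
    (hconv : ∀ n, 1 ≤ n → ∑ x ∈ n.divisorsAntidiagonal, Λ x.1 * a x.2 = a n * Real.log n)
    {κ δ C : ℝ} (hC : 0 < C) (hδ : 0 < δ) (hδ1 : δ ≤ 1) (hκ : 0 < κ)
    (hN : ∀ x, 1 ≤ x → |Nsum a x - κ * x| ≤ C * x ^ (1 - δ)) :
    ∃ (H : ℂ → ℂ) (δ A c : ℝ), Hyp H Λ δ A c := by
  obtain ⟨hsum, H, A, hA, hol, hgr, hone, hHZ⟩ := exists_H a0 hC hδ hδ1 hκ hN
  set af : ℕ → ℂ := fun n => (a n : ℂ) with haf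
  set f : ℕ → ℝ := fun n => Λ n / Real.log n with hf
  have f0 : ∀ n, 0 ≤ f n := fun n => div_nonneg (L0 n) (Real.log_natCast_nonneg n)
  have fle : ∀ n, f n ≤ a n := by
    intro n
    rcases le_or_gt n 1 with h | h
    · have : Real.log n = 0 := by interval_cases n <;> simp
      simp only [hf, this, div_zero]; exact a0 n
    · have : 0 < Real.log n := Real.log_pos (by exact_mod_cast h)
      rw [hf, div_le_iff₀ this]; exact Lle n
  have flog : logMul (fun n => (f n : ℂ)) = fun n => (Λ n : ℂ) := by
    funext n
    rw [logMul, ← Complex.natCast_log, ← Complex.ofReal_mul]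
    congr 1
    rcases le_or_gt n 1 with h | h
    · interval_cases n <;> simp [Lz, L1]
    · have : 0 < Real.log n := Real.log_pos (by exact_mod_cast h)
      simp only [hf]; field_simp
  have fsum : ∀ s : ℂ, 1 < s.re → LSeriesSummable (fun n => (f n : ℂ)) s := by
    intro s hs
    refine Summable.of_norm_bounded (hsum s hs).norm fun n => LSeries.norm_term_le s ?_
    rw [Complex.norm_real, haf, Complex.norm_real, Real.norm_of_nonneg (f0 n), Real.norm_of_nonneg (a0 n)]
    exact fle n
  have absc : ∀ g : ℕ → ℂ, (∀ s : ℂ, 1 < s.re → LSeriesSummable g s) → abscissaOfAbsConv g ≤ ((1:ℝ) : EReal) := by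
    intro g hg
    exact LSeries.abscissaOfAbsConv_le_of_forall_lt_LSeriesSummable fun y hy => hg y (by simpa using hy)
  have lt1 : ∀ g : ℕ → ℂ, (∀ s : ℂ, 1 < s.re → LSeriesSummable g s) → ∀ s : ℂ, 1 < s.re → abscissaOfAbsConv g < s.re :=
    fun g hg s hs => (absc g hg).trans_lt (by exact_mod_cast hs)
  have Lsum : ∀ s : ℂ, 1 < s.re → LSeriesSummable (fun n => (Λ n : ℂ)) s := by
    intro s hs
    rw [← flog]
    exact LSeriesSummable_logMul_of_lt_re (lt1 _ fsum s hs)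
  have hZd : ∀ s : ℂ, 1 < s.re → HasDerivAt (LSeries af) (-(LSeries (fun n => (Λ n : ℂ)) s * LSeries af s)) s := by
    intro s hs
    have h1 := LSeries_hasDerivAt (lt1 _ hsum s hs)
    rw [← LSeries_convolution' (Lsum s hs) (hsum s hs)]
    have e : LSeries (convolution (fun n => (Λ n : ℂ)) af) s = LSeries (logMul af) s := by
      refine LSeries_congr (fun {n} hn => ?_) s
      rw [convolution_def, logMul, haf, ← Complex.natCast_log, mul_comm]
      have := hconv n (Nat.pos_of_ne_zero hn)
      simp only []
      exact_mod_cast this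
    rw [e]; exact h1
  have hFd : ∀ s : ℂ, 1 < s.re → HasDerivAt (LSeries fun n => (f n : ℂ)) (-LSeries (fun n => (Λ n : ℂ)) s) s := by
    intro s hs
    have h1 := LSeries_hasDerivAt (lt1 _ fsum s hs)
    rwa [flog] at h1
  set k : ℂ → ℂ := fun s => LSeries af s * Complex.exp (-LSeries (fun n => (f n : ℂ)) s) with hk
  have hkd : ∀ s : ℂ, 1 < s.re → HasDerivAt k 0 s := by
    intro s hs
    have := (hZd s hs).fun_mul (hFd s hs).fun_neg.cexp
    exact this.congr_deriv (by ring)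
  have hopen : IsOpen {s : ℂ | 1 < s.re} := isOpen_lt continuous_const Complex.continuous_re
  have hk2 : ∀ s : ℂ, 1 < s.re → k s = k 2 := by
    intro s hs
    refine hopen.is_const_of_deriv_eq_zero (convex_halfSpace_re_gt 1).isPreconnected
      (fun z hz => (hkd z hz).differentiableAt.differentiableWithinAt) (fun z hz => (hkd z hz).deriv) hs ?_
    simp
  have hk1 : k 2 = 1 := by
    have t1 := LSeries.tendsto_atTop (f := af) (lt_of_le_of_lt (absc _ hsum) (EReal.coe_lt_top _))
    have t2 := LSeries.tendsto_atTop (f := fun n => (f n : ℂ)) (lt_of_le_of_lt (absc _ fsum) (EReal.coe_lt_top _))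
    have t3 := t1.mul ((Complex.continuous_exp.tendsto _).comp t2.neg)
    have e : af 1 * Complex.exp (-(f 1 : ℂ)) = 1 := by simp [haf, a1, hf]
    rw [e] at t3
    refine tendsto_nhds_unique (f := fun x : ℝ => k x) (l := atTop) ?_ t3
    refine tendsto_const_nhds.congr' ?_
    filter_upwards [eventually_gt_atTop 1] with x hx
    exact (hk2 x (by simpa using hx)).symm
  have hZ : ∀ s : ℂ, 1 < s.re → LSeries af s = Complex.exp (LSeries (fun n => (f n : ℂ)) s) := by
    intro s hs
    have h1 := (hk2 s hs).trans hk1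
    simp only [hk] at h1
    rw [Complex.exp_neg] at h1
    rwa [mul_inv_eq_one₀ (Complex.exp_ne_zero _)] at h1
  have hZlow : ∀ s : ℂ, 1 < s.re → 1 ≤ ‖LSeries af s‖ * ‖LSeries af (s.re : ℂ)‖ := by
    intro s hs
    have hs' : 1 < ((s.re : ℂ)).re := by simpa using hs
    rw [hZ s hs, hZ _ hs', Complex.norm_exp, Complex.norm_exp, ← Real.exp_add]
    apply Real.one_le_exp
    have := norm_LSeries_le f0 (fsum s hs) (fsum _ hs')
    have h2 := (abs_le.1 (Complex.abs_re_le_norm (LSeries (fun n => (f n : ℂ)) s))).1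
    linarith
  have htau : 0 < tau 0 := tau_pos 0
  refine ⟨H, δ / 2, A, Real.exp (-(A * tau 0)), ⟨by linarith, by linarith, hA, Real.exp_pos _,
    Real.exp_le_one_iff.2 (by have := mul_pos hA htau; linarith), hol, hgr, ?_, ?_, L0, Lsum, ?_⟩⟩
  · intro s h1 h2
    have hs' : 1 < ((s.re : ℂ)).re := by simpa using h1
    have g := hgr (s.re : ℂ) (by simp; linarith) (by simp; linarith)
    rw [hHZ _ hs', norm_mul, Complex.ofReal_im] at g
    have e1 : ‖(s.re : ℂ) - 1‖ = s.re - 1 := by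
      rw [← Complex.ofReal_one, ← Complex.ofReal_sub, Complex.norm_real, Real.norm_of_nonneg (by linarith)]
    rw [e1] at g
    rw [hHZ s h1, norm_mul]
    have e2 : s.re - 1 ≤ ‖s - 1‖ := by
      refine le_trans ?_ (Complex.re_le_norm _); simp
    have hp : 0 < s.re - 1 := by linarith
    rw [Real.exp_neg, inv_mul_le_iff₀ (Real.exp_pos _)]
    calc (s.re - 1) ^ 2 ≤ (s.re - 1) ^ 2 * (‖LSeries af s‖ * ‖LSeries af (s.re : ℂ)‖) :=
          le_mul_of_one_le_right (by positivity) (hZlow s h1)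
      _ = ((s.re - 1) * ‖LSeries af (s.re : ℂ)‖) * ((s.re - 1) * ‖LSeries af s‖) := by ring
      _ ≤ _ := by gcongr
  · rw [hone]; exact_mod_cast hκ.ne'
  · intro s hs
    have hs0 : s - 1 ≠ 0 := by
      intro h; have := congrArg Complex.re h; simp at this; linarith
    have hZ0 : LSeries af s ≠ 0 := by rw [hZ s hs]; exact Complex.exp_ne_zero _
    have heq : H =ᶠ[nhds s] fun z => (z - 1) * LSeries af z := by
      filter_upwards [hopen.mem_nhds hs] with z hz
      exact hHZ z hz
    have hd : HasDerivAt (fun z => (z - 1) * LSeries af z)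
      (1 * LSeries af s + (s - 1) * -(LSeries (fun n => (Λ n : ℂ)) s * LSeries af s)) s :=
      ((hasDerivAt_id s).sub_const 1).fun_mul (hZd s hs)
    rw [logDeriv_apply, heq.deriv_eq, hd.deriv, hHZ s hs]
    field_simp
    ring
end D2
end EPI

namespace EPI
section D3
open MeasureTheory

lemma log_two_le {t : ℝ} (ht : 2 ≤ t) : (1:ℝ) / 2 ≤ Real.log t := by
  have h1 := Real.log_two_gt_d9
  have h2 := Real.log_le_log (by norm_num) ht
  linarith

lemma Li_eq {x : ℝ} (hx : 2 ≤ x) : ∫ t in (2:ℝ)..x, 1 / Real.log t =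
    x / Real.log x - 2 / Real.log 2 + ∫ t in (2:ℝ)..x, t * (t * Real.log t ^ 2)⁻¹ := by
  have hc1 : ContinuousOn (fun t : ℝ => 1 / Real.log t) (Set.uIcc 2 x) := by
    rw [Set.uIcc_of_le hx]
    intro t ht
    have : t ≠ 0 := by have := ht.1; positivity
    have h2 : Real.log t ≠ 0 := by have := log_two_le ht.1; positivity
    refine ContinuousAt.continuousWithinAt ?_
    fun_prop (disch := assumption)
  have hc2 : ContinuousOn (fun t : ℝ => t * (t * Real.log t ^ 2)⁻¹) (Set.uIcc 2 x) := by
    rw [Set.uIcc_of_le hx]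
    intro t ht
    have h1 : t ≠ 0 := by have := ht.1; positivity
    have h2 : Real.log t ≠ 0 := by have := log_two_le ht.1; positivity
    have h3 : t * Real.log t ^ 2 ≠ 0 := by positivity
    refine ContinuousAt.continuousWithinAt ?_
    fun_prop (disch := assumption)
  have := intervalIntegral.integral_eq_sub_of_hasDerivAt (a := 2) (b := x) (f := fun t => t / Real.log t)
    (f' := fun t => 1 / Real.log t - t * (t * Real.log t ^ 2)⁻¹) (by
      intro t ht
      rw [Set.uIcc_of_le hx] at ht
      have h1 : t ≠ 0 := by have := ht.1; positivity
      have h2 : Real.log t ≠ 0 := by have := log_two_le ht.1; positivity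
      have := (hasDerivAt_id t).fun_div (Real.hasDerivAt_log h1) h2
      refine this.congr_deriv ?_
      simp only [id]
      field_simp) (hc1.intervalIntegrable.sub hc2.intervalIntegrable)
  rw [intervalIntegral.integral_sub hc1.intervalIntegrable hc2.intervalIntegrable] at this
  linarith

lemma abel {b : ℕ → ℝ} (b0 : b 0 = 0) (b1 : b 1 = 0) {x : ℝ} (hx : 2 ≤ x) :
    ∑ n ∈ Finset.Icc 0 ⌊x⌋₊, (Real.log n)⁻¹ * b n = (Real.log x)⁻¹ * (∑ n ∈ Finset.Icc 0 ⌊x⌋₊, b n)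
      + ∫ t in (2:ℝ)..x, (∑ n ∈ Finset.Icc 0 ⌊t⌋₊, b n) * (t * Real.log t ^ 2)⁻¹ := by
  have hderiv : ∀ t : ℝ, deriv (fun x => (Real.log x)⁻¹) t = -(t * Real.log t ^ 2)⁻¹ := by
    intro t
    rw [Real.deriv_inv_log_apply]
    rw [mul_inv]; ring
  rw [sum_mul_eq_sub_integral_mul₁ b (f := fun n => (Real.log n)⁻¹) b0 b1, ← intervalIntegral.integral_of_le hx]
  · rw [sub_eq_add_neg, ← intervalIntegral.integral_neg]
    congr 1
    refine intervalIntegral.integral_congr fun t _ => ?_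
    simp only [hderiv]
    ring
  · intro t ht
    have h1 : t ≠ 0 := by have := ht.1; positivity
    have h2 : Real.log t ≠ 0 := by have := log_two_le ht.1; positivity
    fun_prop (disch := assumption)
  · refine ContinuousOn.integrableOn_Icc ?_
    simp_rw [funext hderiv]
    intro t ht
    have h1 : t ≠ 0 := by have := ht.1; positivity
    have h2 : Real.log t ≠ 0 := by have := log_two_le ht.1; positivity
    have h3 : t * Real.log t ^ 2 ≠ 0 := by positivity
    refine ContinuousAt.continuousWithinAt ?_
    fun_prop (disch := assumption)

lemma exp_compare {c t x : ℝ} (hc : 0 < c) (ht : 2 ≤ t) (htx : t ≤ x) :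
    Real.exp (-c * √(Real.log t)) ≤ Real.exp (c ^ 2 / 2) * Real.exp (-c * √(Real.log x)) * (√x * (√t)⁻¹) := by
  have ht0 : 0 < t := by linarith
  have hx0 : 0 < x := by linarith
  have e : √x * (√t)⁻¹ = Real.exp ((Real.log x - Real.log t) / 2) := by
    rw [sub_div, Real.exp_sub, Real.exp_half, Real.exp_half, Real.exp_log ht0, Real.exp_log hx0]
    rfl
  rw [e, ← Real.exp_add, ← Real.exp_add]
  apply Real.exp_le_exp.2
  have hl : Real.log t ≤ Real.log x := Real.log_le_log ht0 htx
  have hl0 := log_two_le ht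
  set L := Real.log x
  set l := Real.log t
  have h1 : √L ≤ √l + √(L - l) := by
    refine Real.sqrt_le_iff.2 ⟨by positivity, ?_⟩
    have a1 := Real.sq_sqrt (by linarith : 0 ≤ l)
    have a2 := Real.sq_sqrt (by linarith : 0 ≤ L - l)
    nlinarith [mul_nonneg (Real.sqrt_nonneg l) (Real.sqrt_nonneg (L - l))]
  have a2 := Real.sq_sqrt (by linarith : 0 ≤ L - l)
  nlinarith [sq_nonneg (c - √(L - l))]

theorem pi_of_theta {b : ℕ → ℝ} (b0 : b 0 = 0) (b1 : b 1 = 0) {C c : ℝ} (hC : 0 < C) (hc : 0 < c)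
    (hθ : ∀ t, 2 ≤ t → |(∑ n ∈ Finset.Icc 0 ⌊t⌋₊, b n) - t| ≤ C * t * Real.exp (-c * √(Real.log t))) {x : ℝ} (hx : 2 ≤ x) :
    |(∑ n ∈ Finset.Icc 0 ⌊x⌋₊, (Real.log n)⁻¹ * b n) - ∫ t in (2:ℝ)..x, 1 / Real.log t| ≤
      (2 * C + 8 * C * Real.exp (c ^ 2 / 2)) * x * Real.exp (-c * √(Real.log x)) + 4 := by
  set T : ℝ → ℝ := fun t => ∑ n ∈ Finset.Icc 0 ⌊t⌋₊, b n with hT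
  have hcw : ContinuousOn (fun t : ℝ => (t * Real.log t ^ 2)⁻¹) (Set.Icc 2 x) := by
    intro t ht
    have h1 : t ≠ 0 := by have := ht.1; positivity
    have h2 : Real.log t ≠ 0 := by have := log_two_le ht.1; positivity
    have h3 : t * Real.log t ^ 2 ≠ 0 := by positivity
    refine ContinuousAt.continuousWithinAt ?_
    fun_prop (disch := assumption)
  have i2 : IntervalIntegrable (fun t : ℝ => t * (t * Real.log t ^ 2)⁻¹) volume 2 x := by
    refine ContinuousOn.intervalIntegrable ?_
    rw [Set.uIcc_of_le hx]
    exact continuousOn_id.mul hcw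
  have hle : ∀ t ∈ Set.Ioc 2 x, ‖(T t - t) * (t * Real.log t ^ 2)⁻¹‖ ≤
      4 * C * Real.exp (c ^ 2 / 2) * Real.exp (-c * √(Real.log x)) * √x * (√t)⁻¹ := by
    intro t ht
    have ht2 : 2 ≤ t := ht.1.le
    have hl := log_two_le ht2
    rw [norm_mul, Real.norm_eq_abs, Real.norm_of_nonneg (by positivity)]
    calc _ ≤ (C * t * Real.exp (-c * √(Real.log t))) * (t * (1 / 2) ^ 2)⁻¹ := by
          gcongr
          exact hθ t ht2
      _ = 4 * C * Real.exp (-c * √(Real.log t)) := by field_simp; norm_num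
      _ ≤ 4 * C * (Real.exp (c ^ 2 / 2) * Real.exp (-c * √(Real.log x)) * (√x * (√t)⁻¹)) := by
          gcongr; exact exp_compare hc ht2 ht.2
      _ = _ := by ring
  have hcs : ContinuousOn (fun t : ℝ => (√t)⁻¹) (Set.uIcc 2 x) := by
    rw [Set.uIcc_of_le hx]
    refine ContinuousOn.inv₀ Real.continuous_sqrt.continuousOn fun t ht => ?_
    have := ht.1
    positivity
  have i3 : IntervalIntegrable (fun t : ℝ => 4 * C * Real.exp (c ^ 2 / 2) * Real.exp (-c * √(Real.log x)) * √x * (√t)⁻¹)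
      volume 2 x := (hcs.intervalIntegrable).const_mul _
  have hmeas : Measurable T :=
    (measurable_from_nat (f := fun N : ℕ => ∑ n ∈ Finset.Icc 0 N, b n)).comp Nat.measurable_floor
  have i4 : IntervalIntegrable (fun t : ℝ => (T t - t) * (t * Real.log t ^ 2)⁻¹) volume 2 x := by
    rw [intervalIntegrable_iff_integrableOn_Ioc_of_le hx] at i3 ⊢
    refine Integrable.mono' i3 ?_ ((ae_restrict_iff' measurableSet_Ioc).2 (Eventually.of_forall hle))
    refine Measurable.aestronglyMeasurable ?_
    have := Real.measurable_log
    fun_prop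
  have i1 : IntervalIntegrable (fun t : ℝ => T t * (t * Real.log t ^ 2)⁻¹) volume 2 x := by
    refine (i4.add i2).congr_ae (Eventually.of_forall fun t => ?_)
    simp only [Pi.add_apply]
    ring
  have hsq : ∫ t in (2:ℝ)..x, (√t)⁻¹ ≤ 2 * √x := by
    have := intervalIntegral.integral_eq_sub_of_hasDerivAt (a := 2) (b := x) (f := fun t => 2 * √t)
      (f' := fun t => (√t)⁻¹) (by
        intro t ht
        rw [Set.uIcc_of_le hx] at ht
        have h1 : t ≠ 0 := by have := ht.1; positivity
        have := (Real.hasDerivAt_sqrt h1).const_mul 2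
        refine this.congr_deriv ?_
        field_simp) hcs.intervalIntegrable
    rw [this]
    have := Real.sqrt_nonneg 2
    linarith
  have hIntg : |∫ t in (2:ℝ)..x, (T t - t) * (t * Real.log t ^ 2)⁻¹| ≤
      8 * C * Real.exp (c ^ 2 / 2) * x * Real.exp (-c * √(Real.log x)) := by
    have := intervalIntegral.norm_integral_le_of_norm_le hx (Eventually.of_forall hle) i3
    rw [Real.norm_eq_abs] at this
    refine this.trans ?_
    rw [intervalIntegral.integral_const_mul]
    calc _ ≤ 4 * C * Real.exp (c ^ 2 / 2) * Real.exp (-c * √(Real.log x)) * √x * (2 * √x) := by gcongr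
      _ = 8 * C * Real.exp (c ^ 2 / 2) * (√x * √x) * Real.exp (-c * √(Real.log x)) := by ring
      _ = _ := by rw [Real.mul_self_sqrt (by linarith)]
  rw [abel b0 b1 hx, Li_eq hx]
  have e : (Real.log x)⁻¹ * T x + (∫ t in (2:ℝ)..x, T t * (t * Real.log t ^ 2)⁻¹) -
      (x / Real.log x - 2 / Real.log 2 + ∫ t in (2:ℝ)..x, t * (t * Real.log t ^ 2)⁻¹) =
      (T x - x) * (Real.log x)⁻¹ + (∫ t in (2:ℝ)..x, (T t - t) * (t * Real.log t ^ 2)⁻¹) + 2 / Real.log 2 := by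
    have : ∫ t in (2:ℝ)..x, (T t - t) * (t * Real.log t ^ 2)⁻¹ =
      (∫ t in (2:ℝ)..x, T t * (t * Real.log t ^ 2)⁻¹) - ∫ t in (2:ℝ)..x, t * (t * Real.log t ^ 2)⁻¹ := by
      rw [← intervalIntegral.integral_sub i1 i2]
      refine intervalIntegral.integral_congr fun t _ => ?_
      ring
    rw [this]; ring
  have hT1 : |(T x - x) * (Real.log x)⁻¹| ≤ 2 * C * x * Real.exp (-c * √(Real.log x)) := by
    have hl := log_two_le hx
    rw [abs_mul, abs_of_pos (by positivity : 0 < (Real.log x)⁻¹)]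
    calc _ ≤ (C * x * Real.exp (-c * √(Real.log x))) * (1 / 2)⁻¹ := by
          gcongr
          exact hθ x hx
      _ = _ := by ring
  have h4 : |2 / Real.log 2| ≤ 4 := by
    have hl := log_two_le (le_refl 2)
    rw [abs_of_pos (by positivity), div_le_iff₀ (by positivity)]
    linarith
  change |(Real.log x)⁻¹ * T x + (∫ t in (2:ℝ)..x, T t * (t * Real.log t ^ 2)⁻¹) - _| ≤ _
  rw [e]
  calc _ ≤ |(T x - x) * (Real.log x)⁻¹| + |∫ t in (2:ℝ)..x, (T t - t) * (t * Real.log t ^ 2)⁻¹| + |2 / Real.log 2| :=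
        abs_add_three _ _ _
    _ ≤ _ := by linarith
end D3
end EPI

namespace EPI
section D4
variable {K : Type*} [Field K] [NumberField K]

open Classical in
/-- weighted prime indicator. -/
def bK (K : Type*) [Field K] [NumberField K] (n : ℕ) : ℝ :=
  ∑ p ∈ pr K n, if absNorm p = n then Real.log n else 0

lemma pr_mono {m n : ℕ} (h : m ≤ n) : pr K m ⊆ pr K n := fun p hp => by
  rw [mem_pr] at hp ⊢; exact ⟨hp.1.trans h, hp.2⟩

open Classical in
lemma bK_eq {n N : ℕ} (h : n ≤ N) : bK K n = ∑ p ∈ pr K N, if absNorm p = n then Real.log n else 0 := by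
  rw [bK]
  refine Finset.sum_subset (pr_mono h) fun p h1 h2 => ?_
  rw [if_neg]
  intro h3
  exact h2 (mem_pr.2 ⟨h3.le, (mem_pr.1 h1).2⟩)

lemma sum_bK (N : ℕ) : ∑ n ∈ Finset.Icc 0 N, bK K n = ∑ p ∈ pr K N, Real.log (absNorm p) := by
  classical
  rw [Finset.sum_congr rfl fun n hn => bK_eq (Finset.mem_Icc.1 hn).2, Finset.sum_comm]
  refine Finset.sum_congr rfl fun p hp => ?_
  rw [Finset.sum_ite_eq, if_pos]
  exact Finset.mem_Icc.2 ⟨Nat.zero_le _, (mem_pr.1 hp).1⟩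

lemma sum_inv_bK (N : ℕ) : ∑ n ∈ Finset.Icc 0 N, (Real.log n)⁻¹ * bK K n = (pr K N).card := by
  classical
  have : ∀ n ∈ Finset.Icc 0 N, (Real.log n)⁻¹ * bK K n = ∑ p ∈ pr K N, if absNorm p = n then (1:ℝ) else 0 := by
    intro n hn
    rw [bK_eq (Finset.mem_Icc.1 hn).2, Finset.mul_sum]
    refine Finset.sum_congr rfl fun p hp => ?_
    split_ifs with h
    · have h2 := two_le_absNorm (mem_pr.1 hp).2.1 (mem_pr.1 hp).2.2
      rw [h] at h2
      refine inv_mul_cancel₀ (Real.log_pos ?_).ne'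
      exact_mod_cast (by omega : 1 < n)
    · simp
  rw [Finset.sum_congr rfl this, Finset.sum_comm, Finset.card_eq_sum_ones, Nat.cast_sum]
  refine Finset.sum_congr rfl fun p hp => ?_
  rw [Finset.sum_ite_eq, if_pos (Finset.mem_Icc.2 ⟨Nat.zero_le _, (mem_pr.1 hp).1⟩)]
  simp

lemma bK_zero : bK K 0 = 0 := by simp [bK]
lemma bK_one : bK K 1 = 0 := by simp [bK]

open Classical in
lemma sum_Lam (N : ℕ) : ∑ n ∈ Finset.Icc 1 N, Lam K n =
    ∑ p ∈ pr K N, ∑ k ∈ Finset.Icc 1 N, if absNorm p ^ k ≤ N then Real.log (absNorm p) else 0 := by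
  rw [Finset.sum_congr rfl fun n hn => Lam_eq (Finset.mem_Icc.1 hn).2, Finset.sum_comm]
  refine Finset.sum_congr rfl fun p hp => ?_
  rw [Finset.sum_comm]
  refine Finset.sum_congr rfl fun k hk => ?_
  rw [Finset.sum_ite_eq]
  have h2 := two_le_absNorm (mem_pr.1 hp).2.1 (mem_pr.1 hp).2.2
  have : 1 ≤ absNorm p ^ k := Nat.one_le_pow _ _ (by omega)
  refine if_congr ?_ rfl rfl
  rw [Finset.mem_Icc]; tauto

lemma theta_le (N : ℕ) : ∑ p ∈ pr K N, Real.log (absNorm p) ≤ ∑ n ∈ Finset.Icc 1 N, Lam K n := by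
  classical
  rw [sum_Lam]
  refine Finset.sum_le_sum fun p hp => ?_
  have hm := mem_pr.1 hp
  have h2 := two_le_absNorm hm.2.1 hm.2.2
  have := Finset.single_le_sum (f := fun k => if absNorm p ^ k ≤ N then Real.log (absNorm p) else 0)
    (s := Finset.Icc 1 N) (fun k _ => by
      split_ifs
      · exact log_absNorm_nonneg p
      · exact le_rfl) (Finset.mem_Icc.2 ⟨le_rfl, by omega⟩ : 1 ∈ Finset.Icc 1 N)
  simpa [hm.1] using this

lemma le_theta (N : ℕ) : ∑ n ∈ Finset.Icc 1 N, Lam K n ≤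
    ∑ p ∈ pr K N, Real.log (absNorm p) + (pr K (Nat.sqrt N)).card * Real.log N := by
  classical
  rw [sum_Lam, ← nsmul_eq_mul, ← Finset.sum_const]
  have : ∑ p ∈ pr K (Nat.sqrt N), Real.log N = ∑ p ∈ pr K N, if p ∈ pr K (Nat.sqrt N) then Real.log N else 0 := by
    rw [← Finset.sum_filter]
    congr 1
    ext p
    rw [Finset.mem_filter]
    exact ⟨fun h => ⟨pr_mono (Nat.sqrt_le_self N) h, h⟩, fun h => h.2⟩
  rw [this, ← Finset.sum_add_distrib]
  refine Finset.sum_le_sum fun p hp => ?_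
  have hm := mem_pr.1 hp
  have h2 := two_le_absNorm hm.2.1 hm.2.2
  split_ifs with h
  · rw [← Finset.sum_filter, Finset.sum_const, nsmul_eq_mul]
    have hsub : (Finset.Icc 1 N).filter (fun k => absNorm p ^ k ≤ N) ⊆ Finset.Icc 1 (Nat.log (absNorm p) N) := by
      intro k hk
      rw [Finset.mem_filter, Finset.mem_Icc] at hk
      exact Finset.mem_Icc.2 ⟨hk.1.1, Nat.le_log_of_pow_le (by omega) hk.2⟩
    have hc := Finset.card_le_card hsub
    rw [Nat.card_Icc, Nat.add_sub_cancel] at hc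
    have h3 : (Nat.log (absNorm p) N : ℝ) * Real.log (absNorm p) ≤ Real.log N := by
      rw [← Real.log_pow]
      refine Real.log_le_log (by positivity) ?_
      exact_mod_cast Nat.pow_log_le_self _ (by omega)
    have h4 := log_absNorm_nonneg p
    have h5 : (((Finset.Icc 1 N).filter (fun k => absNorm p ^ k ≤ N)).card : ℝ) ≤ (Nat.log (absNorm p) N : ℝ) := by
      exact_mod_cast hc
    have := mul_le_mul_of_nonneg_right h5 h4
    linarith
  · rw [add_zero]
    have h1 : N < absNorm p ^ 2 := by
      by_contra hcon
      apply h
      rw [mem_pr]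
      refine ⟨?_, hm.2⟩
      rw [Nat.le_sqrt']; omega
    rw [Finset.sum_eq_single_of_mem 1 (Finset.mem_Icc.2 ⟨le_rfl, by omega⟩)]
    · simp [hm.1]
    · intro k hk hk1
      rw [if_neg]
      have : 2 ≤ k := by rw [Finset.mem_Icc] at hk; omega
      have := Nat.pow_le_pow_right (by omega : 0 < absNorm p) this
      omega

lemma card_pr_le (N : ℕ) : ((pr K N).card : ℝ) ≤ Nsum (fun n => ((idn K n).card : ℝ)) N := by
  classical
  rw [Nsum, Nat.floor_natCast, ← Nat.cast_sum]
  norm_cast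
  have : pr K N ⊆ (Finset.Icc 1 N).biUnion (fun n => idn K n) := by
    intro p hp
    have hm := mem_pr.1 hp
    have h2 := two_le_absNorm hm.2.1 hm.2.2
    rw [Finset.mem_biUnion]
    exact ⟨absNorm p, Finset.mem_Icc.2 ⟨by omega, hm.1⟩, mem_idn.2 rfl⟩
  exact (Finset.card_le_card this).trans Finset.card_biUnion_le

/-- elementary comparison: `√x log x ≤ C x exp(-c √log x)`. -/
lemma sqrt_log_le {c x : ℝ} (hc : 0 < c) (hx : 1 ≤ x) :
    √x * Real.log x ≤ 4 * Real.exp (c ^ 2) * (x * Real.exp (-c * √(Real.log x))) := by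
  have hx0 : 0 < x := by linarith
  set L := Real.log x with hL
  have hL0 : 0 ≤ L := Real.log_nonneg hx
  have hxe : x = Real.exp L := (Real.exp_log hx0).symm
  have hse : √x = Real.exp (L / 2) := by
    rw [Real.sqrt_eq_iff_mul_self_eq hx0.le (Real.exp_pos _).le, ← Real.exp_add]
    rw [hxe]; congr 1; ring
  have h1 : L ≤ 4 * Real.exp (L / 4) := by
    have := Real.add_one_le_exp (L / 4)
    linarith
  have h2 : Real.exp (L / 2) * Real.exp (L / 4) ≤ Real.exp (c ^ 2) * (Real.exp L * Real.exp (-c * √L)) := by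
    rw [← Real.exp_add, ← Real.exp_add, ← Real.exp_add]
    apply Real.exp_le_exp.2
    have h3 := Real.sq_sqrt hL0
    nlinarith [sq_nonneg (√L / 2 - c)]
  rw [hse]
  calc Real.exp (L / 2) * L ≤ Real.exp (L / 2) * (4 * Real.exp (L / 4)) := by gcongr
    _ = 4 * (Real.exp (L / 2) * Real.exp (L / 4)) := by ring
    _ ≤ 4 * (Real.exp (c ^ 2) * (Real.exp L * Real.exp (-c * √L))) := by gcongr
    _ = _ := by rw [← hxe]; ring

set_option maxHeartbeats 1000000 in
theorem pr_bound {D C c x0 : ℝ} (hD : 0 < D) (hN : ∀ x : ℝ, 1 ≤ x → Nsum (fun n => ((idn K n).card : ℝ)) x ≤ D * x)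
    (hC : 0 < C) (hc : 0 < c) (hx0 : 2 ≤ x0)
    (hψ : ∀ x, x0 ≤ x → |(∑ n ∈ Finset.Icc 1 ⌊x⌋₊, Lam K n) - x| ≤ C * x * Real.exp (-c * √(Real.log x))) :
    ∃ C' : ℝ, 0 < C' ∧ ∀ x : ℝ, 2 ≤ x → |((pr K ⌊x⌋₊).card : ℝ) - ∫ t in (2:ℝ)..x, 1 / Real.log t| ≤
      C' * x * Real.exp (-c * √(Real.log x)) + 4 := by
  set T : ℝ → ℝ := fun t => ∑ n ∈ Finset.Icc 0 ⌊t⌋₊, bK K n with hT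
  have hbnn : ∀ n, 0 ≤ bK K n := by
    classical
    intro n
    exact Finset.sum_nonneg fun p _ => by
      split_ifs
      · exact Real.log_natCast_nonneg _
      · exact le_rfl
  have hlarge : ∀ t, x0 ≤ t → |T t - t| ≤ (C + D * (4 * Real.exp (c ^ 2))) * t * Real.exp (-c * √(Real.log t)) := by
    intro t ht
    have ht2 : 2 ≤ t := hx0.trans ht
    have h1 := theta_le (K := K) ⌊t⌋₊
    have h2 := le_theta (K := K) ⌊t⌋₊
    rw [← sum_bK] at h1 h2
    have h3 := hψ t ht
    have hf1 : 2 ≤ ⌊t⌋₊ := Nat.le_floor (by exact_mod_cast ht2)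
    have hs1 : 1 ≤ Nat.sqrt ⌊t⌋₊ := by rw [Nat.le_sqrt']; omega
    have hfl : (⌊t⌋₊ : ℝ) ≤ t := Nat.floor_le (by linarith)
    have h4 : ((pr K (Nat.sqrt ⌊t⌋₊)).card : ℝ) ≤ D * √t := by
      refine (card_pr_le _).trans ((hN _ (by exact_mod_cast hs1)).trans ?_)
      gcongr
      refine Real.le_sqrt_of_sq_le (le_trans ?_ hfl)
      exact_mod_cast Nat.sqrt_le' ⌊t⌋₊
    have h5 : Real.log ⌊t⌋₊ ≤ Real.log t := Real.log_le_log (by positivity) hfl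
    have h6 : ((pr K (Nat.sqrt ⌊t⌋₊)).card : ℝ) * Real.log ⌊t⌋₊ ≤ D * (√t * Real.log t) := by
      rw [← mul_assoc]
      refine mul_le_mul h4 h5 (Real.log_natCast_nonneg _) (by positivity)
    have h7 := mul_le_mul_of_nonneg_left (sqrt_log_le (x := t) hc (by linarith)) hD.le
    have h8 : 0 ≤ D * (√t * Real.log t) := by
      have := Real.log_nonneg (by linarith : 1 ≤ t)
      positivity
    rw [abs_le] at h3 ⊢
    change _ ≤ T t - t ∧ T t - t ≤ _
    change T t ≤ _ at h1
    change _ ≤ T t + _ at h2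
    have e : (C + D * (4 * Real.exp (c ^ 2))) * t * Real.exp (-c * √(Real.log t)) =
      C * t * Real.exp (-c * √(Real.log t)) + D * (4 * Real.exp (c ^ 2) * (t * Real.exp (-c * √(Real.log t)))) := by ring
    rw [e]
    constructor <;> linarith [h3.1, h3.2]
  set C1 := C + D * (4 * Real.exp (c ^ 2)) with hC1
  have hC1p : 0 < C1 := by positivity
  have hTmono : ∀ s t, s ≤ t → T s ≤ T t := by
    intro s t hst
    refine Finset.sum_le_sum_of_subset_of_nonneg (Finset.Icc_subset_Icc le_rfl (Nat.floor_le_floor hst)) fun n _ _ => hbnn n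
  have hTnn : ∀ t, 0 ≤ T t := fun t => Finset.sum_nonneg fun n _ => hbnn n
  set E := Real.exp (-c * √(Real.log x0)) with hE
  have hEp : 0 < E := Real.exp_pos _
  set C2 := (T x0 + x0) / (2 * E) with hC2
  have hC2p : 0 ≤ C2 := by have := hTnn x0; positivity
  have hall : ∀ t, 2 ≤ t → |T t - t| ≤ (C1 + C2) * t * Real.exp (-c * √(Real.log t)) := by
    intro t ht
    have hep := Real.exp_pos (-c * √(Real.log t))
    rcases le_total x0 t with h | h
    · refine (hlarge t h).trans ?_
      gcongr
      linarith
    · have h1 : |T t - t| ≤ T x0 + x0 := by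
        have := hTmono t x0 h
        have := hTnn t
        rw [abs_le]; constructor <;> linarith
      have h2 : E ≤ Real.exp (-c * √(Real.log t)) := by
        apply Real.exp_le_exp.2
        have : √(Real.log t) ≤ √(Real.log x0) := Real.sqrt_le_sqrt (Real.log_le_log (by linarith) h)
        nlinarith
      have h3 : T x0 + x0 = C2 * (2 * E) := by rw [hC2]; field_simp
      rw [h3] at h1
      refine h1.trans ?_
      calc C2 * (2 * E) ≤ C2 * (t * Real.exp (-c * √(Real.log t))) := by gcongr
        _ ≤ (C1 + C2) * (t * Real.exp (-c * √(Real.log t))) := by gcongr; linarith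
        _ = _ := by ring
  have hCC : 0 < C1 + C2 := by positivity
  refine ⟨2 * (C1 + C2) + 8 * (C1 + C2) * Real.exp (c ^ 2 / 2), by positivity, fun x hx => ?_⟩
  have := pi_of_theta bK_zero bK_one hCC hc hall hx
  rwa [sum_inv_bK] at this

/-- constants are absorbed -/
lemma five_le {c x : ℝ} (hc : 0 < c) (hx : 2 ≤ x) :
    5 ≤ 40 * Real.exp (c ^ 2) * (x * Real.exp (-c * √(Real.log x))) := by
  have h := sqrt_log_le hc (by linarith : 1 ≤ x)
  have h1 := log_two_le hx
  have h2 : 1 ≤ √x := Real.one_le_sqrt.2 (by linarith)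
  nlinarith

lemma count_eq {x : ℝ} (hx : 0 ≤ x) :
    Nat.card {p : Ideal (𝓞 K) // p.IsPrime ∧ p ∈ (Set.univ : Set (Ideal (𝓞 K))) ∧ (absNorm p : ℝ) ≤ x} = (pr K ⌊x⌋₊).card + 1 := by
  classical
  have hbot : (⊥ : Ideal (𝓞 K)) ∉ pr K ⌊x⌋₊ := fun h => (mem_pr.1 h).2.2 rfl
  rw [← Finset.card_insert_of_notMem hbot]
  refine Nat.subtype_card _ fun p => ?_
  rw [Finset.mem_insert, mem_pr]
  by_cases h : p = ⊥
  · subst h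
    simp [hx, Ideal.isPrime_bot]
  · simp only [h, false_or, Set.mem_univ, true_and, Nat.le_floor_iff hx]
    simp only [ne_eq, h, not_false_eq_true, and_true]
    tauto
end D4
end EPI

namespace EPI
section F1
open MeasureTheory
variable {E ι : Type*} [NormedAddCommGroup E] [NormedSpace ℝ E] [MeasurableSpace E] [BorelSpace E]
  [Finite ι] (b : Module.Basis ι ℝ E) (μ : Measure E) [μ.IsAddHaarMeasure]

lemma lattice_upper_finset {R : ℝ} (hR : ∀ x ∈ ZSpan.fundamentalDomain b, ‖x‖ ≤ R) {S S' : Set E}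
    (h : ∀ x ∈ S, ∀ v, ‖v‖ ≤ R → x + v ∈ S') (t : Finset E)
    (ht : (t : Set E) ⊆ S ∩ (Submodule.span ℤ (Set.range b) : Set E)) :
    (t.card : ENNReal) * μ (ZSpan.fundamentalDomain b) ≤ μ S' := by
  classical
  have := Fintype.ofFinite ι
  have hm := ZSpan.fundamentalDomain_measurableSet b
  have hd : Set.PairwiseDisjoint (t : Set E) (fun x : E => (fun y => x + y) '' ZSpan.fundamentalDomain b) := by
    intro x hx y hy hxy
    rw [Function.onFun, Set.disjoint_left]
    rintro z ⟨u, hu, rfl⟩ ⟨v, hv, hz⟩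
    apply hxy
    have h1 := ZSpan.fract_zSpan_add b u (ht hx).2
    have h2 := ZSpan.fract_zSpan_add b v (ht hy).2
    rw [(ZSpan.fract_eq_self).2 hu] at h1
    rw [(ZSpan.fract_eq_self).2 hv] at h2
    change y + v = x + u at hz
    rw [hz, h1] at h2
    rw [h2] at hz
    exact (add_right_cancel hz).symm
  have hmeas : ∀ x ∈ t, MeasurableSet ((fun y => x + y) '' ZSpan.fundamentalDomain b) := by
    intro x _
    exact ((MeasurableEquiv.addLeft x).measurableSet_image).2 hm
  have h1 := measure_biUnion_finset (μ := μ) hd hmeas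
  have h2 : ∀ x ∈ t, μ ((fun y => x + y) '' ZSpan.fundamentalDomain b) = μ (ZSpan.fundamentalDomain b) := by
    intro x _
    rw [Set.image_add_left, measure_preimage_add]
  rw [Finset.sum_congr rfl h2, Finset.sum_const, nsmul_eq_mul] at h1
  rw [← h1]
  refine measure_mono ?_
  intro z hz
  rw [Set.mem_iUnion₂] at hz
  obtain ⟨x, hx, y, hy, rfl⟩ := hz
  exact h x (ht hx).1 y (hR y hy)

lemma lattice_finite {R : ℝ} (hR : ∀ x ∈ ZSpan.fundamentalDomain b, ‖x‖ ≤ R) {S S' : Set E}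
    (h : ∀ x ∈ S, ∀ v, ‖v‖ ≤ R → x + v ∈ S') (hS' : μ S' ≠ ⊤) :
    (S ∩ (Submodule.span ℤ (Set.range b) : Set E)).Finite := by
  by_contra hinf
  have hinf : (S ∩ (Submodule.span ℤ (Set.range b) : Set E)).Infinite := hinf
  have h0 := ZSpan.measure_fundamentalDomain_ne_zero b (μ := μ)
  obtain ⟨n, hn⟩ := ENNReal.exists_nat_mul_gt h0 hS'
  obtain ⟨t, ht, rfl⟩ := hinf.exists_subset_card_eq n
  have := lattice_upper_finset b μ hR h t ht
  exact absurd (hn.trans_le this) (lt_irrefl _)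

lemma lattice_upper {R : ℝ} (hR : ∀ x ∈ ZSpan.fundamentalDomain b, ‖x‖ ≤ R) {S S' : Set E}
    (h : ∀ x ∈ S, ∀ v, ‖v‖ ≤ R → x + v ∈ S') (hS' : μ S' ≠ ⊤) :
    (Nat.card ↥(S ∩ (Submodule.span ℤ (Set.range b) : Set E)) : ENNReal) * μ (ZSpan.fundamentalDomain b) ≤ μ S' := by
  have hf := lattice_finite b μ hR h hS'
  have := lattice_upper_finset b μ hR h hf.toFinset (by simp)
  rwa [← Set.ncard_eq_toFinset_card _ hf, ← Nat.card_coe_set_eq] at this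

lemma lattice_lower {R : ℝ} (hR : ∀ x ∈ ZSpan.fundamentalDomain b, ‖x‖ ≤ R) {S S' : Set E}
    (h : ∀ x ∈ S', ∀ v, ‖v‖ ≤ R → x + v ∈ S)
    (hf : (S ∩ (Submodule.span ℤ (Set.range b) : Set E)).Finite) :
    μ S' ≤ (Nat.card ↥(S ∩ (Submodule.span ℤ (Set.range b) : Set E)) : ENNReal) * μ (ZSpan.fundamentalDomain b) := by
  classical
  have := Fintype.ofFinite ι
  have h2 : ∀ x ∈ hf.toFinset, μ ((fun y => x + y) '' ZSpan.fundamentalDomain b) = μ (ZSpan.fundamentalDomain b) := by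
    intro x _
    rw [Set.image_add_left, measure_preimage_add]
  have h1 := measure_biUnion_finset_le (μ := μ) hf.toFinset (fun x : E => (fun y => x + y) '' ZSpan.fundamentalDomain b)
  rw [Finset.sum_congr rfl h2, Finset.sum_const, nsmul_eq_mul, ← Set.ncard_eq_toFinset_card _ hf, ← Nat.card_coe_set_eq] at h1
  refine le_trans (measure_mono ?_) h1
  intro y hy
  rw [Set.mem_iUnion₂]
  refine ⟨(ZSpan.floor b y : E), ?_, ZSpan.fract b y, ZSpan.fract_mem_fundamentalDomain b y, ?_⟩
  · rw [Set.Finite.mem_toFinset]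
    refine ⟨?_, (ZSpan.floor b y).2⟩
    have := h y hy (-(ZSpan.fract b y)) (by rw [norm_neg]; exact hR _ (ZSpan.fract_mem_fundamentalDomain b y))
    rw [ZSpan.fract_apply] at this
    simpa using this
  · simp [ZSpan.fract_apply]
end F1
end EPI

namespace EPI
section F2
open MeasureTheory NumberField.InfinitePlace NumberField.mixedEmbedding NumberField.mixedEmbedding.fundamentalCone NumberField.Units NumberField.Units.dirichletUnitTheorem
variable (K : Type*) [Field K] [NumberField K]

open Classical in
/-- Parameter boxes. -/
def pbox (a b p q : ℝ) : Set (realSpace K) :=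
  Set.univ.pi fun w => if w = w₀ then Set.Ioc a b else Set.Ico p q

/-- Regions of the mixed space whose log-parameters lie in a box. -/
def Bx (a b p q : ℝ) : Set (mixedSpace K) := normAtAllPlaces ⁻¹' (expMapBasis '' pbox K a b p q)

variable {K}
lemma mem_pbox {a b p q : ℝ} {u : realSpace K} : u ∈ pbox K a b p q ↔
    (a < u w₀ ∧ u w₀ ≤ b) ∧ ∀ w, w ≠ w₀ → p ≤ u w ∧ u w < q := by
  classical
  simp only [pbox, Set.mem_univ_pi]
  constructor
  · intro h
    refine ⟨by simpa using h w₀, fun w hw => by simpa [hw] using h w⟩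
  · rintro ⟨h1, h2⟩ w
    split_ifs with hw
    · subst hw; exact h1
    · exact h2 w hw

lemma measurableSet_pbox (a b p q : ℝ) : MeasurableSet (pbox K a b p q) := by
  classical
  refine MeasurableSet.univ_pi fun w => ?_
  split_ifs
  · exact measurableSet_Ioc
  · exact measurableSet_Ico

lemma measurableSet_Bx (a b p q : ℝ) : MeasurableSet (Bx K a b p q) := by
  refine (continuous_normAtAllPlaces K).measurable ?_
  exact (measurableSet_pbox a b p q).image_of_continuousOn_injOn (continuous_expMapBasis K).continuousOn
    (injective_expMapBasis K).injOn

open ENNReal in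
lemma lintegral_pbox {a b p q : ℝ} (hab : a ≤ b) (hpq : p ≤ q) {n : ℕ} (hn : 0 < n) :
    ∫⁻ (x : realSpace K) in pbox K a b p q, .ofReal (Real.exp (x w₀ * n)) =
      ENNReal.ofReal ((n:ℝ)⁻¹ * (Real.exp (n * b) - Real.exp (n * a)) * (q - p) ^ (rank K)) := by
  classical
  have hn : 0 < (n : ℝ) := Nat.cast_pos.mpr hn
  rw [volume_pi, pbox, Measure.restrict_pi_pi, lintegral_eq_lmarginal_univ 0,
    lmarginal_erase' _ (by fun_prop) (Finset.mem_univ w₀), if_pos rfl]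
  simp_rw [Function.update_self, lmarginal, lintegral_const, Measure.pi_univ, if_neg
    (Finset.ne_of_mem_erase (Subtype.prop _)), Measure.restrict_apply_univ, Real.volume_Ico, mul_comm _ (n : ℝ)]
  have hIntg : IntegrableOn (fun x : ℝ => Real.exp (n * x)) (Set.Ioc a b) :=
    (Continuous.integrableOn_Icc (by fun_prop)).mono_set Set.Ioc_subset_Icc_self
  have hi : ∫ x in Set.Ioc a b, Real.exp (n * x) = (n:ℝ)⁻¹ * (Real.exp (n * b) - Real.exp (n * a)) := by
    rw [← intervalIntegral.integral_of_le hab, intervalIntegral.integral_comp_mul_left _ hn.ne', integral_exp, smul_eq_mul]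
  rw [← ofReal_integral_eq_lintegral_ofReal hIntg (by filter_upwards with _ using Real.exp_nonneg _), hi,
    Finset.prod_const]
  have hc : (Finset.univ : Finset ↥(Finset.univ.erase (w₀ : InfinitePlace K))).card = rank K := by
    rw [Finset.card_univ, Fintype.card_coe, Finset.card_erase_of_mem (Finset.mem_univ _), Finset.card_univ]; rfl
  rw [hc, ← ofReal_pow (by linarith), ← ofReal_mul]
  have : Real.exp (n * a) ≤ Real.exp (n * b) := Real.exp_le_exp.2 (by gcongr)
  have : 0 ≤ Real.exp (n * b) - Real.exp (n * a) := by linarith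
  positivity

variable (K) in
/-- the volume constant. -/
def vK : ℝ := 2 ^ nrRealPlaces K * Real.pi ^ nrComplexPlaces K * regulator K

variable (K) in
lemma vK_pos : 0 < vK K := by
  have := regulator_pos K
  unfold vK
  positivity

open scoped Classical in
open ENNReal in
lemma volume_Bx {a b p q : ℝ} (hab : a ≤ b) (hpq : p ≤ q) :
    volume (Bx K a b p q) = ENNReal.ofReal (vK K * (Real.exp (Module.finrank ℚ K * b) - Real.exp (Module.finrank ℚ K * a))
      * (q - p) ^ (rank K)) := by
  classical
  have himg : normAtAllPlaces '' (Bx K a b p q) = expMapBasis '' pbox K a b p q :=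
    normAtAllPlaces_image_preimage_expMapBasis _
  rw [volume_eq_two_pow_mul_two_pi_pow_mul_integral (by rw [himg]; rfl) (measurableSet_Bx a b p q), himg,
    setLIntegral_expMapBasis_image (measurableSet_pbox a b p q) (by fun_prop)]
  have hfr : 0 < Module.finrank ℚ K := Module.finrank_pos
  have h1 : ∀ x : realSpace K, ENNReal.ofReal (Real.exp (x w₀ * Module.finrank ℚ K)) *
          (∏ i : {w : InfinitePlace K // IsComplex w},
            ENNReal.ofReal (expMapBasis (fun w ↦ x w) i))⁻¹ * (∏ w : {w : InfinitePlace K // IsComplex w}, ENNReal.ofReal (expMapBasis x w.1)) =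
      ENNReal.ofReal (Real.exp (x w₀ * Module.finrank ℚ K)) := by
    intro x
    rw [mul_assoc, ENNReal.inv_mul_cancel, mul_one]
    · exact Finset.prod_ne_zero_iff.2 fun w _ => (ENNReal.ofReal_pos.2 (expMapBasis_pos _ _)).ne'
    · exact ENNReal.prod_ne_top fun w _ => ENNReal.ofReal_ne_top
  simp_rw [h1]
  rw [lintegral_pbox hab hpq hfr]
  have h2 : (2 : ENNReal) = ENNReal.ofReal 2 := by simp
  have h3 : (Module.finrank ℚ K : ENNReal) = ENNReal.ofReal (Module.finrank ℚ K) := by simp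
  have hreg := (regulator_pos K).le
  rw [h2, h3, ← ENNReal.ofReal_inv_of_pos two_pos, ← ENNReal.ofReal_pow (by positivity), ← ENNReal.ofReal_pow (by positivity),
    ← ENNReal.ofReal_pow (by positivity), ← ENNReal.ofReal_mul (by positivity), ← ENNReal.ofReal_mul (by positivity), ← ENNReal.ofReal_mul (by positivity),
    ← ENNReal.ofReal_mul (by positivity), ← ENNReal.ofReal_mul (by positivity)]
  congr 1
  rw [vK, mul_pow]
  have : (Module.finrank ℚ K : ℝ) ≠ 0 := by positivity
  field_simp
  rw [← mul_pow]
  norm_num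

lemma mem_Bx {a b p q : ℝ} {x : mixedSpace K} : x ∈ Bx K a b p q ↔
    (∀ w, 0 < normAtPlace w x) ∧ expMapBasis.symm (normAtAllPlaces x) ∈ pbox K a b p q := by
  rw [Bx, Set.mem_preimage]
  constructor
  · rintro ⟨u, hu, h⟩
    refine ⟨fun w => ?_, ?_⟩
    · rw [← normAtAllPlaces_apply, ← h]; exact expMapBasis_pos _ _
    · rw [← h, expMapBasis.left_inv (by rw [expMapBasis_source]; trivial)]
      exact hu
  · rintro ⟨h1, h2⟩
    exact ⟨_, h2, expMapBasis.right_inv (Set.mem_univ_pi.mpr h1)⟩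

variable (K) in
lemma exists_min : ∃ m : ℝ, 0 < m ∧ ∀ u : realSpace K, (∀ w, w ≠ w₀ → -1 ≤ u w ∧ u w ≤ 2) →
    ∀ w, m * Real.exp (u w₀) ≤ expMapBasis u w := by
  classical
  have hcomp : IsCompact (Set.univ.pi fun w : InfinitePlace K => if w = w₀ then ({0} : Set ℝ) else Set.Icc (-1) 2) := by
    refine isCompact_univ_pi fun w ↦ ?_
    split_ifs
    · exact isCompact_singleton
    · exact isCompact_Icc
  have hne : (Set.univ.pi fun w : InfinitePlace K => if w = w₀ then ({0} : Set ℝ) else Set.Icc (-1) 2).Nonempty := by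
    refine ⟨0, fun w _ => ?_⟩
    dsimp only
    split_ifs <;> simp
  have h1 : ∀ w : InfinitePlace K, ∃ m : ℝ, 0 < m ∧ ∀ u ∈ (Set.univ.pi fun w : InfinitePlace K => if w = w₀ then ({0} : Set ℝ) else Set.Icc (-1) 2),
      m ≤ expMapBasis u w := by
    intro w
    obtain ⟨u0, _, h⟩ := hcomp.exists_isMinOn hne (f := fun u => expMapBasis u w)
      ((continuous_apply w).comp (continuous_expMapBasis K)).continuousOn
    exact ⟨expMapBasis u0 w, expMapBasis_pos _ _, fun u hu => h hu⟩
  choose m hm hm2 using h1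
  refine ⟨Finset.univ.inf' Finset.univ_nonempty m, (Finset.lt_inf'_iff _).2 fun w _ => hm w, fun u hu w => ?_⟩
  rw [expMapBasis_apply'', Pi.smul_apply, smul_eq_mul, mul_comm]
  gcongr
  refine (Finset.inf'_le _ (Finset.mem_univ w)).trans (hm2 w _ ?_)
  intro i _
  dsimp only
  split_ifs with h
  · rfl
  · exact hu i h

lemma log_diff {y y' e : ℝ} (hy : 0 < y) (h : |y' - y| ≤ e) (he : e ≤ y / 2) :
    0 < y' ∧ |Real.log y' - Real.log y| ≤ 2 * e / y := by
  rw [abs_le] at h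
  have hy' : 0 < y' := by linarith
  refine ⟨hy', ?_⟩
  have h1 : Real.log y' - Real.log y ≤ (y' - y) / y := by
    have := Real.log_le_sub_one_of_pos (div_pos hy' hy)
    rw [Real.log_div hy'.ne' hy.ne'] at this
    rw [sub_div, div_self hy.ne']; exact this
  have h2 : Real.log y - Real.log y' ≤ (y - y') / y' := by
    have := Real.log_le_sub_one_of_pos (div_pos hy hy')
    rw [Real.log_div hy.ne' hy'.ne'] at this
    rw [sub_div, div_self hy'.ne']; exact this
  have he0 : 0 ≤ e := by linarith
  have h3 : (y' - y) / y ≤ 2 * e / y := by gcongr; linarith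
  have h4 : (y - y') / y' ≤ 2 * e / y := by
    rw [div_le_div_iff₀ hy' hy]
    nlinarith
  rw [abs_le]; constructor <;> linarith

variable (K) in
open scoped Classical in
lemma perturb : ∃ M : ℝ, 0 < M ∧ ∀ (a b p q R : ℝ), -1 ≤ p → q ≤ 2 → 0 ≤ R → M * R * Real.exp (-a) ≤ 1 →
    ∀ x ∈ Bx K a b p q, ∀ v : mixedSpace K, ‖v‖ ≤ R →
    x + v ∈ Bx K (a - M * R * Real.exp (-a)) (b + M * R * Real.exp (-a)) (p - M * R * Real.exp (-a)) (q + M * R * Real.exp (-a)) := by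
  obtain ⟨m, hm, hmin⟩ := exists_min K
  set L : realSpace K →L[ℝ] realSpace K := ((completeBasis K).equivFunL : realSpace K →L[ℝ] realSpace K) with hL
  refine ⟨4 * (‖L‖ + 1) / m, by positivity, fun a b p q R hp hq hR hη x hx v hv => ?_⟩
  set η := 4 * (‖L‖ + 1) / m * R * Real.exp (-a) with hηdef
  obtain ⟨hx1, hx2⟩ := mem_Bx.1 hx
  set u := expMapBasis.symm (normAtAllPlaces x) with hu
  have hxu : expMapBasis u = normAtAllPlaces x := expMapBasis.right_inv (Set.mem_univ_pi.mpr hx1)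
  have hub := mem_pbox.1 hx2
  have hlow : ∀ w, m * Real.exp a ≤ normAtPlace w x := by
    intro w
    have := hmin u (fun w hw => ⟨hp.trans (hub.2 w hw).1, (hub.2 w hw).2.le.trans hq⟩) w
    rw [hxu, normAtAllPlaces_apply] at this
    refine le_trans ?_ this
    gcongr
    exact hub.1.1.le
  have hea : Real.exp (-a) * Real.exp a = 1 := by rw [← Real.exp_add]; simp
  have hRm : R ≤ m * Real.exp a / 4 := by
    have h1 : 4 * R * Real.exp (-a) ≤ m := by
      have : 4 * 1 / m * R * Real.exp (-a) ≤ η := by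
        rw [hηdef]; gcongr; linarith [norm_nonneg L]
      have := this.trans hη
      rw [mul_one, div_mul_eq_mul_div, div_mul_eq_mul_div, div_le_one hm] at this
      exact this
    have h2 := mul_le_mul_of_nonneg_right h1 (Real.exp_pos a).le
    rw [mul_assoc, hea] at h2
    linarith
  have hdiff : ∀ w, |normAtPlace w (x + v) - normAtPlace w x| ≤ R := by
    intro w
    have hvw : normAtPlace w v ≤ R := by
      refine le_trans ?_ hv
      rw [norm_eq_sup'_normAtPlace]
      exact Finset.le_sup' (fun w => normAtPlace w v) (Finset.mem_univ w)
    have h1 := normAtPlace_add_le w x v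
    have h2 := normAtPlace_add_le w (x + v) (-v)
    rw [normAtPlace_neg, add_neg_cancel_right] at h2
    rw [abs_le]; constructor <;> linarith
  have hlog := fun w => log_diff (hx1 w) (hdiff w) (by have := hlow w; have := hx1 w; linarith)
  rw [mem_Bx]
  refine ⟨fun w => (hlog w).1, ?_⟩
  set u' := expMapBasis.symm (normAtAllPlaces (x + v)) with hu'
  have hsub : u' - u = L (expMap.symm (normAtAllPlaces (x + v)) - expMap.symm (normAtAllPlaces x)) := by
    rw [map_sub]; rfl
  have hd : ‖expMap.symm (normAtAllPlaces (x + v)) - expMap.symm (normAtAllPlaces x)‖ ≤ 4 * R / (m * Real.exp a) := by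
    rw [pi_norm_le_iff_of_nonneg (by positivity)]
    intro w
    rw [Pi.sub_apply, expMap_symm_apply, expMap_symm_apply, ← mul_sub, Real.norm_eq_abs, abs_mul,
      normAtAllPlaces_apply, normAtAllPlaces_apply]
    have h1 := (hlog w).2
    have h2 : 2 * R / normAtPlace w x ≤ 2 * R / (m * Real.exp a) := by
      gcongr; exact hlow w
    have h3 : |(w.mult : ℝ)| ≤ 2 := by
      rw [abs_of_nonneg (by positivity)]
      have : w.mult ≤ 2 := by unfold InfinitePlace.mult; split_ifs <;> simp
      exact_mod_cast this
    calc _ ≤ 2 * (2 * R / (m * Real.exp a)) := by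
          refine mul_le_mul h3 (h1.trans h2) (abs_nonneg _) (by norm_num)
      _ = _ := by ring
  have hnorm : ‖u' - u‖ ≤ η := by
    rw [hsub]
    refine (L.le_opNorm _).trans ?_
    calc ‖L‖ * _ ≤ (‖L‖ + 1) * (4 * R / (m * Real.exp a)) := by
          gcongr; linarith
      _ = η := by
          rw [hηdef, Real.exp_neg]; field_simp
  have hw : ∀ w, |u' w - u w| ≤ η := fun w => by
    have := (norm_le_pi_norm (u' - u) w).trans hnorm
    rwa [Pi.sub_apply, Real.norm_eq_abs] at this
  rw [mem_pbox]
  refine ⟨?_, fun w hne => ?_⟩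
  · have := abs_le.1 (hw w₀)
    constructor <;> linarith [hub.1.1, hub.1.2]
  · have := abs_le.1 (hw w)
    have := hub.2 w hne
    constructor <;> linarith
end F2
end EPI

namespace EPI
section F3
open MeasureTheory NumberField.InfinitePlace NumberField.mixedEmbedding NumberField.mixedEmbedding.fundamentalCone NumberField.Units NumberField.Units.dirichletUnitTheorem
open scoped nonZeroDivisors
variable {K : Type*} [Field K] [NumberField K]

lemma Bx_mono {a b p q a' b' p' q' : ℝ} (h1 : a' ≤ a) (h2 : b ≤ b') (h3 : p' ≤ p) (h4 : q ≤ q') :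
    Bx K a b p q ⊆ Bx K a' b' p' q' := by
  intro x hx
  rw [mem_Bx] at hx ⊢
  refine ⟨hx.1, ?_⟩
  have := mem_pbox.1 hx.2
  rw [mem_pbox]
  exact ⟨⟨h1.trans_lt this.1.1, this.1.2.trans h2⟩, fun w hw => ⟨h3.trans (this.2 w hw).1, (this.2 w hw).2.trans_le h4⟩⟩

lemma mem_Bx_iff {a b : ℝ} {x : mixedSpace K} : x ∈ Bx K a b 0 1 ↔ x ∈ fundamentalCone K ∧
    Real.exp (Module.finrank ℚ K * a) < mixedEmbedding.norm x ∧ mixedEmbedding.norm x ≤ Real.exp (Module.finrank ℚ K * b) := by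
  classical
  have hn : 0 < Module.finrank ℚ K := Module.finrank_pos
  have key : ∀ u : realSpace K, expMapBasis u = normAtAllPlaces x →
      ((u ∈ pbox K a b 0 1) ↔ x ∈ fundamentalCone K ∧
    Real.exp (Module.finrank ℚ K * a) < mixedEmbedding.norm x ∧ mixedEmbedding.norm x ≤ Real.exp (Module.finrank ℚ K * b)) := by
    intro u hu
    rw [← norm_normAtAllPlaces, ← normAtAllPlaces_mem_fundamentalCone_iff, ← hu, norm_expMapBasis, fundamentalCone,
      Set.mem_sdiff, Set.mem_preimage, logMap_expMapBasis, mem_pbox, ← Real.exp_nat_mul, Real.exp_lt_exp, Real.exp_le_exp]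
    have h1 : expMapBasis u |> mixedSpaceOfRealSpace |> mixedEmbedding.norm |> (· ≠ 0) := norm_expMapBasis_ne_zero u
    have hn' : (0:ℝ) < Module.finrank ℚ K := by exact_mod_cast hn
    rw [mul_lt_mul_iff_right₀ hn', mul_le_mul_iff_right₀ hn']
    simp only [Set.mem_Ico, Set.mem_ofPred_eq]
    constructor
    · rintro ⟨h2, h3⟩
      exact ⟨⟨h3, h1⟩, h2⟩
    · rintro ⟨⟨h3, _⟩, h2⟩
      exact ⟨h2, h3⟩
  constructor
  · intro h
    obtain ⟨h1, h2⟩ := mem_Bx.1 h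
    exact (key _ (expMapBasis.right_inv (Set.mem_univ_pi.mpr h1))).1 h2
  · intro h
    have h1 : ∀ w, 0 < normAtPlace w x := fun w => normAtPlace_pos_of_mem h.1 w
    exact mem_Bx.2 ⟨h1, (key _ (expMapBasis.right_inv (Set.mem_univ_pi.mpr h1))).2 h⟩

open scoped Classical in
lemma cone_bounded (s : ℝ) : Bornology.IsBounded {x : mixedSpace K | x ∈ fundamentalCone K ∧ mixedEmbedding.norm x ≤ s} := by
  have hn : 0 < Module.finrank ℚ K := Module.finrank_pos
  obtain ⟨B, hB⟩ := (isBounded_normLeOne K).exists_norm_le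
  set S := max s 1
  have hS : 0 < S := by positivity
  set c := S ^ ((Module.finrank ℚ K : ℝ)⁻¹) with hc
  have hc0 : 0 < c := Real.rpow_pos_of_pos hS _
  have hcn : c ^ (Module.finrank ℚ K) = S := Real.rpow_inv_natCast_pow hS.le hn.ne'
  refine isBounded_iff_forall_norm_le.2 ⟨c * B, fun x hx => ?_⟩
  have h1 : c⁻¹ • x ∈ normLeOne K := by
    rw [mem_normLeOne]
    refine ⟨(smul_mem_iff_mem (inv_ne_zero hc0.ne')).2 hx.1, ?_⟩
    rw [mixedEmbedding.norm_smul, abs_of_pos (inv_pos.2 hc0), inv_pow, hcn, inv_mul_le_iff₀ hS, mul_one]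
    exact hx.2.trans (le_max_left _ _)
  have h2 := hB _ h1
  rw [_root_.norm_smul, Real.norm_eq_abs, abs_of_pos (inv_pos.2 hc0), inv_mul_le_iff₀ hc0] at h2
  exact h2

variable (K) in
/-- number of elements of the ideal set of norm at most `s`. -/
def AJ (J : (Ideal (𝓞 K))⁰) (s : ℝ) : ℕ := Nat.card {a : idealSet K J // mixedEmbedding.norm (a : mixedSpace K) ≤ s}

lemma AJ_eq (J : (Ideal (𝓞 K))⁰) (s : ℝ) : AJ K J s =
    Set.ncard ({x : mixedSpace K | x ∈ fundamentalCone K ∧ mixedEmbedding.norm x ≤ s} ∩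
      (Submodule.span ℤ (Set.range (fractionalIdealLatticeBasis K (FractionalIdeal.mk0 K J))) : Set (mixedSpace K))) := by
  rw [AJ, ← Nat.card_coe_set_eq]
  refine Nat.card_congr ((Equiv.subtypeSubtypeEquivSubtypeInter (fun x => x ∈ idealSet K J)
    (fun x => mixedEmbedding.norm x ≤ s)).trans (Equiv.subtypeEquivRight fun x => ?_))
  rw [Set.mem_inter_iff, SetLike.mem_coe, span_idealLatticeBasis, idealSet, Set.mem_inter_iff, SetLike.mem_coe, Set.mem_ofPred_eq]
  change _ ↔ (_ ∧ _) ∧ x ∈ mixedEmbedding.idealLattice K (FractionalIdeal.mk0 K J)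
  tauto

open scoped Classical in
lemma cone_finite (J : (Ideal (𝓞 K))⁰) (s : ℝ) : ({x : mixedSpace K | x ∈ fundamentalCone K ∧ mixedEmbedding.norm x ≤ s} ∩
      (Submodule.span ℤ (Set.range (fractionalIdealLatticeBasis K (FractionalIdeal.mk0 K J))) : Set (mixedSpace K))).Finite :=
  ZSpan.setFinite_inter _ (cone_bounded s)

lemma AJ_mono (J : (Ideal (𝓞 K))⁰) {s t : ℝ} (h : s ≤ t) : AJ K J s ≤ AJ K J t := by
  rw [AJ_eq, AJ_eq]
  exact Set.ncard_le_ncard (Set.inter_subset_inter_left _ fun x hx => ⟨hx.1, hx.2.trans h⟩) (cone_finite J t)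

lemma AJ_split (J : (Ideal (𝓞 K))⁰) {a b : ℝ} (hab : a ≤ b) : AJ K J (Real.exp (Module.finrank ℚ K * b)) =
    AJ K J (Real.exp (Module.finrank ℚ K * a)) + Nat.card ↥(Bx K a b 0 1 ∩
      (Submodule.span ℤ (Set.range (fractionalIdealLatticeBasis K (FractionalIdeal.mk0 K J))) : Set (mixedSpace K))) := by
  have hfin : (Bx K a b 0 1 ∩
      (Submodule.span ℤ (Set.range (fractionalIdealLatticeBasis K (FractionalIdeal.mk0 K J))) : Set (mixedSpace K))).Finite :=
    (cone_finite J (Real.exp (Module.finrank ℚ K * b))).subset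
      (Set.inter_subset_inter_left _ fun x hx => ⟨(mem_Bx_iff.1 hx).1, (mem_Bx_iff.1 hx).2.2⟩)
  have hdisj : Disjoint ({x : mixedSpace K | x ∈ fundamentalCone K ∧ mixedEmbedding.norm x ≤ Real.exp (Module.finrank ℚ K * a)} ∩
      (Submodule.span ℤ (Set.range (fractionalIdealLatticeBasis K (FractionalIdeal.mk0 K J))) : Set (mixedSpace K)))
      (Bx K a b 0 1 ∩
      (Submodule.span ℤ (Set.range (fractionalIdealLatticeBasis K (FractionalIdeal.mk0 K J))) : Set (mixedSpace K))) := by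
    rw [Set.disjoint_left]
    intro x hx hx'
    have h1 := hx.1.2
    have h2 := (mem_Bx_iff.1 hx'.1).2.1
    linarith
  rw [AJ_eq, AJ_eq, Nat.card_coe_set_eq, ← Set.ncard_union_eq hdisj (cone_finite J _) hfin]
  rw [← Set.union_inter_distrib_right]
  congr 2
  ext x
  rw [Set.mem_union, mem_Bx_iff, Set.mem_ofPred_eq, Set.mem_ofPred_eq]
  have : Real.exp (Module.finrank ℚ K * a) ≤ Real.exp (Module.finrank ℚ K * b) := Real.exp_le_exp.2 (by gcongr)
  constructor
  · rintro ⟨h1, h2⟩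
    rcases le_or_gt (mixedEmbedding.norm x) (Real.exp (Module.finrank ℚ K * a)) with h | h
    · exact Or.inl ⟨h1, h⟩
    · exact Or.inr ⟨h1, h, h2⟩
  · rintro (⟨h1, h2⟩ | ⟨h1, _, h2⟩)
    · exact ⟨h1, h2.trans this⟩
    · exact ⟨h1, h2⟩
end F3
end EPI

namespace EPI
section F4
open MeasureTheory NumberField.InfinitePlace NumberField.mixedEmbedding NumberField.mixedEmbedding.fundamentalCone NumberField.Units NumberField.Units.dirichletUnitTheorem
open scoped nonZeroDivisors
variable {K : Type*} [Field K] [NumberField K]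

open scoped Classical in
lemma box_bounds (J : (Ideal (𝓞 K))⁰) : ∃ F G : ℝ, 0 < F ∧ 0 < G ∧ ∀ a b : ℝ, G * Real.exp (-a) ≤ 1 / 4 →
    a + G * Real.exp (-a) ≤ b - G * Real.exp (-a) →
    (Nat.card ↥(Bx K a b 0 1 ∩
      (Submodule.span ℤ (Set.range (fractionalIdealLatticeBasis K (FractionalIdeal.mk0 K J))) : Set (mixedSpace K))) : ℝ) * F ≤
      vK K * (Real.exp (Module.finrank ℚ K * (b + G * Real.exp (-a))) - Real.exp (Module.finrank ℚ K * (a - G * Real.exp (-a))))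
        * (1 + 2 * (G * Real.exp (-a))) ^ (rank K) ∧
    vK K * (Real.exp (Module.finrank ℚ K * (b - G * Real.exp (-a))) - Real.exp (Module.finrank ℚ K * (a + G * Real.exp (-a))))
        * (1 - 2 * (G * Real.exp (-a))) ^ (rank K) ≤ (Nat.card ↥(Bx K a b 0 1 ∩
      (Submodule.span ℤ (Set.range (fractionalIdealLatticeBasis K (FractionalIdeal.mk0 K J))) : Set (mixedSpace K))) : ℝ) * F := by
  obtain ⟨M, hM, hp⟩ := perturb K
  set bb := fractionalIdealLatticeBasis K (FractionalIdeal.mk0 K J) with hbb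
  obtain ⟨R0, hR0⟩ := (ZSpan.fundamentalDomain_isBounded bb).exists_norm_le
  set R := max R0 1
  have hR : ∀ x ∈ ZSpan.fundamentalDomain bb, ‖x‖ ≤ R := fun x hx => (hR0 x hx).trans (le_max_left _ _)
  have hRpos : 0 < R := lt_of_lt_of_le one_pos (le_max_right _ _)
  have hFtop : volume (ZSpan.fundamentalDomain bb) ≠ ⊤ :=
    (ZSpan.fundamentalDomain_isBounded bb).measure_lt_top.ne
  have hF0 : volume (ZSpan.fundamentalDomain bb) ≠ 0 := ZSpan.measure_fundamentalDomain_ne_zero bb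
  refine ⟨(volume (ZSpan.fundamentalDomain bb)).toReal, M * R, ENNReal.toReal_pos hF0 hFtop, by positivity, ?_⟩
  intro a b hη hab
  set η := M * R * Real.exp (-a) with hηdef
  have hη0 : 0 < η := by positivity
  have hV := vK_pos K
  have hup : ∀ x ∈ Bx K a b 0 1, ∀ v : mixedSpace K, ‖v‖ ≤ R → x + v ∈ Bx K (a - η) (b + η) (0 - η) (1 + η) :=
    hp a b 0 1 R (by norm_num) (by norm_num) hRpos.le (by linarith)
  have hvu := volume_Bx (K := K) (a := a - η) (b := b + η) (p := 0 - η) (q := 1 + η) (by linarith) (by linarith)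
  have htop : volume (Bx K (a - η) (b + η) (0 - η) (1 + η)) ≠ ⊤ := by rw [hvu]; exact ENNReal.ofReal_ne_top
  have hfin := lattice_finite bb volume hR hup htop
  constructor
  · have h1 := lattice_upper bb volume hR hup htop
    rw [hvu] at h1
    have hnn : 0 ≤ vK K * (Real.exp (Module.finrank ℚ K * (b + η)) - Real.exp (Module.finrank ℚ K * (a - η)))
        * (1 + η - (0 - η)) ^ (rank K) := by
      have : Real.exp (Module.finrank ℚ K * (a - η)) ≤ Real.exp (Module.finrank ℚ K * (b + η)) := by
        apply Real.exp_le_exp.2; gcongr; linarith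
      have h2 : 0 ≤ 1 + η - (0 - η) := by linarith
      have h3 := sub_nonneg.2 this
      positivity
    have h2 := ENNReal.toReal_mono ENNReal.ofReal_ne_top h1
    rw [ENNReal.toReal_ofReal hnn, ENNReal.toReal_mul, ENNReal.toReal_natCast] at h2
    refine h2.trans (le_of_eq ?_)
    ring_nf
  · have hη1 : M * R * Real.exp (-(a + η)) ≤ η := by
      rw [hηdef]
      have : Real.exp (-(a + M * R * Real.exp (-a))) ≤ Real.exp (-a) := Real.exp_le_exp.2 (by linarith)
      gcongr
    have hlo : ∀ x ∈ Bx K (a + η) (b - η) η (1 - η), ∀ v : mixedSpace K, ‖v‖ ≤ R → x + v ∈ Bx K a b 0 1 := by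
      intro x hx v hv
      refine Bx_mono ?_ ?_ ?_ ?_ (hp (a + η) (b - η) η (1 - η) R (by linarith) (by linarith) hRpos.le (by linarith) x hx v hv)
      all_goals linarith
    have h1 := lattice_lower bb volume hR hlo hfin
    rw [volume_Bx (by linarith) (by linarith)] at h1
    have hnn : 0 ≤ vK K * (Real.exp (Module.finrank ℚ K * (b - η)) - Real.exp (Module.finrank ℚ K * (a + η)))
        * (1 - η - η) ^ (rank K) := by
      have : Real.exp (Module.finrank ℚ K * (a + η)) ≤ Real.exp (Module.finrank ℚ K * (b - η)) := by
        apply Real.exp_le_exp.2; gcongr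
      have h2 : 0 ≤ 1 - η - η := by linarith
      have h3 := sub_nonneg.2 this
      positivity
    have h2 := ENNReal.toReal_mono (ENNReal.mul_ne_top (ENNReal.natCast_ne_top _) hFtop) h1
    rw [ENNReal.toReal_ofReal hnn, ENNReal.toReal_mul, ENNReal.toReal_natCast] at h2
    refine le_trans (le_of_eq ?_) h2
    ring_nf

/-- the numerical part -/
lemma box_num {V F c n a η : ℝ} {r : ℕ} (hV : 0 < V) (hF : 0 < F) (hn : 1 ≤ n) (hη0 : 0 < η) (hη : η ≤ 1 / 4)
    (h1 : c * F ≤ V * (Real.exp (n * (2 * a + η)) - Real.exp (n * (a - η))) * (1 + 2 * η) ^ r)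
    (h2 : V * (Real.exp (n * (2 * a - η)) - Real.exp (n * (a + η))) * (1 - 2 * η) ^ r ≤ c * F) :
    |c - V / F * Real.exp (n * (2 * a))| ≤ V / F * ((n + 4 * r) * Real.exp (n + 4 * r) * η * Real.exp (n * (2 * a)) + Real.exp n * Real.exp (n * a)) := by
  set S := Real.exp (n * (2 * a)) with hS
  have hS0 : 0 < S := Real.exp_pos _
  set k : ℝ := n + 4 * r with hk
  have hr : (0:ℝ) ≤ r := Nat.cast_nonneg r
  have hk1 : 1 ≤ k := by linarith
  have hup : c * F ≤ V * (S * (1 + k * Real.exp k * η)) := by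
    refine h1.trans ?_
    rw [mul_assoc]
    refine mul_le_mul_of_nonneg_left ?_ hV.le
    calc (Real.exp (n * (2 * a + η)) - Real.exp (n * (a - η))) * (1 + 2 * η) ^ r
        ≤ Real.exp (n * (2 * a + η)) * (1 + 2 * η) ^ r := by
          gcongr; linarith [Real.exp_pos (n * (a - η))]
      _ ≤ Real.exp (n * (2 * a + η)) * Real.exp (2 * η) ^ r := by
          gcongr; linarith [Real.add_one_le_exp (2 * η)]
      _ = S * Real.exp ((n + 2 * r) * η) := by
          rw [hS, ← Real.exp_nat_mul, ← Real.exp_add, ← Real.exp_add]; congr 1; ring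
      _ ≤ S * Real.exp (k * η) := by
          have : (n + 2 * r) * η ≤ k * η := by
            apply mul_le_mul_of_nonneg_right _ hη0.le; linarith
          gcongr
      _ ≤ S * (1 + k * Real.exp k * η) := by
          gcongr
          have e1 : Real.exp (k * η) ≤ 1 + k * η * Real.exp (k * η) := by
            have := Real.add_one_le_exp (-(k * η))
            have h3 : Real.exp (-(k * η)) * Real.exp (k * η) = 1 := by rw [← Real.exp_add]; simp
            have h4 := Real.exp_pos (k * η)
            nlinarith
          have e2 : Real.exp (k * η) ≤ Real.exp k := Real.exp_le_exp.2 (by nlinarith)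
          have e3 : k * η * Real.exp (k * η) ≤ k * η * Real.exp k := by gcongr
          linarith
  have hlo : V * (S * (1 - k * η) - Real.exp n * Real.exp (n * a)) ≤ c * F := by
    refine le_trans ?_ h2
    rw [mul_assoc]
    refine mul_le_mul_of_nonneg_left ?_ hV.le
    have g1 : 0 ≤ 1 - 2 * η := by linarith
    have g2 : (1 - 2 * η) ^ r ≤ 1 := pow_le_one₀ g1 (by linarith)
    have g3 : Real.exp (-(4 * η)) ≤ 1 - 2 * η := by
      have := Real.add_one_le_exp (4 * η)
      have h3 : Real.exp (-(4 * η)) * Real.exp (4 * η) = 1 := by rw [← Real.exp_add]; simp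
      have h4 := Real.exp_pos (-(4 * η))
      have h5 : (1 - 2 * η) * (4 * η + 1) ≥ 1 := by nlinarith
      have h6 : 1 ≤ (1 - 2 * η) * Real.exp (4 * η) := by nlinarith
      have h7 := Real.exp_pos (4 * η)
      nlinarith
    have g4 : S * (1 - k * η) ≤ Real.exp (n * (2 * a - η)) * (1 - 2 * η) ^ r := by
      calc S * (1 - k * η) ≤ S * Real.exp (-(k * η)) := by
            gcongr; linarith [Real.add_one_le_exp (-(k * η))]
        _ = Real.exp (n * (2 * a - η)) * Real.exp (-(4 * η)) ^ r := by
            rw [hS, ← Real.exp_nat_mul, ← Real.exp_add, ← Real.exp_add]; congr 1; rw [hk]; ring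
        _ ≤ _ := by gcongr
    have g5 : Real.exp (n * (a + η)) * (1 - 2 * η) ^ r ≤ Real.exp n * Real.exp (n * a) := by
      calc Real.exp (n * (a + η)) * (1 - 2 * η) ^ r ≤ Real.exp (n * (a + η)) * 1 := by gcongr
        _ ≤ Real.exp n * Real.exp (n * a) := by
            rw [mul_one, ← Real.exp_add]; apply Real.exp_le_exp.2; nlinarith
    nlinarith
  have hc : c - V / F * S = (c * F - V * S) / F := by field_simp
  rw [hc, abs_div, abs_of_pos hF, div_mul_eq_mul_div]
  gcongr
  have hek : 1 ≤ Real.exp k := Real.one_le_exp (by linarith)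
  have i1 : V * (S * (k * η)) ≤ V * (S * (k * Real.exp k * η)) := by
    gcongr; nlinarith
  have i2 : 0 ≤ V * (Real.exp n * Real.exp (n * a)) := by positivity
  rw [abs_le]
  constructor <;> nlinarith
end F4
end EPI

namespace EPI
section F5
open MeasureTheory NumberField.InfinitePlace NumberField.mixedEmbedding NumberField.mixedEmbedding.fundamentalCone NumberField.Units NumberField.Units.dirichletUnitTheorem
open scoped nonZeroDivisors
variable {K : Type*} [Field K] [NumberField K]

/-- number of ideals in a class. -/
def NC (C : ClassGroup (𝓞 K)) (s : ℝ) : ℕ :=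
  Nat.card {I : (Ideal (𝓞 K))⁰ // absNorm (I : Ideal (𝓞 K)) ≤ s ∧ ClassGroup.mk0 I = C}

lemma NC_eq {C : ClassGroup (𝓞 K)} {J : (Ideal (𝓞 K))⁰} (hJ : ClassGroup.mk0 J = C⁻¹) (s : ℝ) :
    NC C s * torsionOrder K = AJ K J (s * absNorm (J : Ideal (𝓞 K))) := by
  rw [AJ, ← card_isPrincipal_dvd_norm_le, NC]
  congr 1
  simp_rw [← nonZeroDivisors_dvd_iff_dvd_coe]
  refine Nat.card_congr ?_
  refine ((Equiv.dvd J).subtypeEquiv fun I ↦ ?_).trans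
    (Equiv.subtypeSubtypeEquivSubtypeInter (fun I : (Ideal (𝓞 K))⁰ ↦ J ∣ I) _)
  rw [← ClassGroup.mk0_eq_one_iff (SetLike.coe_mem _)]
  simp_rw [Equiv.dvd_apply, Submonoid.coe_mul, ← Submonoid.mul_def, _root_.map_mul, hJ,
    inv_mul_eq_one, Nat.cast_mul, mul_comm s, eq_comm, and_comm, and_congr_left_iff]
  exact fun _ ↦
    (mul_le_mul_iff_of_pos_left (Nat.cast_pos.mpr (absNorm_pos_of_nonZeroDivisors J))).symm

lemma AJ_eventually (J : (Ideal (𝓞 K))⁰) : ∃ D : ℝ, 0 < D ∧ ∀ᶠ s in atTop, (AJ K J s : ℝ) ≤ D * s := by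
  set C := (ClassGroup.mk0 J)⁻¹ with hC
  have hJ : ClassGroup.mk0 J = C⁻¹ := by rw [hC, inv_inv]
  have hN : (0:ℝ) < absNorm (J : Ideal (𝓞 K)) := Nat.cast_pos.mpr (absNorm_pos_of_nonZeroDivisors J)
  have hw : (0:ℝ) < torsionOrder K := Nat.cast_pos.2 (Nat.pos_of_ne_zero (torsionOrder_ne_zero K))
  have ht := NumberField.Ideal.tendsto_norm_le_and_mk_eq_div_atTop K C
  set L := ((2 ^ nrRealPlaces K * (2 * Real.pi) ^ nrComplexPlaces K * regulator K) /
            (torsionOrder K * Real.sqrt |discr K|)) with hL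
  have hL0 : 0 ≤ L := by
    have := (regulator_pos K).le
    positivity
  have h1 : ∀ᶠ s : ℝ in atTop, (NC C s : ℝ) / s ≤ L + 1 := ht.eventually_le_const (by linarith)
  have h2 := (tendsto_id.atTop_div_const hN).eventually h1
  refine ⟨(L + 1) * torsionOrder K / absNorm (J : Ideal (𝓞 K)), by positivity, ?_⟩
  filter_upwards [h2, eventually_gt_atTop 0] with s hs hs0
  have h3 := NC_eq hJ (s / absNorm (J : Ideal (𝓞 K)))
  rw [div_mul_cancel₀ _ hN.ne'] at h3
  rw [← h3, Nat.cast_mul]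
  simp only [id_eq] at hs
  rw [div_le_iff₀ (by positivity)] at hs
  calc _ ≤ (L + 1) * (s / absNorm (J : Ideal (𝓞 K))) * torsionOrder K := by gcongr
    _ = _ := by ring

lemma AJ_large (J : (Ideal (𝓞 K))⁰) : ∃ κ C a0 : ℝ, 0 < κ ∧ 0 < C ∧ 0 ≤ a0 ∧ ∀ a, a0 ≤ a →
    |(AJ K J (Real.exp (Module.finrank ℚ K * (2 * a))) : ℝ) - κ * Real.exp (Module.finrank ℚ K * (2 * a))| ≤
      C * (Real.exp (Module.finrank ℚ K * (2 * a)) * Real.exp (-a)) := by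
  obtain ⟨F, G, hF, hG, hb⟩ := box_bounds J
  obtain ⟨D, hD, hDe⟩ := AJ_eventually J
  have hV := vK_pos K
  have hn : (1:ℝ) ≤ Module.finrank ℚ K := by exact_mod_cast (Module.finrank_pos : 0 < Module.finrank ℚ K)
  set n : ℝ := ((Module.finrank ℚ K : ℕ) : ℝ) with hndef
  have hev1 : ∀ᶠ a : ℝ in atTop, (AJ K J (Real.exp (n * a)) : ℝ) ≤ D * Real.exp (n * a) :=
    (Real.tendsto_exp_atTop.comp (tendsto_id.const_mul_atTop (by linarith : 0 < n))).eventually hDe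
  have hev2 : ∀ᶠ a : ℝ in atTop, G * Real.exp (-a) ≤ 1 / 4 := by
    have : Tendsto (fun a : ℝ => G * Real.exp (-a)) atTop (nhds (G * 0)) :=
      (Real.tendsto_exp_neg_atTop_nhds_zero).const_mul G
    rw [mul_zero] at this
    exact this.eventually_le_const (by norm_num)
  obtain ⟨a1, ha1⟩ := eventually_atTop.1 (hev1.and hev2)
  set k : ℝ := n + 4 * (rank K : ℕ) with hk
  have hk0 : 0 < k := by positivity
  refine ⟨vK K / F, D + vK K / F * (k * Real.exp k * G + Real.exp n), max a1 1, by positivity, by positivity, by positivity, ?_⟩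
  intro a ha
  have haa : 1 ≤ a := (le_max_right _ _).trans ha
  obtain ⟨h1, h2⟩ := ha1 a ((le_max_left _ _).trans ha)
  have hsp := AJ_split J (a := a) (b := 2 * a) (by linarith)
  rw [← hndef] at hsp
  obtain ⟨b1, b2⟩ := hb a (2 * a) h2 (by linarith)
  have hbn := box_num hV hF hn (by positivity) h2 b1 b2
  rw [hsp]
  push_cast
  have hS : Real.exp (n * a) ≤ Real.exp (n * (2 * a)) * Real.exp (-a) := by
    rw [← Real.exp_add]; apply Real.exp_le_exp.2; nlinarith
  set c : ℝ := (Nat.card ↥(Bx K a (2 * a) 0 1 ∩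
      (Submodule.span ℤ (Set.range (fractionalIdealLatticeBasis K (FractionalIdeal.mk0 K J))) : Set (mixedSpace K))) : ℝ)
  have e1 : |(AJ K J (Real.exp (n * a)) : ℝ)| ≤ D * (Real.exp (n * (2 * a)) * Real.exp (-a)) := by
    rw [abs_of_nonneg (Nat.cast_nonneg _)]
    exact h1.trans (by gcongr)
  have e2 : vK K / F * (k * Real.exp k * (G * Real.exp (-a)) * Real.exp (n * (2 * a)) + Real.exp n * Real.exp (n * a))
      ≤ vK K / F * (k * Real.exp k * G + Real.exp n) * (Real.exp (n * (2 * a)) * Real.exp (-a)) := by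
    calc _ ≤ vK K / F * (k * Real.exp k * (G * Real.exp (-a)) * Real.exp (n * (2 * a)) + Real.exp n * (Real.exp (n * (2 * a)) * Real.exp (-a))) := by gcongr
      _ = _ := by ring
  have e3 := abs_add_le (AJ K J (Real.exp (n * a)) : ℝ) (c - vK K / F * Real.exp (n * (2 * a)))
  rw [add_sub_assoc, add_mul]
  linarith

lemma AJ_asymp (J : (Ideal (𝓞 K))⁰) : ∃ κ C : ℝ, 0 < κ ∧ 0 < C ∧ ∀ s, 1 ≤ s →
    |(AJ K J s : ℝ) - κ * s| ≤ C * s ^ (1 - 1 / (2 * (Module.finrank ℚ K : ℝ))) := by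
  obtain ⟨κ, C, a0, hκ, hC, ha0, h⟩ := AJ_large J
  have hn : (1:ℝ) ≤ Module.finrank ℚ K := by exact_mod_cast (Module.finrank_pos : 0 < Module.finrank ℚ K)
  set n : ℝ := ((Module.finrank ℚ K : ℕ) : ℝ) with hndef
  set s0 := Real.exp (n * (2 * a0)) with hs0
  refine ⟨κ, C + ((AJ K J s0 : ℝ) + κ * s0), hκ, by positivity, fun s hs => ?_⟩
  have hs' : 0 < s := by linarith
  have hexp : 0 ≤ 1 - 1 / (2 * n) := by
    rw [sub_nonneg, div_le_one (by positivity)]; linarith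
  have hone : 1 ≤ s ^ (1 - 1 / (2 * n)) := Real.one_le_rpow hs hexp
  have hZ : 0 ≤ (AJ K J s0 : ℝ) + κ * s0 := by positivity
  rw [add_mul]
  rcases le_total s s0 with hle | hle
  · have h1 : (AJ K J s : ℝ) ≤ AJ K J s0 := by exact_mod_cast AJ_mono J hle
    have h2 : κ * s ≤ κ * s0 := by gcongr
    have h3 : (0:ℝ) ≤ AJ K J s := Nat.cast_nonneg _
    have h4 : 0 ≤ κ * s := by positivity
    have h5 : |(AJ K J s : ℝ) - κ * s| ≤ (AJ K J s0 : ℝ) + κ * s0 := by rw [abs_le]; constructor <;> linarith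
    have h6 : 0 ≤ C * s ^ (1 - 1 / (2 * n)) := by positivity
    nlinarith
  · have ha : a0 ≤ Real.log s / (2 * n) := by
      rw [le_div_iff₀ (by positivity)]
      have := Real.log_le_log (Real.exp_pos _) hle
      rw [Real.log_exp] at this
      linarith
    have h1 := h _ ha
    have h2 : n * (2 * (Real.log s / (2 * n))) = Real.log s := by field_simp
    rw [h2, Real.exp_log hs'] at h1
    have h3 : s ^ (1 - 1 / (2 * n)) = s * Real.exp (-(Real.log s / (2 * n))) := by
      rw [Real.rpow_def_of_pos hs']
      nth_rewrite 2 [← Real.exp_log hs']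
      rw [← Real.exp_add]; congr 1; ring
    rw [← h3] at h1
    have : 0 ≤ ((AJ K J s0 : ℝ) + κ * s0) * s ^ (1 - 1 / (2 * n)) := by positivity
    linarith

lemma NC_asymp (C : ClassGroup (𝓞 K)) : ∃ κ B : ℝ, 0 < κ ∧ 0 < B ∧ ∀ s, 1 ≤ s →
    |(NC C s : ℝ) - κ * s| ≤ B * s ^ (1 - 1 / (2 * (Module.finrank ℚ K : ℝ))) := by
  obtain ⟨J, hJ⟩ := ClassGroup.mk0_surjective C⁻¹
  obtain ⟨κ, B, hκ, hB, h⟩ := AJ_asymp J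
  have hN1 : (1:ℝ) ≤ absNorm (J : Ideal (𝓞 K)) := by exact_mod_cast absNorm_pos_of_nonZeroDivisors J
  have hw : (0:ℝ) < torsionOrder K := Nat.cast_pos.2 (Nat.pos_of_ne_zero (torsionOrder_ne_zero K))
  set N : ℝ := ((absNorm (J : Ideal (𝓞 K)) : ℕ) : ℝ) with hN
  have hN0 : 0 < N := by linarith
  set w : ℝ := ((torsionOrder K : ℕ) : ℝ) with hwd
  set θ := 1 - 1 / (2 * (Module.finrank ℚ K : ℝ))
  refine ⟨κ * N / w, B * N ^ θ / w, by positivity, by positivity, fun s hs => ?_⟩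
  have h1 := h (s * N) (by nlinarith)
  have h2 : (NC C s : ℝ) * w = AJ K J (s * N) := by rw [hwd, hN]; exact_mod_cast NC_eq hJ s
  rw [← h2, Real.mul_rpow (by linarith) hN0.le] at h1
  have h3 : (NC C s : ℝ) - κ * N / w * s = ((NC C s : ℝ) * w - κ * (s * N)) / w := by field_simp
  rw [h3, abs_div, abs_of_pos hw, div_le_iff₀ hw]
  refine h1.trans (le_of_eq ?_)
  field_simp
end F5
end EPI

namespace EPI
section F6
open scoped nonZeroDivisors
variable {K : Type*} [Field K] [NumberField K]

open scoped Classical in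
/-- class of an ideal -/
def cl (I : Ideal (𝓞 K)) : ClassGroup (𝓞 K) := if h : I ∈ (Ideal (𝓞 K))⁰ then ClassGroup.mk0 ⟨I, h⟩ else 1

open scoped Classical in
variable (K) in
/-- nonzero ideals of norm at most `m` -/
def idle (m : ℕ) : Finset (Ideal (𝓞 K)) := (Finset.Icc 1 m).biUnion (idn K)

lemma mem_idle {m : ℕ} {I : Ideal (𝓞 K)} : I ∈ idle K m ↔ 1 ≤ absNorm I ∧ absNorm I ≤ m := by
  classical
  simp [idle, mem_idn]

lemma card_idle (m : ℕ) : (idle K m).card = ∑ n ∈ Finset.Icc 1 m, (idn K n).card := by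
  classical
  rw [idle, Finset.card_biUnion]
  intro i _ j _ hij
  change Disjoint (idn K i) (idn K j)
  rw [Finset.disjoint_left]
  intro I h1 h2
  rw [mem_idn] at h1 h2
  exact hij (h1.symm.trans h2)

open scoped Classical in
lemma NC_eq_card (C : ClassGroup (𝓞 K)) {s : ℝ} (hs : 0 ≤ s) :
    NC C s = ((idle K ⌊s⌋₊).filter (fun I => cl I = C)).card := by
  rw [NC, ← Fintype.card_coe, ← Nat.card_eq_fintype_card]
  have hmem : ∀ I : Ideal (𝓞 K), I ∈ (Ideal (𝓞 K))⁰ ↔ 1 ≤ absNorm I := by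
    intro I
    rw [mem_nonZeroDivisors_iff_ne_zero, Nat.one_le_iff_ne_zero, Ne, Ne, Ideal.absNorm_eq_zero_iff]
    rfl
  refine Nat.card_congr
    { toFun := fun I => ⟨I.1.1, ?_⟩
      invFun := fun I => ⟨⟨I.1, (hmem _).2 (mem_idle.1 (Finset.mem_filter.1 I.2).1).1⟩, ?_⟩
      left_inv := fun I => rfl
      right_inv := fun I => rfl }
  · rw [Finset.mem_filter, mem_idle]
    refine ⟨⟨(hmem _).1 I.1.2, Nat.le_floor I.2.1⟩, ?_⟩
    rw [cl, dif_pos I.1.2]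
    exact I.2.2
  · obtain ⟨h1, h2⟩ := Finset.mem_filter.1 I.2
    have h3 := mem_idle.1 h1
    refine ⟨(Nat.le_floor_iff hs).1 h3.2, ?_⟩
    rw [cl, dif_pos ((hmem _).2 h3.1)] at h2
    exact h2

lemma Nsum_eq {s : ℝ} (hs : 0 ≤ s) :
    Nsum (fun n => ((idn K n).card : ℝ)) s = ∑ C : ClassGroup (𝓞 K), (NC C s : ℝ) := by
  classical
  rw [Nsum, ← Nat.cast_sum, ← card_idle, ← Nat.cast_sum]
  congr 1
  rw [Finset.card_eq_sum_card_fiberwise (f := cl) (t := Finset.univ) (fun _ _ => Finset.mem_univ _)]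
  exact Finset.sum_congr rfl fun C _ => (NC_eq_card C hs).symm

variable (K) in
lemma ideal_count : ∃ κ B δ : ℝ, 0 < κ ∧ 0 < B ∧ 0 < δ ∧ δ ≤ 1 ∧ ∀ x, 1 ≤ x →
    |Nsum (fun n => ((idn K n).card : ℝ)) x - κ * x| ≤ B * x ^ (1 - δ) := by
  have hn : (1:ℝ) ≤ Module.finrank ℚ K := by exact_mod_cast (Module.finrank_pos : 0 < Module.finrank ℚ K)
  choose κ B hκ hB h using fun C : ClassGroup (𝓞 K) => NC_asymp C
  refine ⟨∑ C, κ C, ∑ C, B C, 1 / (2 * (Module.finrank ℚ K : ℝ)),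
    Finset.sum_pos (fun C _ => hκ C) Finset.univ_nonempty,
    Finset.sum_pos (fun C _ => hB C) Finset.univ_nonempty, by positivity, ?_, fun x hx => ?_⟩
  · rw [div_le_one (by positivity)]; linarith
  · rw [Nsum_eq (by linarith), Finset.sum_mul, ← Finset.sum_sub_distrib, Finset.sum_mul]
    exact (Finset.abs_sum_le_sum_abs _ _).trans (Finset.sum_le_sum fun C _ => h C x hx)
end F6
end EPI

namespace EPI
section G
variable (K : Type*) [Field K] [NumberField K]

theorem final : ∃ C₁ : ℝ, 0 < C₁ ∧ ∃ C₂ : ℝ, 0 < C₂ ∧ ∃ X₀ : ℝ, ∀ X : ℝ, X₀ ≤ X →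
    |(Nat.card {p : Ideal (𝓞 K) // p.IsPrime ∧ p ∈ (Set.univ : Set (Ideal (𝓞 K))) ∧ (absNorm p : ℝ) ≤ X} : ℝ)
      - ∫ t in (2:ℝ)..X, 1 / Real.log t| ≤ C₁ * X * Real.exp (-C₂ * Real.sqrt (Real.log X)) := by
  obtain ⟨κ, B, δ, hκ, hB, hδ, hδ1, hN⟩ := ideal_count K
  obtain ⟨H, δ', A, c', hyp⟩ := exists_hyp (a := fun n => ((idn K n).card : ℝ)) (Λ := Lam K)
    (fun n => Nat.cast_nonneg _) (by simp [card_idn_one]) Lam_nonneg Lam_zero Lam_one Lam_le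
    (fun n hn => conv_eq hn) hB hδ hδ1 hκ hN
  obtain ⟨C, c, x0, hC, hc, hx0, hψ⟩ := hyp.psi_bound
  have hN' : ∀ x, 1 ≤ x → Nsum (fun n => ((idn K n).card : ℝ)) x ≤ (κ + B) * x := by
    intro x hx
    have h1 := (abs_le.1 (hN x hx)).2
    have h2 : x ^ (1 - δ) ≤ x := by
      calc x ^ (1 - δ) ≤ x ^ (1:ℝ) := Real.rpow_le_rpow_of_exponent_le hx (by linarith)
        _ = x := Real.rpow_one x
    have h3 : B * x ^ (1 - δ) ≤ B * x := by gcongr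
    linarith
  obtain ⟨C', hC', hpr⟩ := pr_bound (K := K) (by positivity) hN' hC hc hx0 hψ
  refine ⟨C' + 40 * Real.exp (c ^ 2), by positivity, c, hc, 2, fun X hX => ?_⟩
  rw [count_eq (by linarith)]
  push_cast
  have h1 := hpr X hX
  have h2 := five_le hc hX
  have h3 := abs_le.1 h1
  rw [abs_le]
  constructor <;> nlinarith
end G
end EPI

namespace AlladiGen

variable (K : Type*) [Field K] [NumberField K]

/-- Effective prime ideal theorem. -/
theorem effective_prime_ideal_theorem :
    ∃ C₁ : ℝ, 0 < C₁ ∧ ∃ C₂ : ℝ, 0 < C₂ ∧ ∃ X₀ : ℝ, ∀ X : ℝ, X₀ ≤ X →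
      |(primeCount K Set.univ X : ℝ) - Li X| ≤
        C₁ * X * Real.exp (-C₂ * Real.sqrt (Real.log X)) := by
  exact EPI.final K

end AlladiGen
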